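/- arXiv:math/0608796 — 2 statements merged into one kernel-verified Lean document; each statement's English description precedes it below -/
import Mathlib

section
/- The only solutions to the equation p^a − p^b + 1 = x^2 in positive integers (x, p, a, b) with a > b and p an odd prime are (x, p, a, b) = (5, 3, 3, 1) and (x, p, a, b) = (11, 5, 3, 1). -/
/-- The element `1 + √(1-Q)` of norm `Q`. -/
def al (Q : ℤ) : ℤ√(1 - Q) := ⟨1, 1⟩

/-- Real part of the powers of `al`. -/
def W (Q : ℤ) (n : ℕ) : ℤ := (al Q ^ n).re

/-- Imaginary part of the powers of `al`: the Lucas sequence. -/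
def U (Q : ℤ) (n : ℕ) : ℤ := (al Q ^ n).im

theorem W_zero (Q : ℤ) : W Q 0 = 1 := by simp [W]
theorem U_zero (Q : ℤ) : U Q 0 = 0 := by simp [U]
theorem W_succ (Q : ℤ) (n : ℕ) : W Q (n + 1) = W Q n + (1 - Q) * U Q n := by
  simp [W, U, pow_succ, al]
theorem U_succ (Q : ℤ) (n : ℕ) : U Q (n + 1) = W Q n + U Q n := by
  simp [W, U, pow_succ, al]
theorem W_add (Q : ℤ) (m n : ℕ) : W Q (m + n) = W Q m * W Q n + (1 - Q) * U Q m * U Q n := by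
  simp [W, U, pow_add]
theorem U_add (Q : ℤ) (m n : ℕ) : U Q (m + n) = W Q m * U Q n + U Q m * W Q n := by
  simp [W, U, pow_add]

theorem norm_WU (Q : ℤ) (n : ℕ) : W Q n ^ 2 + (Q - 1) * U Q n ^ 2 = Q ^ n := by
  induction n with
  | zero => simp [W_zero, U_zero]
  | succ n ih => rw [W_succ, U_succ, pow_succ Q, ← ih]; ring

theorem W_mod (Q : ℤ) (n : ℕ) : (Q - 1) ∣ W Q n - 1 := by
  induction n with
  | zero => simp [W_zero]
  | succ n ih =>
    rw [W_succ]
    have : W Q n + (1 - Q) * U Q n - 1 = (W Q n - 1) - (Q - 1) * U Q n := by ring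
    rw [this]; exact dvd_sub ih (dvd_mul_right _ _)

theorem U_mod (Q : ℤ) (n : ℕ) : (Q - 1) ∣ U Q n - n := by
  induction n with
  | zero => simp [U_zero]
  | succ n ih =>
    rw [U_succ]
    have : W Q n + U Q n - ((n + 1 : ℕ) : ℤ) = (W Q n - 1) + (U Q n - n) := by push_cast; ring
    rw [this]; exact dvd_add (W_mod Q n) ih

theorem UW_modQ (Q : ℤ) (n : ℕ) : Q ∣ U Q (n + 1) - 2 ^ n ∧ Q ∣ W Q (n + 1) - 2 ^ n := by
  induction n with
  | zero => simp [U_succ, W_succ, U_zero, W_zero]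
  | succ n ih =>
    obtain ⟨⟨r, hr⟩, ⟨s, hs⟩⟩ := ih
    rw [U_succ, W_succ Q (n + 1)]
    refine ⟨⟨r + s, ?_⟩, ⟨r + s - U Q (n + 1), ?_⟩⟩
    · rw [pow_succ]; linear_combination hr + hs
    · rw [pow_succ]; linear_combination hr + hs

theorem descent (p b : ℕ) (hp : p.Prime) (hodd : Odd p) (hb : 0 < b)
    (Q : ℤ) (hQ : Q = (p : ℤ) ^ b) :
    ∀ (a : ℕ) (z : ℤ√(1 - Q)),
      z.re ^ 2 + (Q - 1) * z.im ^ 2 = (p : ℤ) ^ a →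
      ¬ ((p : ℤ) ∣ z.re ∧ (p : ℤ) ∣ z.im) →
      ∃ m, a = b * m ∧ (z = al Q ^ m ∨ z = - al Q ^ m ∨
        z = star (al Q) ^ m ∨ z = - star (al Q) ^ m) := by
  intro a
  have hpZ : Prime (p : ℤ) := Nat.prime_iff_prime_int.mp hp
  have hp3 : 3 ≤ p := by
    have := hp.two_le
    rcases hodd with ⟨k, hk⟩; omega
  have hpb : (p : ℤ) ∣ Q := hQ ▸ dvd_pow_self _ hb.ne'
  induction a using Nat.strong_induction_on with
  | _ a ih =>
  intro z hz hprim
  by_cases hab : a < b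
  · -- then `z.im = 0`
    have h1 : (p : ℤ) ^ (a + 1) ≤ Q := hQ ▸
      pow_le_pow_right₀ (by exact_mod_cast hp.one_le) hab
    have h2 : (1 : ℤ) ≤ (p : ℤ) ^ a := one_le_pow₀ (by exact_mod_cast hp.one_le)
    rw [pow_succ] at h1
    have h3 : (3 : ℤ) ≤ p := by exact_mod_cast hp3
    have h4 : (p : ℤ) ^ a < Q - 1 := by nlinarith
    have him : z.im = 0 := by
      by_contra h
      have : 1 ≤ z.im ^ 2 := by
        have := sq_pos_of_ne_zero h
        omega
      nlinarith [sq_nonneg z.re]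
    rw [him] at hz hprim
    have ha0 : a = 0 := by
      by_contra h
      apply hprim
      refine ⟨?_, dvd_zero _⟩
      apply hpZ.dvd_of_dvd_pow (n := 2)
      have : z.re ^ 2 = (p : ℤ) ^ a := by linarith
      rw [this]; exact dvd_pow_self _ h
    subst ha0
    refine ⟨0, by simp, ?_⟩
    have : z.re ^ 2 = 1 := by simpa using hz
    rcases (sq_eq_sq_iff_eq_or_eq_neg.mp (this.trans (one_pow 2).symm)) with h | h
    · left; ext <;> simp [h, him]
    · right; left; ext <;> simp [h, him]
  · push Not at hab
    have hsplit : (p : ℤ) ^ a = Q * (p : ℤ) ^ (a - b) := by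
      rw [hQ, ← pow_add]; congr 1; omega
    have hprod : Q ∣ (z.im - z.re) * (z.im + z.re) := by
      refine ⟨z.im ^ 2 - (p : ℤ) ^ (a - b), ?_⟩
      linear_combination -hz - hsplit
    have hQ0 : Q ≠ 0 := hQ ▸ pow_ne_zero _ hpZ.ne_zero
    have hcop : ¬ ((p : ℤ) ∣ z.im - z.re ∧ (p : ℤ) ∣ z.im + z.re) := by
      rintro ⟨h1, h2⟩
      have h2p : ¬ (p : ℤ) ∣ 2 := by
        intro h
        have := Int.le_of_dvd (by norm_num) h
        have h3 : (3 : ℤ) ≤ p := by exact_mod_cast hp3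
        omega
      apply hprim
      constructor
      · have : (p : ℤ) ∣ 2 * z.re := by
          have := dvd_sub h2 h1
          ring_nf at this; rwa [mul_comm]
        exact (hpZ.dvd_or_dvd this).resolve_left h2p
      · have : (p : ℤ) ∣ 2 * z.im := by
          have := dvd_add h2 h1
          ring_nf at this; rwa [mul_comm]
        exact (hpZ.dvd_or_dvd this).resolve_left h2p
    have hcQ : ∀ t : ℤ, ¬ (p : ℤ) ∣ t → IsCoprime Q t := by
      intro t ht
      rw [hQ]
      exact IsCoprime.pow_left ((Prime.coprime_iff_not_dvd hpZ).mpr ht)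
    have hdiv : Q ∣ z.im - z.re ∨ Q ∣ z.im + z.re := by
      by_cases h : (p : ℤ) ∣ z.im - z.re
      · left
        have h2 : ¬ (p : ℤ) ∣ z.im + z.re := fun h' => hcop ⟨h, h'⟩
        exact (hcQ _ h2).dvd_of_dvd_mul_right hprod
      · right
        exact (hcQ _ h).dvd_of_dvd_mul_left hprod
    have hstar : al Q * star (al Q) = (Q : ℤ√(1 - Q)) := by
      ext <;> simp [al]
    -- mixed products are not primitive
    have hmix : ∀ t : ℤ√(1 - Q), z ≠ (Q : ℤ√(1 - Q)) * t := by
      intro t ht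
      apply hprim
      rw [ht]
      simp only [Zsqrtd.re_smul, Zsqrtd.im_smul]
      exact ⟨hpb.mul_right _, hpb.mul_right _⟩
    have key : ∀ w : ℤ√(1 - Q), (z = al Q * w ∨ z = star (al Q) * w) →
        ∃ m, a - b = b * m ∧ (w = al Q ^ m ∨ w = - al Q ^ m ∨
          w = star (al Q) ^ m ∨ w = - star (al Q) ^ m) := by
      intro w hw
      apply ih (a - b) (by omega) w
      · have hn : z.norm = Q * w.norm := by
          have h1 : (al Q).norm = Q := by simp [Zsqrtd.norm_def, al]
          rcases hw with h | h
          · rw [h, Zsqrtd.norm_mul, h1]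
          · rw [h, Zsqrtd.norm_mul, Zsqrtd.norm_conj, h1]
        simp only [Zsqrtd.norm_def] at hn
        apply mul_left_cancel₀ hQ0
        rw [← hsplit, ← hz]
        linear_combination -hn
      · rintro ⟨h1, h2⟩
        apply hprim
        rw [← Zsqrtd.intCast_dvd]
        have : ((p : ℤ) : ℤ√(1 - Q)) ∣ w := (Zsqrtd.intCast_dvd _ _).mpr ⟨h1, h2⟩
        rcases hw with h | h <;> rw [h] <;> exact this.mul_left _
    rcases hdiv with ⟨y, hy⟩ | ⟨y, hy⟩
    · have hzw : z = al Q * ⟨z.im - y, y⟩ := by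
        ext
        · simp [al]; linear_combination -hy
        · simp [al]
      obtain ⟨m, hm, h⟩ := key _ (Or.inl hzw)
      refine ⟨m + 1, by rw [mul_add, mul_one, ← hm]; omega, ?_⟩
      rcases h with h | h | h | h
      · left; rw [hzw, h, pow_succ']
      · right; left; rw [hzw, h, pow_succ']; ring
      · rcases m with _ | m
        · left; rw [hzw, h]; simp
        · exfalso; apply hmix (star (al Q) ^ m)
          rw [hzw, h, ← hstar, pow_succ']; ring
      · rcases m with _ | m
        · right; left; rw [hzw, h]; simp
        · exfalso; apply hmix (-star (al Q) ^ m)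
          rw [hzw, h, ← hstar, pow_succ']; ring
    · have hzw : z = star (al Q) * ⟨y - z.im, y⟩ := by
        ext
        · simp [al]; linear_combination hy
        · simp [al]
      obtain ⟨m, hm, h⟩ := key _ (Or.inr hzw)
      refine ⟨m + 1, by rw [mul_add, mul_one, ← hm]; omega, ?_⟩
      rcases h with h | h | h | h
      · rcases m with _ | m
        · right; right; left; rw [hzw, h]; simp
        · exfalso; apply hmix (al Q ^ m)
          rw [hzw, h, ← hstar, pow_succ']; ring
      · rcases m with _ | m
        · right; right; right; rw [hzw, h]; simp
        · exfalso; apply hmix (-al Q ^ m)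
          rw [hzw, h, ← hstar, pow_succ']; ring
      · right; right; left; rw [hzw, h, pow_succ']
      · right; right; right; rw [hzw, h, pow_succ']; ring

theorem descent' (p b : ℕ) (hp : p.Prime) (hodd : Odd p) (hb : 0 < b) (a : ℕ) (x : ℤ)
    (h : x ^ 2 + ((p : ℤ) ^ b - 1) = (p : ℤ) ^ a) :
    ∃ m, a = b * m ∧ (U ((p : ℤ) ^ b) m = 1 ∨ U ((p : ℤ) ^ b) m = -1) := by
  obtain ⟨m, hm, h⟩ := descent p b hp hodd hb _ rfl a ⟨x, 1⟩ (by simpa using h) (by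
    rintro ⟨-, h⟩
    exact (Nat.prime_iff_prime_int.mp hp).not_isUnit (isUnit_of_dvd_one h))
  refine ⟨m, hm, ?_⟩
  unfold U
  rcases h with h | h | h | h
  · rw [← h]; simp
  · right; have := congrArg Zsqrtd.im h; simp at this; omega
  · right; have := congrArg Zsqrtd.im h; rw [← star_pow] at this; simp only [Zsqrtd.im_star, Zsqrtd.im_neg] at this; omega
  · left; have := congrArg Zsqrtd.im h; rw [← star_pow] at this; simp only [Zsqrtd.im_star, Zsqrtd.im_neg] at this; omega

theorem U_two_mul (Q : ℤ) (j : ℕ) : U Q (2 * j) = 2 * (W Q j * U Q j) := by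
  rw [two_mul, U_add]; ring

theorem W_two_mul (Q : ℤ) (j : ℕ) : W Q (2 * j) = W Q j ^ 2 + (1 - Q) * U Q j ^ 2 := by
  rw [two_mul, W_add]; ring

theorem U_three_mul (Q : ℤ) (j : ℕ) :
    U Q (3 * j) = U Q j * (3 * W Q j ^ 2 + (1 - Q) * U Q j ^ 2) := by
  rw [show 3 * j = 2 * j + j by ring, U_add, U_two_mul, W_two_mul]; ring

theorem not_dvd_W (Q : ℤ) (q : ℕ) (hq : q.Prime) (hqD : (q : ℤ) ∣ Q - 1) (j : ℕ) :
    ¬ (q : ℤ) ∣ W Q j := by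
  intro h
  have h1 := (hqD.trans (W_mod Q j))
  have h2 : (q : ℤ) ∣ 1 := by
    have := dvd_sub h h1
    simpa using this
  exact (Nat.prime_iff_prime_int.mp hq).not_isUnit (isUnit_of_dvd_one h2)

/-- `U (q j) = q U_j t` with `t` prime to `q`. -/
def Step (Q : ℤ) (q : ℕ) : Prop := ∀ j, ∃ t, U Q (q * j) = q * (t * U Q j) ∧ ¬ (q : ℤ) ∣ t

theorem val_of_step (Q : ℤ) (q : ℕ) (hq : q.Prime) (hqD : (q : ℤ) ∣ Q - 1) (hs : Step Q q) :
    ∀ e k : ℕ, (q : ℤ) ^ e ∣ U Q k → q ^ e ∣ k := by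
  intro e
  have hqZ := Nat.prime_iff_prime_int.mp hq
  induction e with
  | zero => intro k _; simp
  | succ e ih =>
    intro k hk
    have h1 : (q : ℤ) ∣ U Q k := (dvd_pow_self _ (Nat.succ_ne_zero e)).trans hk
    have h2 : (q : ℤ) ∣ k := by
      have := dvd_sub h1 (hqD.trans (U_mod Q k))
      simpa using this
    obtain ⟨j, rfl⟩ := Int.natCast_dvd_natCast.mp h2
    obtain ⟨t, ht, htq⟩ := hs j
    rw [ht, pow_succ'] at hk
    have h3 : (q : ℤ) ^ e ∣ t * U Q j := (mul_dvd_mul_iff_left hqZ.ne_zero).mp hk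
    have h4 : (q : ℤ) ^ e ∣ U Q j :=
      (IsCoprime.pow_left ((Prime.coprime_iff_not_dvd hqZ).mpr htq)).dvd_of_dvd_mul_left h3
    rw [pow_succ']
    exact mul_dvd_mul_left _ (ih j h4)

theorem step_two (Q : ℤ) (hQ : (2 : ℤ) ∣ Q - 1) : Step Q 2 := fun j =>
  ⟨W Q j, by rw [U_two_mul]; norm_num, not_dvd_W Q 2 Nat.prime_two hQ j⟩

theorem step_three (Q : ℤ) (hQ : (9 : ℤ) ∣ Q - 1) : Step Q 3 := by
  intro j
  obtain ⟨c, hc⟩ := hQ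
  refine ⟨W Q j ^ 2 - 3 * c * U Q j ^ 2, ?_, ?_⟩
  · rw [U_three_mul, show 1 - Q = -(9 * c) by linarith]; push_cast; ring
  · intro h
    have h3 : ((3 : ℕ) : ℤ) ∣ Q - 1 := ⟨3 * c, by push_cast; linarith⟩
    apply not_dvd_W Q 3 Nat.prime_three h3 j
    apply (Nat.prime_iff_prime_int.mp Nat.prime_three).dvd_of_dvd_pow (n := 2)
    have := dvd_add h (show ((3 : ℕ) : ℤ) ∣ 3 * c * U Q j ^ 2 from ⟨c * U Q j ^ 2, by push_cast; ring⟩)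
    simpa using this

theorem step_large (Q : ℤ) (q : ℕ) (hq : q.Prime) (hq5 : 5 ≤ q) (hqD : (q : ℤ) ∣ Q - 1) :
    Step Q q := by
  intro j
  set A := W Q j with hA
  set B := U Q j with hB
  have hd : (q : ℤ) ∣ 1 - Q := by
    have := (dvd_neg).mpr hqD
    rwa [neg_sub] at this
  obtain ⟨c, hc⟩ := hd
  let s : ℤ√(1 - Q) := Zsqrtd.sqrtd
  have hs2 : s * s = ((q : ℤ) : ℤ√(1 - Q)) * ((c : ℤ) : ℤ√(1 - Q)) := by
    have : s * s = ((1 - Q : ℤ) : ℤ√(1 - Q)) := Zsqrtd.dmuld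
    rw [this, ← Int.cast_mul, ← hc]
  have hz : al Q ^ j = s * (B : ℤ√(1 - Q)) + (A : ℤ√(1 - Q)) := by
    ext <;> simp [s, hA, hB, W, U]
  have hdvd : ∃ T : ℤ√(1 - Q), al Q ^ (q * j) = (A : ℤ√(1 - Q)) ^ q
      + (s * B) * (A : ℤ√(1 - Q)) ^ (q - 1) * q + ((q : ℤ) : ℤ√(1 - Q)) ^ 2 * B * T := by
    obtain ⟨r, rfl⟩ : ∃ r, q = r + 2 := ⟨q - 2, by omega⟩
    rw [mul_comm, pow_mul, hz, add_pow, Finset.sum_range_succ', Finset.sum_range_succ']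
    have : (((r + 2 : ℕ) : ℤ) : ℤ√(1 - Q)) ^ 2 * B ∣ ∑ k ∈ Finset.range (r + 1),
        (s * (B : ℤ√(1 - Q))) ^ (k + 1 + 1) * (A : ℤ√(1 - Q)) ^ (r + 2 - (k + 1 + 1)) *
          ((r + 2).choose (k + 1 + 1) : ℤ√(1 - Q)) := by
      apply Finset.dvd_sum
      intro k hk
      rw [Finset.mem_range] at hk
      by_cases hkr : k = r
      · subst hkr
        obtain ⟨l, rfl⟩ : ∃ l, k = l + 3 := ⟨k - 3, by omega⟩
        have e : (s * (B : ℤ√(1 - Q))) ^ (l + 3 + 1 + 1)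
            = (s * s) ^ 2 * s * B ^ 5 * (s * (B : ℤ√(1 - Q))) ^ l := by ring
        rw [e, hs2]
        exact ⟨(c : ℤ√(1 - Q)) ^ 2 * s * B ^ 4 * (s * (B : ℤ√(1 - Q))) ^ l * 
          (A : ℤ√(1 - Q)) ^ (l + 3 + 2 - (l + 3 + 1 + 1)) *
          ((l + 3 + 2).choose (l + 3 + 1 + 1) : ℤ√(1 - Q)), by ring⟩
      · obtain ⟨w, hw⟩ := hq.dvd_choose_self (k := k + 1 + 1) (by omega) (by omega)
        have e : (s * (B : ℤ√(1 - Q))) ^ (k + 1 + 1)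
            = (s * s) * B ^ 2 * (s * (B : ℤ√(1 - Q))) ^ k := by ring
        rw [e, hs2, hw]
        exact ⟨(c : ℤ√(1 - Q)) * B * (s * (B : ℤ√(1 - Q))) ^ k * 
          (A : ℤ√(1 - Q)) ^ (r + 2 - (k + 1 + 1)) * (w : ℤ√(1 - Q)), by push_cast; ring⟩
    obtain ⟨T, hT⟩ := this
    refine ⟨T, ?_⟩
    rw [hT]
    simp
    ring
  obtain ⟨T, hT⟩ := hdvd
  have him : U Q (q * j) = q * ((A ^ (q - 1) + q * T.im) * B) := by
    have h1 := congrArg Zsqrtd.im hT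
    have e : (A : ℤ√(1 - Q)) ^ q + (s * B) * (A : ℤ√(1 - Q)) ^ (q - 1) * q
        + ((q : ℤ) : ℤ√(1 - Q)) ^ 2 * B * T
        = ((A ^ q : ℤ) : ℤ√(1 - Q)) + ((B * A ^ (q - 1) * q : ℤ) : ℤ√(1 - Q)) * s
        + ((q ^ 2 * B : ℤ) : ℤ√(1 - Q)) * T := by push_cast; ring
    rw [e] at h1
    simp only [Zsqrtd.im_add, Zsqrtd.im_smul, Zsqrtd.im_intCast, s, Zsqrtd.im_sqrtd] at h1
    unfold U
    rw [h1]; ring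
  refine ⟨_, him, ?_⟩
  intro h
  have h2 : (q : ℤ) ∣ A ^ (q - 1) := by
    have := dvd_sub h (dvd_mul_right (q : ℤ) T.im)
    simpa using this
  exact not_dvd_W Q q hq hqD j ((Nat.prime_iff_prime_int.mp hq).dvd_of_dvd_pow h2)

/-- Basic relation when `U m = 1`. -/
theorem rel_one (Q : ℤ) (k : ℕ) (h : U Q (k + 1) = 1) : U Q k * (Q * U Q k - 2) = Q ^ k - 1 := by
  have h1 := norm_WU Q k
  rw [U_succ] at h
  rw [show W Q k = 1 - U Q k by linarith] at h1
  linear_combination h1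

theorem no_step_one (Q : ℤ) (q : ℕ) (hq : q.Prime) (hq3 : 3 ≤ q) (hqD : (q : ℤ) ∣ Q - 1)
    (hs : Step Q q) (k : ℕ) (hk : 0 < k) (h : U Q (k + 1) = 1) : False := by
  have hqZ := Nat.prime_iff_prime_int.mp hq
  have hrel := rel_one Q k h
  obtain ⟨e, k', hk', hek⟩ := Nat.exists_eq_pow_mul_and_not_dvd hk.ne' q hq.ne_one
  have h1 : (q : ℤ) ^ (e + 1) ∣ Q ^ k - 1 := by
    have h2 := dvd_sub_pow_of_dvd_sub hqD e
    rw [hek, pow_mul]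
    rw [one_pow] at h2
    exact h2.trans (sub_one_dvd_pow_sub_one _ _)
  rw [← hrel] at h1
  have hB : (q : ℤ) ∣ U Q k := by
    have h3 := hqD.trans (W_mod Q k)
    rw [U_succ] at h
    have : U Q k = -(W Q k - 1) := by linarith
    rw [this]; exact (dvd_neg).mpr h3
  have hn : ¬ (q : ℤ) ∣ Q * U Q k - 2 := by
    intro h4
    have h5 := dvd_sub (hB.mul_left Q) h4
    have h6 : (q : ℤ) ∣ 2 := by simpa using h5
    have := Int.le_of_dvd (by norm_num) h6
    omega
  have h7 : (q : ℤ) ^ (e + 1) ∣ U Q k :=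
    (IsCoprime.pow_left ((Prime.coprime_iff_not_dvd hqZ).mpr hn)).dvd_of_dvd_mul_right h1
  have h8 := val_of_step Q q hq hqD hs (e + 1) k h7
  rw [hek, pow_succ] at h8
  exact hk' (Nat.dvd_of_mul_dvd_mul_left (pow_pos hq.pos e) h8)

theorem pow_two_dvd (Q : ℤ) (hQ : (2 : ℤ) ∣ Q - 1) (e : ℕ) :
    (2 : ℤ) ^ (e + 3) ∣ Q ^ 2 ^ (e + 1) - 1 := by
  induction e with
  | zero =>
    obtain ⟨c, hc⟩ := hQ
    have : Q ^ 2 ^ (0 + 1) - 1 = 4 * (c * (c + 1)) := by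
      rw [show Q = 2 * c + 1 by linarith]; ring
    rw [this]
    obtain ⟨d, hd⟩ := Int.even_mul_succ_self c
    exact ⟨d, by rw [hd]; ring⟩
  | succ e ih =>
    have : Q ^ 2 ^ (e + 1 + 1) - 1 = (Q ^ 2 ^ (e + 1) - 1) * (Q ^ 2 ^ (e + 1) + 1) := by
      rw [pow_succ 2 (e + 1), pow_mul]; ring
    rw [this, show e + 1 + 3 = (e + 3) + 1 by ring, pow_succ (2 : ℤ) (e + 3)]
    refine mul_dvd_mul ih ?_
    have h2 : (2 : ℤ) ∣ Q ^ 2 ^ (e + 1) - 1 := hQ.trans (sub_one_dvd_pow_sub_one _ _)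
    omega

theorem two_adic (Q : ℤ) (hQ : (2 : ℤ) ∣ Q - 1) (k : ℕ) (hk : 0 < k) (h4 : 4 ∣ k) (f g : ℤ)
    (hrel : U Q k * (f * U Q k + 2 * g) = Q ^ k - 1) (hg : Odd g) : False := by
  obtain ⟨e, k', hk', hek⟩ := Nat.exists_eq_pow_mul_and_not_dvd hk.ne' 2 (by norm_num)
  have he : ∃ e', e = e' + 1 := by
    rcases e with _ | e
    · exfalso; apply hk'; rw [pow_zero, one_mul] at hek; rw [← hek]; omega
    · exact ⟨e, rfl⟩
  obtain ⟨e', rfl⟩ := he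
  have h1 : (2 : ℤ) ^ (e' + 3) ∣ Q ^ k - 1 := by
    rw [hek, pow_mul]
    exact (pow_two_dvd Q hQ e').trans (sub_one_dvd_pow_sub_one _ _)
  have hU4 : (4 : ℤ) ∣ U Q k := by
    obtain ⟨j, rfl⟩ := h4
    rw [show 4 * j = 2 * (2 * j) by ring, U_two_mul, U_two_mul]
    exact ⟨W Q (2 * j) * (W Q j * U Q j), by ring⟩
  obtain ⟨B, hB⟩ := hU4
  have hfac : f * U Q k + 2 * g = 2 * (2 * (f * B) + g) := by rw [hB]; ring
  have hoddc : ¬ (2 : ℤ) ∣ 2 * (f * B) + g := by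
    obtain ⟨r, hr⟩ := hg; omega
  rw [← hrel, hfac, show U Q k * (2 * (2 * (f * B) + g)) = 2 * (U Q k * (2 * (f * B) + g)) by ring,
    pow_succ'] at h1
  have h2 : (2 : ℤ) ^ (e' + 2) ∣ U Q k * (2 * (f * B) + g) :=
    (mul_dvd_mul_iff_left two_ne_zero).mp h1
  have h3 : (2 : ℤ) ^ (e' + 2) ∣ U Q k :=
    (IsCoprime.pow_left ((Prime.coprime_iff_not_dvd Int.prime_two).mpr hoddc)).dvd_of_dvd_mul_right h2
  have h5 := val_of_step Q 2 Nat.prime_two hQ (step_two Q hQ) (e' + 2) k (by exact_mod_cast h3)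
  rw [hek, show e' + 2 = (e' + 1) + 1 by ring, pow_succ 2 (e' + 1)] at h5
  exact hk' (Nat.dvd_of_mul_dvd_mul_left (pow_pos (by norm_num) _) h5)

theorem odd_index (Q : ℤ) (hQ : (2 : ℤ) ∣ Q - 1) (m : ℕ) (h : U Q m = 1 ∨ U Q m = -1) :
    m % 2 = 1 := by
  have := hQ.trans (U_mod Q m)
  rcases h with h | h <;> rw [h] at this <;> omega

theorem case_one_mod (Q : ℤ) (hQ : (2 : ℤ) ∣ Q - 1) (m : ℕ) (hm : 1 < m) (h : U Q m = 1) :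
    m % 4 = 3 := by
  have h1 := odd_index Q hQ m (Or.inl h)
  by_contra h3
  obtain ⟨k, rfl⟩ : ∃ k, m = k + 1 := ⟨m - 1, by omega⟩
  have hr := rel_one Q k h
  exact two_adic Q hQ k (by omega) (by omega) Q (-1) (by rw [← hr]; ring) (by decide)

/-- If `U m = 1` with `m > 1` then `Q = 3` or `Q = 7`. -/
theorem case_one_Q (Q : ℕ) (hQ3 : 3 ≤ Q) (hQ : (2 : ℤ) ∣ (Q : ℤ) - 1) (m : ℕ) (hm : 1 < m)
    (h : U Q m = 1) : Q = 3 ∨ Q = 7 := by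
  have h3 := case_one_mod Q hQ m hm h
  have h4 : ¬ (4 : ℤ) ∣ (Q : ℤ) - 1 := by
    intro h4
    have := h4.trans (U_mod Q m)
    rw [h] at this
    omega
  obtain ⟨k, rfl⟩ : ∃ k, m = k + 1 := ⟨m - 1, by omega⟩
  have h9 : ¬ (9 : ℤ) ∣ (Q : ℤ) - 1 := fun h9 =>
    no_step_one Q 3 Nat.prime_three le_rfl (by push_cast; omega) (step_three Q h9) k (by omega) h
  have hq : ∀ q : ℕ, q.Prime → q ∣ Q - 1 → q = 2 ∨ q = 3 := by
    intro q hq hqd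
    by_contra hne
    have hq5 : 5 ≤ q := by
      by_contra hlt
      have := hq.two_le
      have h4 : q = 4 := by omega
      rw [h4] at hq; exact absurd hq (by decide)
    have hqD : (q : ℤ) ∣ (Q : ℤ) - 1 := by
      have := Int.natCast_dvd_natCast.mpr hqd
      rwa [Nat.cast_sub (by omega), Nat.cast_one] at this
    exact no_step_one Q q hq (by omega) hqD (step_large Q q hq hq5 hqD) k (by omega) h
  have hnine : ¬ 9 ∣ Q - 1 := by omega
  obtain ⟨E, hE⟩ : ∃ E, Q - 1 = 2 * E := ⟨(Q - 1) / 2, by omega⟩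
  have hE2 : ¬ 2 ∣ E := by omega
  by_cases hE3 : 3 ∣ E
  · obtain ⟨F, rfl⟩ := hE3
    have : F = 1 := by
      by_contra hF
      obtain ⟨q, hq1, hq2⟩ := Nat.exists_prime_and_dvd hF
      rcases hq q hq1 (hE ▸ (hq2.mul_left 3).mul_left 2) with rfl | rfl <;> omega
    omega
  · have : E = 1 := by
      by_contra hF
      obtain ⟨q, hq1, hq2⟩ := Nat.exists_prime_and_dvd hF
      rcases hq q hq1 (hE ▸ hq2.mul_left 2) with rfl | rfl <;> omega
    omega

theorem case_three (m : ℕ) (hm : 1 < m) (h : U 3 m = 1) : m = 3 := by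
  have h3 := case_one_mod 3 (by norm_num) m hm h
  by_contra hne
  obtain ⟨k, rfl⟩ : ∃ k, m = 3 + k := ⟨m - 3, by omega⟩
  rw [U_add, show U 3 3 = 1 by decide, show W 3 3 = -5 by decide] at h
  have h1 := norm_WU 3 k
  rw [show W 3 k = 1 + 5 * U 3 k by linarith] at h1
  exact two_adic 3 (by norm_num) k (by omega) (by omega) 27 5 (by rw [← h1]; ring) (by decide)

theorem case_seven (m : ℕ) (hm : 1 < m) (h : U 7 m = 1) : False := by
  have h3 := case_one_mod 7 (by norm_num) m hm h
  have h1 := norm_WU 7 m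
  rw [h] at h1
  obtain ⟨j, rfl⟩ : ∃ j, m = 4 * j + 3 := ⟨m / 4, by omega⟩
  have h2 := congrArg (Int.cast : ℤ → ZMod 5) h1
  push_cast at h2
  rw [pow_add, pow_mul, show (7 : ZMod 5) ^ 4 = 1 by decide, one_pow] at h2
  revert h2
  generalize ((W 7 (4 * j + 3) : ℤ) : ZMod 5) = w
  revert w
  decide

theorem case_five (m : ℕ) (h4 : m % 4 = 3) (h : U 5 m = -1) : m = 3 := by
  by_contra hne
  obtain ⟨k, rfl⟩ : ∃ k, m = 3 + k := ⟨m - 3, by omega⟩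
  rw [U_add, show U 5 3 = -1 by decide, show W 5 3 = -11 by decide] at h
  have h1 := norm_WU 5 k
  rw [show W 5 k = 1 - 11 * U 5 k by linarith] at h1
  exact two_adic 5 (by norm_num) k (by omega) (by omega) 125 (-11) (by rw [← h1]; ring) (by decide)

theorem neg_one_mod (Q : ℤ) (hQ : (4 : ℤ) ∣ Q - 3) (j : ℕ) :
    (4 : ℤ) ∣ U Q (2 * j + 1) - 1 ∧ (2 : ℤ) ∣ W Q (2 * j + 1) - 1 := by
  induction j with
  | zero => simp [U_succ, W_succ, U_zero, W_zero]
  | succ j ih =>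
    obtain ⟨⟨u, hu⟩, ⟨w, hw⟩⟩ := ih
    obtain ⟨t, ht⟩ := hQ
    refine ⟨?_, ((by omega : (2 : ℤ) ∣ Q - 1)).trans (W_mod Q _)⟩
    rw [show 2 * (j + 1) + 1 = (2 * j + 1) + 1 + 1 by ring, U_succ, U_succ, W_succ,
      show U Q (2 * j + 1) = 4 * u + 1 by linarith, show W Q (2 * j + 1) = 2 * w + 1 by linarith,
      show Q = 4 * t + 3 by linarith]
    exact ⟨w - u - t - 4 * t * u, by ring⟩

/-- If `U m = -1` then `p = 5`. -/
theorem case_neg_p (p b : ℕ) (hp : p.Prime) (hodd : Odd p) (hb : 0 < b) (m : ℕ)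
    (h : U ((p : ℤ) ^ b) m = -1) : p = 5 ∧ m % 4 = 3 := by
  have hQodd : Odd ((p : ℤ) ^ b) := by
    have : Odd (p : ℤ) := by exact_mod_cast hodd
    exact this.pow
  have hQ2 : (2 : ℤ) ∣ (p : ℤ) ^ b - 1 := by
    obtain ⟨r, hr⟩ := hQodd; omega
  have hm := odd_index _ hQ2 m (Or.inr h)
  have hQ4 : (4 : ℤ) ∣ (p : ℤ) ^ b - 1 := by
    by_contra h4
    have h43 : (4 : ℤ) ∣ (p : ℤ) ^ b - 3 := by omega
    have := (neg_one_mod _ h43 (m / 2)).1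
    rw [show 2 * (m / 2) + 1 = m by omega, h] at this
    omega
  have hm4 : m % 4 = 3 := by
    have := hQ4.trans (U_mod _ m)
    rw [h] at this; omega
  refine ⟨?_, hm4⟩
  haveI : Fact p.Prime := ⟨hp⟩
  have hd : ((p - 1 : ℕ) : ℤ) ∣ ((m + 1 : ℕ) : ℤ) := by
    have h1 : ((p : ℤ) - 1) ∣ (p : ℤ) ^ b - 1 := sub_one_dvd_pow_sub_one _ _
    have h2 := h1.trans (U_mod _ m)
    rw [h] at h2
    rw [Nat.cast_sub hp.one_le]
    have := (dvd_neg).mpr h2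
    push_cast
    rwa [show -(-1 - (m : ℤ)) = m + 1 by ring] at this
  obtain ⟨t, ht⟩ := Int.natCast_dvd_natCast.mp hd
  have h2ne : (2 : ZMod p) ≠ 0 := by
    intro h0
    have : (p : ℕ) ∣ 2 := (ZMod.natCast_eq_zero_iff 2 p).mp (by exact_mod_cast h0)
    have := Nat.le_of_dvd (by norm_num) this
    have := hp.two_le
    obtain ⟨r, hr⟩ := hodd
    omega
  have hF : (2 : ZMod p) ^ (m + 1) = 1 := by
    rw [ht, pow_mul, ZMod.pow_card_sub_one_eq_one h2ne, one_pow]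
  obtain ⟨n, rfl⟩ : ∃ n, m = n + 1 := ⟨m - 1, by omega⟩
  have h3 : (p : ℤ) ∣ -1 - 2 ^ n := by
    have := (UW_modQ ((p : ℤ) ^ b) n).1
    rw [h] at this
    exact (dvd_pow_self _ hb.ne').trans this
  have h4 : ((-1 - 2 ^ n : ℤ) : ZMod p) = 0 := (ZMod.intCast_zmod_eq_zero_iff_dvd _ _).mpr h3
  push_cast at h4
  have h5 : ((5 : ℕ) : ZMod p) = 0 := by
    push_cast
    linear_combination -4 * h4 - hF
  have h6 := (ZMod.natCast_eq_zero_iff 5 p).mp h5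
  exact (Nat.prime_dvd_prime_iff_eq hp Nat.prime_five).mp h6

open Real in
theorem trig_form (Q : ℤ) (R S θ : ℝ) (h1 : R * cos θ = 1) (h2 : R * sin θ = S)
    (hS : S ^ 2 = Q - 1) (n : ℕ) :
    (W Q n : ℝ) = R ^ n * cos (n * θ) ∧ S * (U Q n : ℝ) = R ^ n * sin (n * θ) := by
  induction n with
  | zero => simp [W_zero, U_zero]
  | succ n ih =>
    obtain ⟨ih1, ih2⟩ := ih
    rw [W_succ, U_succ]
    push_cast
    rw [add_mul, one_mul, cos_add, sin_add, pow_succ]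
    constructor
    · linear_combination ih1 * (R * cos θ) - ih2 * (R * sin θ)
        - (W Q n : ℝ) * h1 + S * (U Q n : ℝ) * h2 + (U Q n : ℝ) * hS
    · linear_combination ih2 * (R * cos θ) + ih1 * (R * sin θ)
        - S * (U Q n : ℝ) * h1 - (W Q n : ℝ) * h2

open Real in
theorem U_sign_neg (c : ℕ) : U ((5 : ℤ) ^ (2 * c + 1)) (5 ^ (c + 1)) < 0 := by
  set Q : ℤ := (5 : ℤ) ^ (2 * c + 1) with hQ
  set N : ℕ := 5 ^ (c + 1) with hN
  set R : ℝ := 5 ^ c * √5 with hR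
  have h5 : √5 ^ 2 = 5 := Real.sq_sqrt (by norm_num)
  have hs2 : (2.2 : ℝ) < √5 := Real.lt_sqrt_of_sq_lt (by norm_num)
  have hs3 : √5 < 2.3 := (Real.sqrt_lt' (by norm_num)).mpr (by norm_num)
  have hc1 : (1 : ℝ) ≤ 5 ^ c := one_le_pow₀ (by norm_num)
  have hR1 : 2.2 < R := by rw [hR]; nlinarith
  have hR0 : 0 < R := by linarith
  have hR2 : R ^ 2 = (Q : ℝ) := by
    rw [hR, hQ]; push_cast; rw [mul_pow, h5]; ring
  have hNR : (N : ℝ) = R * √5 := by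
    rw [hN, hR]; push_cast; rw [pow_succ]; linear_combination -(5 : ℝ) ^ c * h5
  have hinv1 : 1 / R ≤ 1 := by rw [div_le_one hR0]; linarith
  have hinv0 : 0 < 1 / R := by positivity
  set δ := arcsin (1 / R) with hδ
  have hsin : sin δ = 1 / R := sin_arcsin (by linarith) hinv1
  have hδ0 : 0 < δ := arcsin_pos.mpr hinv0
  have hδ1 : δ ≤ π / 2 := arcsin_le_pi_div_two _
  have hcos : 0 ≤ cos δ := cos_arcsin_nonneg _
  have hlo : 1 / R ≤ δ := hsin ▸ sin_le hδ0.le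
  have hhi : 2 / π * δ ≤ 1 / R := hsin ▸ mul_le_sin hδ0.le hδ1
  have hpi := pi_pos
  have hlo' : √5 ≤ N * δ := by
    have h := mul_le_mul_of_nonneg_left hlo (by positivity : (0 : ℝ) ≤ N)
    have e : (N : ℝ) * (1 / R) = √5 := by rw [hNR]; field_simp
    linarith
  have hhi' : N * δ ≤ √5 * (π / 2) := by
    have h := mul_le_mul_of_nonneg_left hhi (by positivity : (0 : ℝ) ≤ N * (π / 2))
    have e : (N : ℝ) * (π / 2) * (1 / R) = √5 * (π / 2) := by rw [hNR]; field_simp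
    have e2 : (N : ℝ) * (π / 2) * (2 / π * δ) = N * δ := by field_simp
    linarith
  have hneg : cos (N * δ) < 0 := by
    apply cos_neg_of_pi_div_two_lt_of_lt
    · have := pi_lt_d2; linarith
    · nlinarith
  have hRc : R * cos (π / 2 - δ) = 1 := by
    rw [cos_pi_div_two_sub, hsin]; field_simp
  have hS : (R * sin (π / 2 - δ)) ^ 2 = (Q : ℝ) - 1 := by
    rw [sin_pi_div_two_sub, mul_pow, cos_sq', hsin, ← hR2]; field_simp
  have ht := (trig_form Q R _ _ hRc rfl hS N).2
  obtain ⟨K, hK⟩ : ∃ K : ℕ, N = 4 * K + 1 := by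
    have : N % 4 = 1 := by rw [hN, Nat.pow_mod]; norm_num
    exact ⟨N / 4, by omega⟩
  have e : (N : ℝ) * (π / 2 - δ) = (π / 2 - N * δ) + K * (2 * π) := by
    have : (N : ℝ) = 4 * K + 1 := by exact_mod_cast hK
    rw [mul_sub]
    nth_rewrite 1 [this]
    ring
  rw [e, sin_add_nat_mul_two_pi, sin_pi_div_two_sub (N * δ), sin_pi_div_two_sub] at ht
  have hlt : R * cos δ * (U Q N : ℝ) < 0 := by
    rw [ht]; exact mul_neg_of_pos_of_neg (by positivity) hneg
  by_contra hge
  push Not at hge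
  have : (0 : ℝ) ≤ (U Q N : ℝ) := by exact_mod_cast hge
  have := mul_nonneg (mul_nonneg hR0.le hcos) this
  linarith

theorem U_dvd (Q : ℤ) (N r : ℕ) :
    U Q N ∣ U Q (2 * N * r) ∧ U Q N ∣ W Q (2 * N * r) - Q ^ (N * r) := by
  induction r with
  | zero => simp [U_zero, W_zero]
  | succ r ih =>
    obtain ⟨⟨u, hu⟩, ⟨w, hw⟩⟩ := ih
    have hn := norm_WU Q N
    rw [mul_add (2 * N), mul_one, U_add, W_add, U_two_mul, W_two_mul, mul_add N, pow_add, mul_one,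
      ← hn, hu, show W Q (2 * N * r) = U Q N * w + Q ^ (N * r) by linarith]
    refine ⟨⟨(U Q N * w + Q ^ (N * r)) * (2 * W Q N) + u * (W Q N ^ 2 + (1 - Q) * U Q N ^ 2), ?_⟩,
      ⟨w * (W Q N ^ 2 + (1 - Q) * U Q N ^ 2)
      + (1 - Q) * u * (2 * (W Q N * U Q N)) - 2 * Q ^ (N * r) * (Q - 1) * U Q N, ?_⟩⟩
    · ring
    · ring

theorem case_five_large (c : ℕ) (hc : 1 ≤ c) (m : ℕ) (h4 : m % 4 = 3)
    (h : U ((5 : ℤ) ^ (2 * c + 1)) m = -1) : False := by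
  have hsign := U_sign_neg c
  obtain ⟨n, hn, rfl⟩ : ∃ n, n % 2 = 1 ∧ m = 2 * n + 1 := ⟨m / 2, by omega, by omega⟩
  have hnodd : Odd n := Nat.odd_iff.mpr hn
  haveI : Fact (Nat.Prime 5) := ⟨Nat.prime_five⟩
  -- `5 ^ (c + 1) ∣ n`
  have hN : 5 ^ (c + 1) ∣ n := by
    have h1 := (UW_modQ ((5 : ℤ) ^ (2 * c + 1)) (2 * n)).1
    rw [h] at h1
    have h2 : 5 ^ (2 * c + 1) ∣ 4 ^ n + 1 ^ n := by
      have h3 := (dvd_neg).mpr h1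
      rw [pow_mul, show -(-1 - ((2 : ℤ) ^ 2) ^ n) = ((4 ^ n + 1 ^ n : ℕ) : ℤ) by push_cast; ring] at h3
      exact_mod_cast h3
    have h3 : padicValNat 5 (4 ^ n + 1 ^ n) = padicValNat 5 (4 + 1) + padicValNat 5 n :=
      padicValNat.pow_add_pow (by decide) (by norm_num) (by norm_num) hnodd
    have h5 : padicValNat 5 (4 + 1) = 1 := by norm_num
    have h6 := (padicValNat_dvd_iff_le (by positivity)).mp h2
    rw [padicValNat_dvd_iff_le (by omega)]
    omega
  obtain ⟨r, hr⟩ := hN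
  set N := 5 ^ (c + 1) with hNdef
  set Q : ℤ := (5 : ℤ) ^ (2 * c + 1) with hQ
  have hdvd : U Q N ∣ Q ^ n + 1 := by
    obtain ⟨h1, h2⟩ := U_dvd Q N r
    rw [hr, show 2 * (N * r) = 2 * N * r by ring, U_succ] at h
    have h3 := dvd_sub (dvd_neg.mpr h2) h1
    rw [hr]
    have e : Q ^ (N * r) + 1 = -(W Q (2 * N * r) - Q ^ (N * r)) - U Q (2 * N * r) := by
      linarith
    rw [e]
    exact h3
  have hN4 : N % 4 = 1 := by rw [hNdef, Nat.pow_mod]; norm_num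
  have hQ4 : (4 : ℤ) ∣ Q - 1 := by
    have : ((5 : ℤ) - 1) ∣ Q - 1 := sub_one_dvd_pow_sub_one _ _
    simpa using this
  have hU4 : (4 : ℤ) ∣ U Q N - N := hQ4.trans (U_mod Q N)
  have hU5 : (5 : ℤ) ∣ U Q N - 1 := by
    obtain ⟨K, hK⟩ : ∃ K : ℕ, N = 4 * K + 1 := ⟨N / 4, by omega⟩
    have h1 := (UW_modQ Q (4 * K)).1
    rw [← hK] at h1
    have h2 : (5 : ℤ) ∣ Q := dvd_pow_self _ (by omega)
    have h3 : ((16 : ℤ) - 1) ∣ 16 ^ K - 1 := sub_one_dvd_pow_sub_one _ _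
    have h4 := h2.trans h1
    rw [pow_mul, show (2 : ℤ) ^ 4 = 16 by norm_num] at h4
    omega
  obtain ⟨M, hM⟩ : ∃ M : ℕ, U Q N = -(M : ℤ) := ⟨(U Q N).natAbs, by omega⟩
  have hM4 : M % 4 = 3 := by omega
  have hM5 : M % 5 = 4 := by omega
  have hModd : Odd M := Nat.odd_iff.mpr (by omega)
  have hJ5 : jacobiSym 5 M = 1 := by
    have h1 := jacobiSym.quadratic_reciprocity_one_mod_four (a := 5) (b := M) (by norm_num) hModd
    rw [show ((5 : ℕ) : ℤ) = 5 by norm_num] at h1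
    rw [h1, jacobiSym.mod_left, show (M : ℤ) % ((5 : ℕ) : ℤ) = 4 by omega]
    norm_num
  have hJ1 : jacobiSym (-1) M = -1 := by
    rw [jacobiSym.at_neg_one hModd, ZMod.χ₄_nat_three_mod_four hM4]
  have hmod : (Q ^ n) % (M : ℤ) = (-1) % (M : ℤ) := by
    rw [hM, neg_dvd] at hdvd
    apply Int.ModEq.symm
    apply (Int.modEq_iff_dvd).mpr
    simpa using hdvd
  have h1 : jacobiSym (Q ^ n) M = jacobiSym (-1) M := by
    rw [jacobiSym.mod_left, hmod, ← jacobiSym.mod_left]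
  rw [hJ1, hQ, ← pow_mul, jacobiSym.pow_left, hJ5, one_pow] at h1
  norm_num at h1

theorem p_pow_sub_p_pow_add_one_eq_sq
    (p a b x : ℕ) (hp : p.Prime) (hodd : Odd p)
    (ha : 0 < a) (hb : 0 < b) (hx : 0 < x) (hab : a > b)
    (heq : (p : ℤ) ^ a - (p : ℤ) ^ b + 1 = (x : ℤ) ^ 2) :
    (x, p, a, b) = (5, 3, 3, 1) ∨ (x, p, a, b) = (11, 5, 3, 1) := by
  obtain ⟨m, hm, hU⟩ := descent' p b hp hodd hb a x (by linarith)
  have hm1 : 1 < m := by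
    by_contra hle
    have : b * m ≤ b * 1 := Nat.mul_le_mul_left _ (by omega)
    omega
  rcases hU with hU | hU
  · left
    have hp3 : 3 ≤ p := by
      have := hp.two_le
      obtain ⟨r, hr⟩ := hodd; omega
    have hQ3 : 3 ≤ p ^ b := hp3.trans (Nat.le_self_pow hb.ne' p)
    have hQ2 : (2 : ℤ) ∣ ((p ^ b : ℕ) : ℤ) - 1 := by
      obtain ⟨r, hr⟩ := (hodd.pow (n := b)); omega
    have hQ := case_one_Q (p ^ b) hQ3 hQ2 m hm1 (by exact_mod_cast hU)
    have hQZ : (p : ℤ) ^ b = ((p ^ b : ℕ) : ℤ) := by push_cast; rfl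
    rcases hQ with hQ | hQ
    · rw [hQZ, hQ] at hU
      have hm3 := case_three m hm1 hU
      have hb1 : b = 1 := by
        by_contra hne
        have h1 : p ^ 2 ≤ p ^ b := Nat.pow_le_pow_right hp.pos (by omega)
        nlinarith
      subst hb1
      rw [pow_one] at hQ
      subst hQ
      subst hm3
      subst hm
      norm_num at heq ⊢
      have : (x : ℤ) = 5 := by nlinarith
      exact_mod_cast this
    · rw [hQZ, hQ] at hU
      exact (case_seven m hm1 hU).elim
  · right
    obtain ⟨rfl, hm4⟩ := case_neg_p p b hp hodd hb m hU
    push_cast at hU heq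
    rcases Nat.even_or_odd' b with ⟨c, rfl | rfl⟩
    · exfalso
      have h1 : (5 : ℤ) ^ a = (5 ^ (c * m)) ^ 2 := by rw [hm, ← pow_mul]; congr 1; ring
      have h2 : (5 : ℤ) ^ (2 * c) ≤ 5 ^ (c * m) :=
        pow_le_pow_right₀ (by norm_num) (by rw [mul_comm]; exact Nat.mul_le_mul_left _ hm1)
      have h3 : (5 : ℤ) ^ 1 ≤ 5 ^ (2 * c) := pow_le_pow_right₀ (by norm_num) hb
      rw [h1] at heq
      generalize (5 : ℤ) ^ (c * m) = S at *
      generalize (5 : ℤ) ^ (2 * c) = T at *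
      have hx0 : (0 : ℤ) < x := by exact_mod_cast hx
      have hlt : (x : ℤ) < S := by nlinarith
      nlinarith
    · rcases Nat.eq_zero_or_pos c with rfl | hc
      · norm_num at hU
        have hm3 := case_five m hm4 hU
        subst hm3
        subst hm
        norm_num at heq ⊢
        have : (x : ℤ) = 11 := by nlinarith
        exact_mod_cast this
      · exact (case_five_large c hc m hm4 hU).elim
end

section
/- Let C be an even positive integer. Let P be the (unique) squarefree positive integer such that C/P is a perfect square, and let Q be the positive integer such that P·Q is the largest squarefree divisor of C. Let u = 1 if P > 3 and P ≡ 3 (mod 8), and u = 0 otherwise. Let h(−P) be the least positive integer h such that the h-th power of every ideal of the ring of integers of ℚ(√−P) is principal (the exponent of the class group). Define N = 2 · 3^u · h(−P) · L, where L is the least common multiple of the numbers q − χ(q) taken over all primes q dividing Q, where χ(q) is the Legendre symbol (−P / q) for odd primes q and χ(2) = 0, and where L = 1 if Q = 1. Suppose x² + C = y^n where x and y are nonzero integers each divisible by at most one prime, gcd(x, y) = 1, n is a positive integer, and (x, y, n) is neither (7, 3, 4) nor (401, 11, 5) (up to the signs of x and y). Then n = 3 or n divides N. -/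
lemma zs_sqrtd_pow (d : ℤ) (k : ℕ) : (Zsqrtd.sqrtd : ℤ√d) ^ k =
    ⟨if k % 2 = 0 then d ^ (k / 2) else 0, if k % 2 = 1 then d ^ (k / 2) else 0⟩ := by
  induction k with
  | zero => ext <;> simp
  | succ k ih =>
    rw [pow_succ, ih]
    rcases Nat.mod_two_eq_zero_or_one k with h | h
    · have h1 : (k + 1) % 2 = 1 := by omega
      have h2 : (k + 1) / 2 = k / 2 := by omega
      ext <;> simp [h, h1, h2]
    · have h1 : (k + 1) % 2 = 0 := by omega
      have h2 : (k + 1) / 2 = k / 2 + 1 := by omega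
      ext <;> simp [h, h1, h2, pow_succ, mul_comm]

lemma zs_im_sum {ι : Type*} {d : ℤ} (s : Finset ι) (f : ι → ℤ√d) :
    (∑ i ∈ s, f i).im = ∑ i ∈ s, (f i).im := by
  classical
  induction s using Finset.induction_on with
  | empty => simp
  | insert a s h ih => simp [Finset.sum_insert h, ih]

lemma zs_re_sum {ι : Type*} {d : ℤ} (s : Finset ι) (f : ι → ℤ√d) :
    (∑ i ∈ s, f i).re = ∑ i ∈ s, (f i).re := by
  classical
  induction s using Finset.induction_on with
  | empty => simp
  | insert a s h ih => simp [Finset.sum_insert h, ih]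

lemma zs_mk_eq (d a : ℤ) : (⟨a, 1⟩ : ℤ√d) = Zsqrtd.sqrtd + (a : ℤ√d) := by
  ext <;> simp

lemma zs_im_pow (d a : ℤ) (n : ℕ) : ((⟨a, 1⟩ : ℤ√d) ^ n).im =
    ∑ k ∈ Finset.range (n + 1),
      (if k % 2 = 1 then d ^ (k / 2) else 0) * (a ^ (n - k) * (n.choose k : ℤ)) := by
  rw [zs_mk_eq, add_pow, zs_im_sum]
  refine Finset.sum_congr rfl fun k _ => ?_
  rw [zs_sqrtd_pow, mul_assoc]
  have : ((a : ℤ√d) ^ (n - k) * ((n.choose k : ℕ) : ℤ√d)) =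
      ((a ^ (n - k) * (n.choose k : ℤ) : ℤ) : ℤ√d) := by push_cast; rfl
  rw [this, Zsqrtd.im_mul, Zsqrtd.re_intCast, Zsqrtd.im_intCast]
  simp

lemma zs_re_pow (d a : ℤ) (n : ℕ) : ((⟨a, 1⟩ : ℤ√d) ^ n).re =
    ∑ k ∈ Finset.range (n + 1),
      (if k % 2 = 0 then d ^ (k / 2) else 0) * (a ^ (n - k) * (n.choose k : ℤ)) := by
  rw [zs_mk_eq, add_pow, zs_re_sum]
  refine Finset.sum_congr rfl fun k _ => ?_
  rw [zs_sqrtd_pow, mul_assoc]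
  have : ((a : ℤ√d) ^ (n - k) * ((n.choose k : ℕ) : ℤ√d)) =
      ((a ^ (n - k) * (n.choose k : ℤ) : ℤ) : ℤ√d) := by push_cast; rfl
  rw [this, Zsqrtd.re_mul, Zsqrtd.re_intCast, Zsqrtd.im_intCast]
  simp

-- modulo `d`
lemma zs_mod_d (d a : ℤ) (n : ℕ) :
    d ∣ ((⟨a, 1⟩ : ℤ√d) ^ n).re - a ^ n ∧
    d ∣ ((⟨a, 1⟩ : ℤ√d) ^ (n + 1)).im - (n + 1) * a ^ n := by
  induction n with
  | zero => simp
  | succ n ih =>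
    obtain ⟨⟨u, hu⟩, ⟨v, hv⟩⟩ := ih
    have hre : d ∣ ((⟨a, 1⟩ : ℤ√d) ^ (n + 1)).re - a ^ (n + 1) := by
      refine ⟨u * a + ((⟨a, 1⟩ : ℤ√d) ^ n).im, ?_⟩
      rw [pow_succ, Zsqrtd.re_mul]
      linear_combination a * hu
    refine ⟨hre, ?_⟩
    obtain ⟨w, hw⟩ := hre
    refine ⟨w + a * v, ?_⟩
    rw [pow_succ (n := n + 1), Zsqrtd.im_mul]
    push_cast
    linear_combination hw + a * hv

-- modulo `a ^ 2`
lemma zs_mod_a (d a : ℤ) (m : ℕ) :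
    ∃ W : ℤ, ((⟨a, 1⟩ : ℤ√d) ^ (2 * m + 1)).re = a * W ∧
      a ^ 2 ∣ W - (2 * m + 1) * d ^ m ∧
      a ^ 2 ∣ ((⟨a, 1⟩ : ℤ√d) ^ (2 * m + 1)).im - d ^ m := by
  induction m with
  | zero => exact ⟨1, by simp⟩
  | succ m ih =>
    obtain ⟨W, hW, ⟨u, hu⟩, ⟨v, hv⟩⟩ := ih
    have e : (⟨a, 1⟩ : ℤ√d) ^ (2 * (m + 1) + 1) =
        (⟨a, 1⟩ : ℤ√d) ^ (2 * m + 1) * ⟨a ^ 2 + d, 2 * a⟩ := by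
      rw [show 2 * (m + 1) + 1 = (2 * m + 1) + 2 by ring, pow_add]
      congr 1
      rw [pow_two]; ext <;> simp <;> ring
    refine ⟨(a ^ 2 + d) * W + 2 * d * ((⟨a, 1⟩ : ℤ√d) ^ (2 * m + 1)).im, ?_, ?_, ?_⟩
    · rw [e, Zsqrtd.re_mul, hW]; ring
    · refine ⟨W + d * u + 2 * d * v, ?_⟩
      push_cast
      linear_combination d * hu + 2 * d * hv
    · refine ⟨((⟨a, 1⟩ : ℤ√d) ^ (2 * m + 1)).im + 2 * W + d * v, ?_⟩
      rw [e, Zsqrtd.im_mul, hW]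
      linear_combination d * hv

-- modulo `r`
lemma zs_mod_r (d a : ℤ) (m : ℕ) (hr : (2 * m + 1).Prime) :
    ((2 * m + 1 : ℕ) : ℤ) ∣ ((⟨a, 1⟩ : ℤ√d) ^ (2 * m + 1)).im - d ^ m := by
  obtain ⟨z, hz⟩ := exists_add_pow_prime_eq hr (Zsqrtd.sqrtd : ℤ√d) (a : ℤ√d)
  refine ⟨(Zsqrtd.sqrtd * (a : ℤ√d) * z).im, ?_⟩
  rw [zs_mk_eq, hz, zs_sqrtd_pow]
  have h1 : (2 * m + 1) % 2 = 1 := by omega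
  have h2 : (2 * m + 1) / 2 = m := by omega
  have h3 : ((a : ℤ√d) ^ (2 * m + 1)) = ((a ^ (2 * m + 1) : ℤ) : ℤ√d) := by push_cast; rfl
  have h4 : (((2 * m + 1 : ℕ) : ℤ√d)) * Zsqrtd.sqrtd * (a : ℤ√d) * z
     = (((2 * m + 1 : ℕ) : ℤ) : ℤ√d) * (Zsqrtd.sqrtd * (a : ℤ√d) * z) := by push_cast; ring
  rw [h4, h3, Zsqrtd.im_add, Zsqrtd.im_add, Zsqrtd.im_smul, Zsqrtd.im_intCast, h2]
  simp only [h1]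
  simp

-- modulo `Y = 1 - d` when `a = 1`
lemma zs_mod_Y (d : ℤ) (n : ℕ) :
    (1 - d) ∣ ((⟨1, 1⟩ : ℤ√d) ^ (n + 1)).re - 2 ^ n ∧
    (1 - d) ∣ ((⟨1, 1⟩ : ℤ√d) ^ (n + 1)).im - 2 ^ n := by
  induction n with
  | zero => simp
  | succ n ih =>
    obtain ⟨⟨u, hu⟩, ⟨v, hv⟩⟩ := ih
    rw [pow_succ (n := n + 1)]
    refine ⟨⟨u + v - ((⟨1, 1⟩ : ℤ√d) ^ (n + 1)).im, ?_⟩, ⟨u + v, ?_⟩⟩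
    · rw [Zsqrtd.re_mul]; linear_combination hu + hv
    · rw [Zsqrtd.im_mul]; linear_combination hu + hv

lemma zs_norm (d a b : ℤ) (n : ℕ) : ((⟨a, b⟩ : ℤ√d) ^ n).re ^ 2 -
    d * ((⟨a, b⟩ : ℤ√d) ^ n).im ^ 2 = (a ^ 2 - d * b ^ 2) ^ n := by
  have h := map_pow (Zsqrtd.normMonoidHom (d := d)) (⟨a, b⟩ : ℤ√d) n
  have e : ∀ z : ℤ√d, Zsqrtd.normMonoidHom z = z.re ^ 2 - d * z.im ^ 2 := by
    intro z
    change z.norm = _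
    rw [Zsqrtd.norm_def]; ring
  rw [e, e] at h
  exact h

-- modulo `r ^ 2` when `r ∣ d` and `r ≥ 5`
lemma zs_mod_r_sq (d a : ℤ) (r : ℕ) (hr : r.Prime) (h5 : 5 ≤ r) (hd : (r : ℤ) ∣ d) :
    (r : ℤ) ^ 2 ∣ ((⟨a, 1⟩ : ℤ√d) ^ r).im - r * a ^ (r - 1) := by
  rw [zs_im_pow]
  have h1 : 1 ∈ Finset.range (r + 1) := by simp; omega
  have hodd : r % 2 = 1 := by
    rcases hr.eq_two_or_odd with h | h
    · omega
    · exact h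
  rw [← Finset.add_sum_erase _ _ h1]
  have e : (if 1 % 2 = 1 then d ^ (1 / 2) else 0) * (a ^ (r - 1) * ((r.choose 1 : ℕ) : ℤ))
      = r * a ^ (r - 1) := by simp; ring
  rw [e, add_sub_cancel_left]
  refine Finset.dvd_sum fun k hk => ?_
  simp only [Finset.mem_erase, Finset.mem_range] at hk
  split_ifs with hk2
  swap
  · simp
  rcases Nat.lt_or_ge k r with hlt | hge
  · have hc : (r : ℤ) ∣ (r.choose k : ℤ) := by
      exact_mod_cast hr.dvd_choose_self (by omega) hlt
    have hdk : (r : ℤ) ∣ d ^ (k / 2) := dvd_pow hd (by omega)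
    rw [pow_two]
    exact mul_dvd_mul hdk (Dvd.dvd.mul_left hc _)
  · have : k = r := by omega
    subst this
    refine Dvd.dvd.mul_right ?_ _
    exact (pow_dvd_pow_of_dvd hd 2).trans (pow_dvd_pow _ (by omega))

lemma zs_ne_r (d : ℤ) (r : ℕ) (hr : r.Prime) (h7 : 7 ≤ r) (hd : (r : ℤ) ∣ d) (hd0 : d ≠ 0) :
    ((⟨1, 1⟩ : ℤ√d) ^ r).im ≠ r := by
  intro h
  rw [zs_im_pow] at h
  have h1 : 1 ∈ Finset.range (r + 1) := by simp; omega
  have h3 : 3 ∈ (Finset.range (r + 1)).erase 1 := by simp; omega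
  have hodd : r % 2 = 1 := by
    rcases hr.eq_two_or_odd with h | h
    · omega
    · exact h
  rw [← Finset.add_sum_erase _ _ h1, ← Finset.add_sum_erase _ _ h3] at h
  have hdv : d * (r : ℤ) ^ 2 ∣ ∑ k ∈ ((Finset.range (r + 1)).erase 1).erase 3,
      (if k % 2 = 1 then d ^ (k / 2) else 0) * ((1 : ℤ) ^ (r - k) * (r.choose k : ℤ)) := by
    refine Finset.dvd_sum fun k hk => ?_
    simp only [Finset.mem_erase, Finset.mem_range] at hk
    split_ifs with hk2
    swap
    · simp
    have hk5 : 5 ≤ k := by omega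
    rcases Nat.lt_or_ge k r with hlt | hge
    · have hc : (r : ℤ) ∣ (r.choose k : ℤ) := by
        exact_mod_cast hr.dvd_choose_self (by omega) hlt
      have hdk : d * (r : ℤ) ∣ d ^ (k / 2) := by
        calc d * (r : ℤ) ∣ d * d := mul_dvd_mul_left _ hd
          _ = d ^ 2 := by ring
          _ ∣ _ := pow_dvd_pow _ (by omega)
      rw [pow_two, ← mul_assoc]
      exact mul_dvd_mul hdk (Dvd.dvd.mul_left hc _)
    · have : k = r := by omega
      subst this
      refine Dvd.dvd.mul_right ?_ _
      calc d * (k : ℤ) ^ 2 ∣ d * d ^ 2 := mul_dvd_mul_left _ (pow_dvd_pow_of_dvd hd 2)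
          _ = d ^ 3 := by ring
          _ ∣ _ := pow_dvd_pow _ (by omega)
  obtain ⟨c, hc⟩ := hdv
  rw [hc] at h
  norm_num at h
  have h' : (r.choose 3 : ℤ) = - (r ^ 2 * c) := by
    have : d * ((r.choose 3 : ℤ) + r ^ 2 * c) = 0 := by linear_combination h
    rcases mul_eq_zero.1 this with h | h
    · exact absurd h hd0
    · linear_combination h
  have h6 : (6 : ℤ) * (r.choose 3 : ℤ) = r * (r - 1) * (r - 2) := by
    have h6 := Nat.descFactorial_eq_factorial_mul_choose r 3
    obtain ⟨q, rfl⟩ : ∃ q, r = q + 3 := ⟨r - 3, by omega⟩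
    have : (q + 3).descFactorial 3 = (q + 3) * (q + 2) * (q + 1) := by
      simp [Nat.descFactorial]; ring
    rw [this] at h6
    have h7 : (((q + 3) * (q + 2) * (q + 1) : ℕ) : ℤ) = ((Nat.factorial 3 * (q + 3).choose 3 : ℕ) : ℤ) := by
      exact_mod_cast h6
    push_cast [Nat.factorial] at h7
    push_cast
    linear_combination - h7
  have hr0 : (r : ℤ) ≠ 0 := by exact_mod_cast hr.ne_zero
  have h8 : (r : ℤ) * (6 * (r * c) + (r - 1) * (r - 2)) = 0 := by
    rw [h'] at h6; linear_combination - h6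
  rcases mul_eq_zero.1 h8 with h | h
  · exact hr0 h
  · have : (r : ℤ) ∣ 2 := ⟨- (6 * c + r - 3), by linear_combination h⟩
    have := Int.le_of_dvd (by norm_num) this
    omega

lemma lm_three {R : Type*} [CommRing R] (j : ℕ) (hj : 1 ≤ j) (z : R) :
    ∃ w : R, (1 + ((3 : ℕ) : R) ^ j * z) ^ 3 = 1 + ((3 : ℕ) : R) ^ (j + 1) * (z + ((3 : ℕ) : R) * w) := by
  obtain ⟨j, rfl⟩ : ∃ i, j = i + 1 := ⟨j - 1, by omega⟩
  refine ⟨3 ^ j * z ^ 2 + 3 ^ (2 * j) * z ^ 3, ?_⟩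
  push_cast
  ring

lemma lm_two {R : Type*} [CommRing R] (j : ℕ) (hj : 2 ≤ j) (z : R) :
    ∃ w : R, (1 + ((2 : ℕ) : R) ^ j * z) ^ 2 = 1 + ((2 : ℕ) : R) ^ (j + 1) * (z + ((2 : ℕ) : R) * w) := by
  obtain ⟨j, rfl⟩ : ∃ i, j = i + 2 := ⟨j - 2, by omega⟩
  refine ⟨2 ^ j * z ^ 2, ?_⟩
  push_cast
  ring

lemma lm_one {R : Type*} [CommRing R] (z : R) (n : ℕ) :
    ∃ w : R, (1 + z) ^ n = 1 + n * z + z ^ 2 * w := by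
  induction n with
  | zero => exact ⟨0, by simp⟩
  | succ n ih =>
    obtain ⟨w, hw⟩ := ih
    refine ⟨n + w + z * w, ?_⟩
    rw [pow_succ, hw]; push_cast; ring

lemma lm_M {d : ℤ} (l : ℕ) (hl : l.Prime) (i : ℕ) (hi : 1 ≤ i)
    (hstep : ∀ j, i ≤ j → ∀ z : ℤ√d, ∃ w : ℤ√d,
      (1 + (l : ℤ√d) ^ j * z) ^ l = 1 + (l : ℤ√d) ^ (j + 1) * (z + (l : ℤ√d) * w))
    (z b : ℤ√d) (hnd : ¬ (l : ℤ) ∣ (z * b).im) (M : ℕ) (hM : 0 < M) :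
    ((1 + (l : ℤ√d) ^ i * z) ^ M * b).im ≠ b.im := by
  obtain ⟨s, o, ho, rfl⟩ := Nat.exists_eq_pow_mul_and_not_dvd hM.ne' l hl.ne_one
  have h1 : ∃ w : ℤ√d, (1 + (l : ℤ√d) ^ i * z) ^ (l ^ s) =
      1 + (l : ℤ√d) ^ (i + s) * (z + (l : ℤ√d) * w) := by
    clear ho hM
    induction s with
    | zero => exact ⟨0, by simp⟩
    | succ s ih =>
      obtain ⟨w, hw⟩ := ih
      obtain ⟨w', hw'⟩ := hstep (i + s) (by omega) (z + l * w)
      refine ⟨w + w', ?_⟩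
      rw [pow_succ l, pow_mul, hw, hw']
      ring
  obtain ⟨w, hw⟩ := h1
  obtain ⟨w', hw'⟩ := lm_one ((l : ℤ√d) ^ (i + s) * (z + (l : ℤ√d) * w)) o
  obtain ⟨k, hk⟩ : ∃ k, i + s = k + 1 := ⟨i + s - 1, by omega⟩
  intro h
  rw [pow_mul, hw, hw'] at h
  have e : (1 + (o : ℤ√d) * ((l : ℤ√d) ^ (i + s) * (z + (l : ℤ√d) * w)) +
      ((l : ℤ√d) ^ (i + s) * (z + (l : ℤ√d) * w)) ^ 2 * w') * b
      = b + (((l : ℤ) ^ (i + s) : ℤ) : ℤ√d) * (((o : ℤ) : ℤ√d) * (z * b)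
        + ((l : ℤ) : ℤ√d) * (o * w * b + (l : ℤ√d) ^ k * (z + (l : ℤ√d) * w) ^ 2 * w' * b)) := by
    rw [hk]; push_cast; ring
  rw [e, Zsqrtd.im_add, Zsqrtd.im_smul, Zsqrtd.im_add, Zsqrtd.im_smul, Zsqrtd.im_smul] at h
  have h0 : (l : ℤ) ^ (i + s) ≠ 0 := pow_ne_zero _ (by exact_mod_cast hl.ne_zero)
  have h2 := mul_eq_zero.1 (show (l : ℤ) ^ (i + s) * _ = 0 from add_eq_left.1 h)
  rcases h2 with h2 | h2
  · exact h0 h2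
  · have hp : Prime (l : ℤ) := Nat.prime_iff_prime_int.1 hl
    have : (l : ℤ) ∣ (o : ℤ) * (z * b).im := ⟨_, (eq_neg_of_add_eq_zero_left h2).trans (neg_mul_eq_mul_neg _ _)⟩
    rcases hp.dvd_or_dvd this with h3 | h3
    · exact ho (by exact_mod_cast h3)
    · exact hnd h3

-- `D = 4`, `U = -1`
lemma lm_D4 (r : ℕ) (hr : 3 < r) (hr4 : r % 4 = 3) : ((⟨1, 1⟩ : ℤ√(-4)) ^ r).im ≠ -1 := by
  have e4 : (⟨1, 1⟩ : ℤ√(-4)) ^ 4 = 1 + ((2 : ℕ) : ℤ√(-4)) ^ 2 * ⟨-2, -3⟩ := by decide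
  have e3 : (⟨1, 1⟩ : ℤ√(-4)) ^ 3 = ⟨-11, -1⟩ := by decide
  have := lm_M 2 Nat.prime_two 2 (by norm_num) (fun j hj z => lm_two j hj z)
    (⟨-2, -3⟩ : ℤ√(-4)) ⟨-11, -1⟩ (by decide) (r / 4) (by omega)
  rw [← e4, ← e3, ← pow_mul, ← pow_add, show 4 * (r / 4) + 3 = r by omega, e3] at this
  exact this

lemma lm_D2 (r : ℕ) (hr : 3 < r) (hr2 : r % 2 = 1) : ((⟨1, 1⟩ : ℤ√(-2)) ^ r).im ≠ 1 := by
  have e4 : (⟨1, 1⟩ : ℤ√(-2)) ^ 4 = 1 + ((2 : ℕ) : ℤ√(-2)) ^ 2 * ⟨-2, -1⟩ := by decide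
  have e3 : (⟨1, 1⟩ : ℤ√(-2)) ^ 3 = ⟨-5, 1⟩ := by decide
  have e1 : (⟨1, 1⟩ : ℤ√(-2)) ^ 1 = ⟨1, 1⟩ := by decide
  rcases (by omega : r % 4 = 1 ∨ r % 4 = 3) with h4 | h4
  · have := lm_M 2 Nat.prime_two 2 (by norm_num) (fun j hj z => lm_two j hj z)
      (⟨-2, -1⟩ : ℤ√(-2)) ⟨1, 1⟩ (by decide) (r / 4) (by omega)
    rw [← e4, ← pow_mul, ← pow_succ, show 4 * (r / 4) + 1 = r by omega] at this
    exact this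
  · have := lm_M 2 Nat.prime_two 2 (by norm_num) (fun j hj z => lm_two j hj z)
      (⟨-2, -1⟩ : ℤ√(-2)) ⟨-5, 1⟩ (by decide) (r / 4) (by omega)
    rw [← e4, ← e3, ← pow_mul, ← pow_add, show 4 * (r / 4) + 3 = r by omega, e3] at this
    exact this

lemma lm_D6 (r : ℕ) (hr : 3 < r) (hr6 : r % 6 = 1) : ((⟨1, 1⟩ : ℤ√(-6)) ^ r).im ≠ 1 := by
  have e3 : (⟨1, 1⟩ : ℤ√(-6)) ^ 3 = 1 + ((3 : ℕ) : ℤ√(-6)) ^ 1 * ⟨-6, -1⟩ := by decide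
  have := lm_M 3 Nat.prime_three 1 (by norm_num) (fun j hj z => lm_three j hj z)
      (⟨-6, -1⟩ : ℤ√(-6)) ⟨1, 1⟩ (by decide) (r / 3) (by omega)
  rw [← e3, ← pow_mul, ← pow_succ, show 3 * (r / 3) + 1 = r by omega] at this
  exact this

lemma up_val (l k : ℕ) (hl : l.Prime) (w : ℕ) (hw : l ^ w ∣ k) (hk : 2 ≤ k) :
    (5 ≤ l → w + 1 ≤ k / 2) ∧ w + 1 ≤ 2 * (k / 2) := by
  have h1 := Nat.le_of_dvd (by omega) hw
  have h2 := hl.two_le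
  constructor
  · intro h5
    rcases Nat.eq_zero_or_pos w with rfl | hw0
    · omega
    · have : 2 * w + 2 ≤ 5 ^ w := by
        clear hw h1
        induction w, hw0 using Nat.le_induction with
        | base => norm_num
        | succ n hn ih => rw [pow_succ]; omega
      have := Nat.pow_le_pow_left h5 w
      omega
  · rcases Nat.lt_or_ge w 2 with hw0 | hw0
    · omega
    · have : w + 2 ≤ 2 ^ w := by
        clear hw h1
        induction w, hw0 using Nat.le_induction with
        | base => norm_num
        | succ n hn ih => rw [pow_succ]; omega
      have := Nat.pow_le_pow_left h2 w
      omega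

lemma up_im (d : ℤ) (m : ℕ) : ((⟨1, 1⟩ : ℤ√d) ^ (m + 1)).im =
    ∑ k ∈ Finset.range (m + 1), d ^ (k / 2) * (m.choose k : ℤ) := by
  rw [pow_succ, Zsqrtd.im_mul, mul_one, mul_one, zs_im_pow, zs_re_pow, ← Finset.sum_add_distrib]
  refine Finset.sum_congr rfl fun k _ => ?_
  rcases Nat.mod_two_eq_zero_or_one k with h | h <;> simp [h]

lemma up_prime (d : ℤ) (m : ℕ) (hm : 0 < m) (l : ℕ) (hl : l.Prime)
    (hd : (5 ≤ l ∧ (l : ℤ) ∣ d) ∨ (l : ℤ) ^ 2 ∣ d) : ((⟨1, 1⟩ : ℤ√d) ^ (m + 1)).im ≠ 1 := by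
  intro h
  rw [up_im] at h
  obtain ⟨s, o, ho, hmo⟩ := Nat.exists_eq_pow_mul_and_not_dvd hm.ne' l hl.ne_one
  have hterm : ∀ k ∈ Finset.range (m + 1), 2 ≤ k →
      (l : ℤ) ^ (s + 1) ∣ d ^ (k / 2) * (m.choose k : ℤ) := by
    intro k hk hk2
    obtain ⟨w, k', hk', hkw⟩ := Nat.exists_eq_pow_mul_and_not_dvd (show k ≠ 0 by omega) l hl.ne_one
    have hv := up_val l k hl w ⟨k', hkw⟩ hk2
    have hdk : (l : ℤ) ^ (w + 1) ∣ d ^ (k / 2) := by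
      rcases hd with ⟨h5, hd⟩ | hd
      · exact (pow_dvd_pow _ (hv.1 h5)).trans (pow_dvd_pow_of_dvd hd _)
      · refine (pow_dvd_pow _ hv.2).trans ?_
        rw [pow_mul]; exact pow_dvd_pow_of_dvd hd _
    obtain ⟨e, he⟩ := hdk
    have hch : (k : ℤ) * (m.choose k : ℤ) = m * ((m - 1).choose (k - 1) : ℤ) := by
      obtain ⟨m', rfl⟩ : ∃ m', m = m' + 1 := ⟨m - 1, by omega⟩
      obtain ⟨j, rfl⟩ : ∃ j, k = j + 1 := ⟨k - 1, by omega⟩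
      have := Nat.add_one_mul_choose_eq m' j
      simp only [Nat.add_sub_cancel]
      rw [mul_comm]
      exact_mod_cast this.symm
    have hcop : IsCoprime ((l : ℤ) ^ (s + 1)) (k' : ℤ) := by
      apply IsCoprime.pow_left
      rw [Nat.isCoprime_iff_coprime]
      exact (Nat.Prime.coprime_iff_not_dvd hl).2 hk'
    apply hcop.dvd_of_dvd_mul_left
    refine ⟨e * o * ((m - 1).choose (k - 1) : ℤ), ?_⟩
    rw [he]
    have hkz : (k : ℤ) = (l : ℤ) ^ w * k' := by exact_mod_cast hkw
    have hmz : (m : ℤ) = (l : ℤ) ^ s * o := by exact_mod_cast hmo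
    have h3 : (l : ℤ) * e * ((k : ℤ) * (m.choose k : ℤ)) = (l : ℤ) * e * (m * ((m - 1).choose (k - 1) : ℤ)) := by
      rw [hch]
    rw [hmz] at h3
    rw [hkz] at h3
    linear_combination h3
  have h0 : 0 ∈ Finset.range (m + 1) := by simp
  have h1 : 1 ∈ (Finset.range (m + 1)).erase 0 := by simp; omega
  rw [← Finset.add_sum_erase _ _ h0, ← Finset.add_sum_erase _ _ h1] at h
  have hdv : (l : ℤ) ^ (s + 1) ∣ ∑ k ∈ ((Finset.range (m + 1)).erase 0).erase 1,
      d ^ (k / 2) * (m.choose k : ℤ) := by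
    refine Finset.dvd_sum fun k hk => hterm k ?_ ?_
    · simp only [Finset.mem_erase] at hk; exact hk.2.2
    · simp only [Finset.mem_erase] at hk; omega
  simp only [Nat.choose_zero_right, Nat.choose_one_right] at h
  norm_num at h
  have : (l : ℤ) ^ (s + 1) ∣ (m : ℤ) := by
    rw [eq_neg_of_add_eq_zero_left h]; exact hdv.neg_right
  have h4 : l ^ (s + 1) ∣ l ^ s * o := by rw [← hmo]; exact_mod_cast this
  rw [pow_succ] at h4
  exact ho (Nat.dvd_of_mul_dvd_mul_left (pow_pos hl.pos s) h4)

lemma up_main (D : ℕ) (hD : 0 < D) (hD2 : 2 ∣ D) (r : ℕ) (hr : 3 < r) (hr2 : r % 2 = 1) :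
    ((⟨1, 1⟩ : ℤ√(-(D : ℤ))) ^ r).im ≠ 1 := by
  intro h
  obtain ⟨m, rfl⟩ : ∃ m, r = m + 1 := ⟨r - 1, by omega⟩
  have key : ∀ l : ℕ, l.Prime → (5 ≤ l ∧ l ∣ D) ∨ l ^ 2 ∣ D → False := by
    intro l hl hd
    refine up_prime (-(D : ℤ)) m (by omega) l hl ?_ h
    rcases hd with ⟨h5, hd⟩ | hd
    · left; exact ⟨h5, by rw [dvd_neg]; exact_mod_cast hd⟩
    · right; rw [dvd_neg]; exact_mod_cast hd
  have hsmall : ∀ l : ℕ, l.Prime → l ∣ D → l = 2 ∨ l = 3 := by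
    intro l hl hd
    by_contra hne
    push Not at hne
    have := hl.two_le
    have h4 : l ≠ 4 := by rintro rfl; revert hl; decide
    exact key l hl (Or.inl ⟨by omega, hd⟩)
  obtain ⟨E, rfl⟩ := hD2
  have hDE : E = 1 ∨ E = 3 := by
    by_contra hne
    push Not at hne
    obtain ⟨p, hp, hpE⟩ := Nat.exists_prime_and_dvd hne.1
    rcases hsmall p hp (hpE.mul_left 2) with rfl | rfl
    · exact key 2 hp (Or.inr (by rw [pow_two]; exact mul_dvd_mul_left _ hpE))
    · obtain ⟨F, rfl⟩ := hpE
      obtain ⟨p, hp', hpE⟩ := Nat.exists_prime_and_dvd (show F ≠ 1 by rintro rfl; omega)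
      rcases hsmall p hp' ((hpE.mul_left 3).mul_left 2) with rfl | rfl
      · exact key 2 hp' (Or.inr (by rw [pow_two]; exact mul_dvd_mul_left _ (hpE.mul_left 3)))
      · exact key 3 hp (Or.inr (by rw [pow_two]; exact (mul_dvd_mul_left _ hpE).mul_left 2))
  rcases hDE with rfl | rfl
  · exact lm_D2 (m + 1) hr hr2 h
  · refine lm_D6 (m + 1) hr ?_ h
    have h6 := (zs_mod_d (-6) 1 m).2
    have h' : ((⟨1, 1⟩ : ℤ√(-6)) ^ (m + 1)).im = 1 := h
    rw [h'] at h6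
    simp at h6
    omega

/-! negative case -/

def pellList : List (ℕ × ℕ) := [(2, 1), (38, 17), (67, 100), (143, 143), (47, 14), (88, 109),
  (102, 103), (108, 105), (202, 147), (43, 81), (162, 81), (3, 147), (97, 105), (103, 103),
  (117, 109), (158, 14), (62, 143), (138, 100), (167, 17), (203, 1)]

lemma pell_mem (W : ℕ) : ∀ X : ℕ, X ^ 2 + 1 = 5 * W ^ 2 → (X % 205, W % 205) ∈ pellList := by
  induction W using Nat.strong_induction_on with
  | _ W ih =>
    intro X hX
    by_cases h9 : X < 9
    · have hW : W < 5 := by nlinarith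
      interval_cases X <;> interval_cases W <;> simp_all [pellList]
    · have h1 : 20 * W < 9 * X := by
        by_contra hc
        push Not at hc
        nlinarith
      have h2 : 4 * X < 9 * W := by
        by_contra hc
        push Not at hc
        nlinarith
      have h3 : 2 * W < X := by
        by_contra hc
        push Not at hc
        nlinarith
      obtain ⟨X', hX'⟩ : ∃ X', 9 * X = 20 * W + X' := ⟨9 * X - 20 * W, by omega⟩
      obtain ⟨W', hW'⟩ : ∃ W', 9 * W = 4 * X + W' := ⟨9 * W - 4 * X, by omega⟩
      have e1 : X = 9 * X' + 20 * W' := by omega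
      have e2 : W = 4 * X' + 9 * W' := by omega
      have := ih W' (by omega) X' (by rw [e1, e2] at hX; nlinarith)
      have hcl : ∀ p ∈ pellList, ((9 * p.1 + 20 * p.2) % 205, (4 * p.1 + 9 * p.2) % 205) ∈ pellList := by
        decide
      have h4 := hcl _ this
      have e3 : (9 * (X' % 205) + 20 * (W' % 205)) % 205 = X % 205 := by omega
      have e4 : (4 * (X' % 205) + 9 * (W' % 205)) % 205 = W % 205 := by omega
      simp only [e3, e4] at h4
      exact h4

lemma pell_41 (X W : ℕ) (h : X ^ 2 + 1 = 5 * W ^ 2) (hW : 5 ∣ W) : 41 ∣ 2 * X ^ 2 + 1 := by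
  have h1 := pell_mem W X h
  have hcl : ∀ p ∈ pellList, p.2 % 5 = 0 → (2 * p.1 ^ 2 + 1) % 41 = 0 := by decide
  have h2 := hcl _ h1 (by simp only; omega)
  simp only at h2
  have : X % 205 % 41 = X % 41 := by omega
  rw [Nat.dvd_iff_mod_eq_zero]
  rw [← h2, Nat.add_mod, Nat.mul_mod, Nat.pow_mod, ← this]
  simp [Nat.add_mod, Nat.mul_mod, Nat.pow_mod]

lemma five_pow_41 (n : ℕ) (hn : n % 2 = 1) : ¬ (41 : ℤ) ∣ 5 ^ n + 1 := by
  intro h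
  have h1 : (5 : ZMod 41) ^ n = -1 := by
    have := (ZMod.intCast_zmod_eq_zero_iff_dvd (5 ^ n + 1) 41).2 (by exact_mod_cast h)
    push_cast at this
    exact eq_neg_of_add_eq_zero_left this
  have h2 : ((5 : ZMod 41) ^ n) ^ 10 = 1 := by rw [h1]; decide
  rw [← pow_mul, mul_comm, pow_mul, show (5 : ZMod 41) ^ 10 = -1 by decide,
    Odd.neg_one_pow (Nat.odd_iff.2 hn)] at h2
  revert h2; decide

lemma um_main (D : ℕ) (hD : 0 < D) (hD2 : 2 ∣ D)
    (hY : ∀ p q : ℕ, p.Prime → q.Prime → p ∣ D + 1 → q ∣ D + 1 → p = q)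
    (r : ℕ) (hr : 3 < r) (hr2 : r % 2 = 1) :
    ((⟨1, 1⟩ : ℤ√(-(D : ℤ))) ^ r).im ≠ -1 := by
  intro h
  obtain ⟨n, rfl⟩ : ∃ n, r = n + 1 := ⟨r - 1, by omega⟩
  have hDr : D ∣ n + 2 := by
    have h6 := (zs_mod_d (-(D : ℤ)) 1 n).2
    rw [h, neg_dvd] at h6
    have : (D : ℤ) ∣ ((n + 2 : ℕ) : ℤ) := by
      rw [← dvd_neg]; push_cast; convert h6 using 1; simp; ring
    exact_mod_cast this
  have h2 := (zs_mod_Y (-(D : ℤ)) n).2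
  rw [h] at h2
  obtain ⟨q, hq, hqY⟩ := Nat.exists_prime_and_dvd (show D + 1 ≠ 1 by omega)
  obtain ⟨c, hc⟩ : ∃ c, D + 1 = q ^ c :=
    ⟨_, Nat.eq_prime_pow_of_unique_prime_dvd (by omega) (fun {d} hd hdd => hY d q hd hq hdd hqY)⟩
  have hq2 : q ≠ 2 := by rintro rfl; omega
  have hq1 : q - 1 ∣ D := by
    have := Nat.sub_dvd_pow_sub_pow q 1 c
    rw [one_pow, ← hc] at this
    simpa using this
  have hq5 : q = 5 := by
    have := Fact.mk hq
    have ha : (2 : ZMod q) ^ n = -1 := by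
      have : (q : ℤ) ∣ -1 - 2 ^ n := by
        refine dvd_trans ?_ h2
        have : (q : ℤ) ∣ ((D + 1 : ℕ) : ℤ) := by exact_mod_cast hqY
        rw [show (1 - -(D : ℤ)) = ((D + 1 : ℕ) : ℤ) by push_cast; ring]; exact this
      have := (ZMod.intCast_zmod_eq_zero_iff_dvd _ q).2 this
      push_cast at this
      linear_combination -this
    have h20 : (2 : ZMod q) ≠ 0 := by
      intro h0
      have : ((2 : ℕ) : ZMod q) = 0 := by exact_mod_cast h0
      rw [ZMod.natCast_eq_zero_iff] at this
      exact hq2 ((Nat.prime_dvd_prime_iff_eq hq Nat.prime_two).1 this)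
    have hb : (2 : ZMod q) ^ (n + 2) = 1 := by
      obtain ⟨t, ht⟩ := hq1.trans hDr
      rw [ht, pow_mul, ZMod.pow_card_sub_one_eq_one h20, one_pow]
    rw [pow_add, ha] at hb
    have : ((5 : ℕ) : ZMod q) = 0 := by push_cast; linear_combination -hb
    rw [ZMod.natCast_eq_zero_iff] at this
    exact (Nat.prime_dvd_prime_iff_eq hq (by norm_num)).1 this
  subst hq5
  obtain ⟨m, rfl⟩ : ∃ m, n = 2 * m := ⟨n / 2, by omega⟩
  have hnorm := zs_norm (-(D : ℤ)) 1 1 m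
  have h0 := h
  rw [pow_succ, pow_mul', pow_two] at h
  generalize (⟨1, 1⟩ : ℤ√(-(D : ℤ))) ^ m = z at h hnorm
  simp only [Zsqrtd.im_mul, Zsqrtd.re_mul] at h
  have hYz : (D : ℤ) + 1 = 5 ^ c := by exact_mod_cast hc
  have hX : (z.re + z.im) ^ 2 - 5 ^ c * z.im ^ 2 = -1 := by rw [← hYz]; linear_combination h
  have hc0 : c ≠ 0 := by rintro rfl; simp at hc; omega
  rcases Nat.even_or_odd' c with ⟨e, rfl | rfl⟩
  · have h5 : (5 : ℤ) ∣ 5 ^ e := dvd_pow_self _ (by omega)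
    have hf : (5 ^ e * z.im - (z.re + z.im)) * (5 ^ e * z.im + (z.re + z.im)) = 1 := by
      rw [pow_mul'] at hX
      linear_combination -hX
    rcases Int.mul_eq_one_iff_eq_one_or_neg_one.1 hf with ⟨h3, h4⟩ | ⟨h3, h4⟩
    · have : (5 : ℤ) ∣ 1 := h5.trans ⟨z.im, by omega⟩
      norm_num at this
    · have : (5 : ℤ) ∣ 1 := h5.trans ⟨-z.im, by rw [mul_neg]; omega⟩
      norm_num at this
  · rcases Nat.eq_zero_or_pos e with rfl | he
    · have hD4 : D = 4 := by simp at hc; omega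
      subst hD4
      exact lm_D4 (2 * m + 1) hr (by omega) h0
    · have h41 := pell_41 (z.re + z.im).natAbs (5 ^ e * z.im).natAbs (by
        zify; rw [sq_abs, sq_abs]; rw [pow_succ (5 : ℤ), pow_mul'] at hX; linear_combination hX)
        (by rw [Int.natAbs_mul]; refine Dvd.dvd.mul_right ?_ _
            rw [Int.natAbs_pow]; exact dvd_pow_self _ (by omega))
      have h41' : (41 : ℤ) ∣ 2 * (z.re + z.im) ^ 2 + 1 := by
        zify at h41
        rwa [sq_abs] at h41
      refine five_pow_41 ((2 * e + 1) * (2 * m + 1)) (by simp [Nat.mul_mod, Nat.add_mod]) ?_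
      obtain ⟨w, hw⟩ := h41'
      have hn2 : ((5 : ℤ) ^ (2 * e + 1)) ^ m = 2 * (z.re + z.im) ^ 2 + 1 - 2 * (z.re + z.im) * z.im := by
        rw [← hYz] at hX ⊢
        rw [show (D : ℤ) + 1 = 1 ^ 2 - -(D : ℤ) * 1 ^ 2 by ring, ← hnorm]
        linear_combination -hX
      rw [pow_mul, pow_succ, pow_mul', hn2, hw]
      generalize hYY : (5 : ℤ) ^ (2 * e + 1) = YY at *
      generalize z.re + z.im = X at *
      generalize z.im = V at *
      -- completing the square
      refine ⟨YY * (41 * w ^ 2 - 4 * w * X * V) + w * (2 * X ^ 2 + 1), ?_⟩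
      linear_combination (-4 * X ^ 2) * hX + (2 * X ^ 2 + 1) * hw

lemma zs_neg_one (d : ℤ) (r : ℕ) (hr : r % 2 = 1) :
    ((⟨-1, 1⟩ : ℤ√d) ^ r).im = ((⟨1, 1⟩ : ℤ√d) ^ r).im := by
  have e : (⟨-1, 1⟩ : ℤ√d) = -star (⟨1, 1⟩ : ℤ√d) := by ext <;> simp
  rw [e, Odd.neg_pow (Nat.odd_iff.2 hr), ← star_pow, Zsqrtd.im_neg, Zsqrtd.im_star, neg_neg]

-- primes dividing `U`
lemma sit_U (r : ℕ) (hr : r.Prime) (hr2 : r % 2 = 1) (D : ℕ) (a : ℤ)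
    (hcop : IsCoprime a (D : ℤ))
    (hU : ∀ q : ℕ, q.Prime → (q : ℤ) ∣ ((⟨a, 1⟩ : ℤ√(-(D : ℤ))) ^ r).im → q = r ∨ q ∣ D) :
    ∃ j, (((⟨a, 1⟩ : ℤ√(-(D : ℤ))) ^ r).im).natAbs = r ^ j ∧
      (1 ≤ j → r ∣ D) ∧ (5 ≤ r → j ≤ 1) := by
  have hra : r ∣ D → ¬ (r : ℤ) ∣ a := by
    intro h1 h2
    have h3 : (r : ℤ) ∣ (D : ℤ) := by exact_mod_cast h1
    exact (Nat.prime_iff_prime_int.1 hr).not_isUnit (hcop.isUnit_of_dvd' h2 h3)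
  have hrz := Nat.prime_iff_prime_int.1 hr
  obtain ⟨n, hn⟩ : ∃ n, r = n + 1 := ⟨r - 1, by have := hr.pos; omega⟩
  obtain ⟨m, hm⟩ : ∃ m, r = 2 * m + 1 := ⟨r / 2, by omega⟩
  have h1 : ∀ q : ℕ, q.Prime → (q : ℤ) ∣ ((⟨a, 1⟩ : ℤ√(-(D : ℤ))) ^ r).im → q = r := by
    intro q hq hqU
    rcases hU q hq hqU with h | h
    · exact h
    · have hd := (zs_mod_d (-(D : ℤ)) a n).2
      rw [← hn] at hd
      have hqD : (q : ℤ) ∣ (D : ℤ) := by exact_mod_cast h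
      have hqz := Nat.prime_iff_prime_int.1 hq
      have h2 := (dvd_sub_right hqU).1 (((dvd_neg.2 hqD)).trans hd)
      have hqa : ¬ (q : ℤ) ∣ a := fun h3 => hqz.not_isUnit (hcop.isUnit_of_dvd' h3 hqD)
      rcases hqz.dvd_or_dvd h2 with h3 | h3
      · have : q ∣ r := by rw [hn]; exact_mod_cast h3
        exact (Nat.prime_dvd_prime_iff_eq hq hr).1 this
      · exact absurd (hqz.dvd_of_dvd_pow h3) hqa
  have hrD : (r : ℤ) ∣ ((⟨a, 1⟩ : ℤ√(-(D : ℤ))) ^ r).im → r ∣ D := by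
    intro h2
    have h3 := zs_mod_r (-(D : ℤ)) a m (hm ▸ hr)
    rw [← hm] at h3
    have h4 := hrz.dvd_of_dvd_pow ((dvd_sub_right h2).1 h3)
    rw [dvd_neg] at h4
    exact_mod_cast h4
  have hU0 : ((⟨a, 1⟩ : ℤ√(-(D : ℤ))) ^ r).im ≠ 0 := by
    intro h0
    have := h1 2 Nat.prime_two (by rw [h0]; exact dvd_zero _)
    omega
  have hj := Nat.eq_prime_pow_of_unique_prime_dvd (n := (((⟨a, 1⟩ : ℤ√(-(D : ℤ))) ^ r).im).natAbs)
    (p := r) (by simpa using hU0)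
    (fun {q} hq hqU => h1 q hq (Int.natCast_dvd.2 hqU))
  refine ⟨_, hj, ?_, ?_⟩
  · intro h2
    apply hrD
    rw [Int.natCast_dvd, hj]
    exact dvd_pow_self _ (by omega)
  · intro h5
    by_contra hlt
    push Not at hlt
    have h2 : (r : ℤ) ^ 2 ∣ ((⟨a, 1⟩ : ℤ√(-(D : ℤ))) ^ r).im := by
      have : r ^ 2 ∣ (((⟨a, 1⟩ : ℤ√(-(D : ℤ))) ^ r).im).natAbs := by
        rw [hj]; exact pow_dvd_pow _ hlt
      have h3 := Int.natCast_dvd.2 this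
      push_cast at h3
      exact h3
    have hrD' := hrD ((dvd_pow_self _ two_ne_zero).trans h2)
    have h3 := (dvd_sub_right h2).1 (zs_mod_r_sq (-(D : ℤ)) a r hr h5 (by
      rw [dvd_neg]; exact_mod_cast hrD'))
    rw [pow_two] at h3
    have h4 := (mul_dvd_mul_iff_left (by exact_mod_cast hr.ne_zero)).1 h3
    exact hra hrD' (hrz.dvd_of_dvd_pow h4)

-- the cofactor `W`
lemma sit_W (r : ℕ) (hr : r.Prime) (hr2 : r % 2 = 1) (D : ℕ) (a : ℤ)
    (hcop : IsCoprime a (D : ℤ)) (p : ℕ) (hp : p.Prime) (hpa : (p : ℤ) ∣ a)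
    (hA : ∀ p q : ℕ, p.Prime → q.Prime → (p : ℤ) ∣ ((⟨a, 1⟩ : ℤ√(-(D : ℤ))) ^ r).re →
      (q : ℤ) ∣ ((⟨a, 1⟩ : ℤ√(-(D : ℤ))) ^ r).re → p = q) :
    ∃ W : ℤ, ((⟨a, 1⟩ : ℤ√(-(D : ℤ))) ^ r).re = a * W ∧ (W.natAbs = 1 ∨ (W.natAbs = r ∧ p = r)) := by
  obtain ⟨m, hm⟩ : ∃ m, r = 2 * m + 1 := ⟨r / 2, by omega⟩
  have hrz := Nat.prime_iff_prime_int.1 hr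
  have hpz := Nat.prime_iff_prime_int.1 hp
  obtain ⟨W, hW, hW2, -⟩ := zs_mod_a (-(D : ℤ)) a m
  rw [← hm] at hW
  have hmr : (2 * (m : ℤ) + 1) = r := by rw [hm]; push_cast; ring
  rw [hmr] at hW2
  refine ⟨W, hW, ?_⟩
  rw [hW] at hA
  have hpD : ¬ (p : ℤ) ∣ (-(D : ℤ)) ^ m := by
    intro h
    have := hpz.dvd_of_dvd_pow h
    rw [dvd_neg] at this
    exact hpz.not_isUnit (hcop.isUnit_of_dvd' hpa this)
  have hW0 : W ≠ 0 := by
    rintro rfl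
    have := hA 2 3 Nat.prime_two Nat.prime_three (by simp) (by simp)
    omega
  have hj := Nat.eq_prime_pow_of_unique_prime_dvd (n := W.natAbs)
    (p := p) (by simpa using hW0)
    (fun {q} hq hqU => hA q p hq hp ((Int.natCast_dvd.2 hqU).mul_left a) (hpa.mul_right _))
  generalize W.natAbs.primeFactorsList.length = j at hj
  rcases Nat.eq_zero_or_pos j with rfl | hj0
  · left; simpa using hj
  · right
    have hpW : (p : ℤ) ∣ W := by rw [Int.natCast_dvd, hj]; exact dvd_pow_self _ (by omega)
    have h1 : (p : ℤ) ∣ r * (-(D : ℤ)) ^ m :=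
      (dvd_sub_right hpW).1 ((hpa.trans (dvd_pow_self _ two_ne_zero)).trans hW2)
    have hpr : p = r := by
      rcases hpz.dvd_or_dvd h1 with h2 | h2
      · exact (Nat.prime_dvd_prime_iff_eq hp hr).1 (by exact_mod_cast h2)
      · exact absurd h2 hpD
    refine ⟨?_, hpr⟩
    have : j = 1 := by
      by_contra hne
      have h2 : (p : ℤ) ^ 2 ∣ W := by
        have : p ^ 2 ∣ W.natAbs := by rw [hj]; exact pow_dvd_pow _ (by omega)
        have h3 := Int.natCast_dvd.2 this
        push_cast at h3
        exact h3
      have h3 := (dvd_sub_right h2).1 ((pow_dvd_pow_of_dvd hpa 2).trans hW2)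
      rw [← hpr, pow_two] at h3
      exact hpD ((mul_dvd_mul_iff_left (by exact_mod_cast hp.ne_zero)).1 h3)
    rw [hj, this, pow_one, hpr]

lemma three_pow_aux (a : ℤ) (p : ℕ) (hp : p.Prime) (hp2 : p ≠ 2) (f : ℕ) (hf : 1 ≤ f)
    (ha : a.natAbs = p ^ f) (j : ℕ) (h : 8 * a ^ 2 + 1 = 3 ^ j) : False := by
  have hp3 : 3 ≤ p := by have := hp.two_le; omega
  have hpz := Nat.prime_iff_prime_int.1 hp
  have ha2 : a ^ 2 = (p : ℤ) ^ (2 * f) := by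
    rw [← Int.natAbs_sq, ha]; push_cast; ring
  have ha9 : 9 ≤ a ^ 2 := by
    rw [ha2]
    calc (9 : ℤ) = 3 ^ 2 := by norm_num
      _ ≤ (p : ℤ) ^ 2 := by gcongr; exact_mod_cast hp3
      _ ≤ _ := by gcongr <;> omega
  rcases Nat.even_or_odd' j with ⟨i, rfl | rfl⟩
  · rw [pow_mul'] at h
    generalize hM : (3 : ℤ) ^ i = M at h
    have hM0 : 0 < M := by rw [← hM]; positivity
    have hfac : (p : ℤ) ^ (2 * f) ∣ (M - 1) * (M + 1) := ⟨8, by rw [← ha2]; linear_combination -h⟩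
    by_cases hd : (p : ℤ) ∣ M - 1
    · have hnd : ¬ (p : ℤ) ∣ M + 1 := by
        intro h2
        have h3 : (p : ℤ) ∣ 2 := by
          have := dvd_sub h2 hd
          rwa [show M + 1 - (M - 1) = 2 by ring] at this
        have := Int.le_of_dvd (by norm_num) h3
        omega
      have hc : IsCoprime ((p : ℤ) ^ (2 * f)) (M + 1) :=
        IsCoprime.pow_left ((Prime.coprime_iff_not_dvd hpz).2 hnd)
      obtain ⟨k, hk⟩ := hc.dvd_of_dvd_mul_right hfac
      rw [← ha2] at hk
      have h8 : k * (M + 1) = 8 := by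
        have : a ^ 2 * (k * (M + 1)) = a ^ 2 * 8 := by
          linear_combination - h - (M + 1) * hk
        exact mul_left_cancel₀ (by positivity) this
      have hk0 : 0 < k := by by_contra hc; push Not at hc; nlinarith
      nlinarith
    · have hc : IsCoprime ((p : ℤ) ^ (2 * f)) (M - 1) :=
        IsCoprime.pow_left ((Prime.coprime_iff_not_dvd hpz).2 hd)
      obtain ⟨k, hk⟩ := hc.dvd_of_dvd_mul_left hfac
      rw [← ha2] at hk
      have h8 : k * (M - 1) = 8 := by
        have : a ^ 2 * (k * (M - 1)) = a ^ 2 * 8 := by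
          linear_combination - h - (M - 1) * hk
        exact mul_left_cancel₀ (by positivity) this
      have hk0 : 0 < k := by by_contra hc; push Not at hc; nlinarith
      have hM8 : 8 ≤ M := by nlinarith
      have hk1 : k = 1 := by nlinarith
      subst hk1
      have : a ^ 2 = 10 := by linarith
      have : a < 4 := by nlinarith
      have : -4 < a := by nlinarith
      interval_cases a <;> omega
  · rw [pow_succ (3 : ℤ), pow_mul] at h
    have h1 : ((3 : ℤ) ^ 2) ^ i % 8 = 1 := by
      rw [show (3 : ℤ) ^ 2 = 9 by norm_num]
      have := (Int.emod_emod_of_dvd (9 ^ i) (dvd_refl 8))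
      have h9 : (9 : ℤ) ^ i ≡ 1 ^ i [ZMOD 8] := Int.ModEq.pow i (by decide)
      rw [one_pow] at h9
      exact h9
    omega

lemma sit_S (r : ℕ) (hr : r.Prime) (hr2 : r % 2 = 1) (D : ℕ) (hD : 0 < D) (hD2 : 2 ∣ D) (a : ℤ)
    (ha2 : a % 2 = 1) (hcop : IsCoprime a (D : ℤ))
    (hA : ∀ p q : ℕ, p.Prime → q.Prime → (p : ℤ) ∣ ((⟨a, 1⟩ : ℤ√(-(D : ℤ))) ^ r).re →
      (q : ℤ) ∣ ((⟨a, 1⟩ : ℤ√(-(D : ℤ))) ^ r).re → p = q)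
    (hY : ∀ p q : ℕ, p.Prime → q.Prime → (p : ℤ) ∣ a ^ 2 + D → (q : ℤ) ∣ a ^ 2 + D → p = q)
    (hU : ∀ q : ℕ, q.Prime → (q : ℤ) ∣ ((⟨a, 1⟩ : ℤ√(-(D : ℤ))) ^ r).im → q = r ∨ q ∣ D) :
    a ^ 2 = 1 ∧ ((r = 3 ∧ D = 2) ∨ (r = 3 ∧ D = 4) ∨ (r = 5 ∧ D = 10) ∨
      (r = 3 ∧ ∃ j, 1 ≤ j ∧ D = 3 + 3 ^ j)) := by
  obtain ⟨j, hj, hj1, hj5⟩ := sit_U r hr hr2 D a hcop hU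
  have hr3 : 3 ≤ r := by have := hr.two_le; omega
  have e3 : ∀ a : ℤ, (⟨a, 1⟩ : ℤ√(-(D : ℤ))) ^ 3 = ⟨a * (a ^ 2 - 3 * D), 3 * a ^ 2 - D⟩ := by
    intro a
    rw [pow_succ, pow_two]; ext <;> simp <;> ring
  by_cases ha1 : a.natAbs = 1
  · have haa : a ^ 2 = 1 := by rw [← Int.natAbs_sq, ha1]; norm_num
    refine ⟨haa, ?_⟩
    have hU1 : ((⟨a, 1⟩ : ℤ√(-(D : ℤ))) ^ r).im = ((⟨1, 1⟩ : ℤ√(-(D : ℤ))) ^ r).im := by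
      rcases Int.natAbs_eq a with h | h <;> rw [ha1] at h <;> push_cast at h <;> rw [h]
      exact zs_neg_one _ r hr2
    rw [hU1] at hj
    have hYD : ∀ p q : ℕ, p.Prime → q.Prime → p ∣ D + 1 → q ∣ D + 1 → p = q := by
      intro p q hp hq h1 h2
      refine hY p q hp hq ?_ ?_ <;> rw [haa, add_comm] <;> exact_mod_cast (by assumption)
    rcases Nat.lt_or_ge 3 r with hlt | hge
    · have hr5 : 5 ≤ r := by omega
      have h1 := up_main D hD hD2 r hlt hr2
      have h2 := um_main D hD hD2 hYD r hlt hr2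
      have hj' : j = 0 ∨ j = 1 := by have := hj5 hr5; omega
      rcases hj' with rfl | rfl
      · rw [pow_zero] at hj; omega
      · rw [pow_one] at hj
        have hrD := hj1 le_rfl
        have hrDz : (r : ℤ) ∣ -(D : ℤ) := by rw [dvd_neg]; exact_mod_cast hrD
        have h3 := zs_mod_r_sq (-(D : ℤ)) 1 r hr hr5 hrDz
        rcases Int.natAbs_eq ((⟨1, 1⟩ : ℤ√(-(D : ℤ))) ^ r).im with h | h
        · rw [hj] at h
          rcases Nat.lt_or_ge 5 r with h5 | h5
          · exact absurd h (zs_ne_r _ r hr (by omega) hrDz (by omega))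
          · have hr5' : r = 5 := by omega
            subst hr5'
            have e5 : ((⟨1, 1⟩ : ℤ√(-(D : ℤ))) ^ 5).im = 5 - 10 * D + D ^ 2 := by
              rw [pow_succ, pow_succ, e3, Zsqrtd.im_mul, Zsqrtd.im_mul, Zsqrtd.re_mul]; ring
            rw [e5] at h
            have : (D : ℤ) * (D - 10) = 0 := by push_cast at h; linear_combination h
            rcases mul_eq_zero.1 this with h | h <;> omega
        · rw [hj] at h
          rw [h, one_pow, mul_one, show -(r : ℤ) - r = r * (-2) by ring, pow_two] at h3
          have h4 := (mul_dvd_mul_iff_left (by exact_mod_cast hr.ne_zero)).1 h3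
          rw [dvd_neg] at h4
          have := Int.le_of_dvd (by norm_num) h4
          omega
    · have hr3 : r = 3 := by omega
      subst hr3
      rw [e3] at hj
      simp only at hj
      rcases Nat.eq_zero_or_pos j with rfl | hj0
      · rw [pow_zero] at hj; omega
      · right; right; right
        refine ⟨rfl, j, hj0, ?_⟩
        have : 3 ≤ 3 ^ j := by
          calc 3 = 3 ^ 1 := by norm_num
            _ ≤ _ := Nat.pow_le_pow_right (by norm_num) hj0
        omega
  · exfalso
    obtain ⟨p, hp, hpa'⟩ := Nat.exists_prime_and_dvd ha1
    have hpa : (p : ℤ) ∣ a := Int.natCast_dvd.2 hpa'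
    have hp2 : p ≠ 2 := by rintro rfl; omega
    obtain ⟨W, hW, hW1⟩ := sit_W r hr hr2 D a hcop p hp hpa hA
    have ha0 : a ≠ 0 := by rintro rfl; omega
    have haf := Nat.eq_prime_pow_of_unique_prime_dvd (n := a.natAbs)
      (p := p) (by simpa using ha0)
      (fun {q} hq hqU => hA q p hq hp (by rw [hW]; exact (Int.natCast_dvd.2 hqU).mul_right _)
        (by rw [hW]; exact hpa.mul_right _))
    generalize a.natAbs.primeFactorsList.length = f at haf
    have hf : 1 ≤ f := by
      rcases Nat.eq_zero_or_pos f with rfl | h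
      · exact absurd haf ha1
      · exact h
    have ha9 : 9 ≤ a ^ 2 := by
      have : 3 ≤ a.natAbs := by have := hp.two_le; have := Nat.le_of_dvd (by omega) hpa'; omega
      rw [← Int.natAbs_sq]
      have : (3 : ℤ) ≤ a.natAbs := by exact_mod_cast this
      nlinarith
    by_cases hle : j ≤ 1
    · have hUr : ((⟨a, 1⟩ : ℤ√(-(D : ℤ))) ^ r).im ^ 2 ≤ (r : ℤ) ^ 2 := by
        rw [← Int.natAbs_sq, hj]
        push_cast
        gcongr
        calc (r : ℤ) ^ j ≤ r ^ 1 := by gcongr; omega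
          _ = r := pow_one _
      have hWr : W ^ 2 ≤ (r : ℤ) ^ 2 := by
        rw [← Int.natAbs_sq]
        gcongr
        rcases hW1 with h | h <;> omega
      have hn := zs_norm (-(D : ℤ)) a 1 r
      rw [hW] at hn
      have hYr : (a ^ 2 + D) ^ r ≤ (r : ℤ) ^ 2 * (a ^ 2 + D) := by
        rw [show a ^ 2 + (D : ℤ) = a ^ 2 - -(D : ℤ) * 1 ^ 2 by ring, ← hn]
        have h1 : (0 : ℤ) ≤ D := by positivity
        have h2 := mul_le_mul_of_nonneg_left hUr h1
        have h3 := mul_le_mul_of_nonneg_left hWr (sq_nonneg a)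
        linarith
      obtain ⟨s, hs⟩ : ∃ s, r = s + 2 := ⟨r - 2, by omega⟩
      have hY11 : 11 ≤ a ^ 2 + (D : ℤ) := by
        have : 2 ≤ D := Nat.le_of_dvd hD hD2
        omega
      generalize a ^ 2 + (D : ℤ) = Y at hYr hY11
      have h4 : Y ^ (s + 1) ≤ (r : ℤ) ^ 2 := by
        rw [hs, pow_succ, ← hs] at hYr
        exact le_of_mul_le_mul_right hYr (by linarith)
      have h5 : ((s : ℤ) + 2) ^ 2 < 11 ^ (s + 1) := by
        clear * -
        induction s with
        | zero => norm_num
        | succ s ih =>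
          rw [pow_succ (11 : ℤ)]; push_cast; nlinarith
      have h6 : (11 : ℤ) ^ (s + 1) ≤ Y ^ (s + 1) := by gcongr
      rw [hs] at h4
      push_cast at h4
      linarith
    · have hr3 : r = 3 := by
        by_contra hne
        exact hle (hj5 (by omega))
      subst hr3
      have h3D : 3 ∣ D := hj1 (by omega)
      have hp3 : p ≠ 3 := by
        rintro rfl
        have h3 : ((3 : ℕ) : ℤ) ∣ (D : ℤ) := by exact_mod_cast h3D
        exact (Nat.prime_iff_prime_int.1 hp).not_isUnit (hcop.isUnit_of_dvd' hpa h3)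
      have hWW : W.natAbs = 1 := by
        rcases hW1 with h | h
        · exact h
        · exact absurd h.2 hp3
      rw [e3] at hW hj
      simp only at hW hj
      have hW' : W = a ^ 2 - 3 * D := (mul_left_cancel₀ ha0 hW).symm
      have hm3 : a ^ 2 % 3 = 0 ∨ a ^ 2 % 3 = 1 := by
        rcases (by omega : a % 3 = 0 ∨ a % 3 = 1 ∨ a % 3 = 2) with h | h | h <;>
          simp [pow_two, Int.mul_emod, h]
      have hW1' : a ^ 2 - 3 * D = 1 := by omega
      have hU3 : 8 * a ^ 2 + 1 = 3 ^ (j + 1) := by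
        have hpos : 0 ≤ 3 * a ^ 2 - (D : ℤ) := by omega
        have : (3 * a ^ 2 - (D : ℤ)) = 3 ^ j := by
          have h7 : ((3 * a ^ 2 - (D : ℤ)).natAbs : ℤ) = ((3 ^ j : ℕ) : ℤ) := by rw [hj]
          rw [Int.natAbs_of_nonneg hpos] at h7
          push_cast at h7; exact h7
        rw [pow_succ (3 : ℤ), ← this]; linear_combination - hW1'
      exact three_pow_aux a p hp hp2 f hf haf _ hU3

lemma zset_gcd (Z : ℕ → Prop) (h0 : Z 0) (hadd : ∀ m n, Z m → Z n → Z (m + n))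
    (hsub : ∀ m n, Z (m + n) → Z m → Z n) (m n : ℕ) (hm : Z m) (hn : Z n) : Z (Nat.gcd m n) := by
  induction m, n using Nat.gcd.induction with
  | H0 n => simpa using hn
  | H1 m n hpos ih =>
    rw [Nat.gcd_rec]
    refine ih ?_ hm
    have hmul : ∀ k, Z (m * k) := by
      intro k
      induction k with
      | zero => simpa using h0
      | succ k ih2 => rw [Nat.mul_succ]; exact hadd _ _ ih2 hm
    refine hsub (m * (n / m)) _ ?_ (hmul _)
    rwa [Nat.div_add_mod]

lemma frob_im (d a b : ℤ) (q : ℕ) (hq : q.Prime) (hq2 : q % 2 = 1) :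
    (q : ℤ) ∣ ((⟨a, b⟩ : ℤ√d) ^ q).re - a ∧
    (q : ℤ) ∣ ((⟨a, b⟩ : ℤ√d) ^ q).im - jacobiSym d q * b := by
  have := Fact.mk hq
  obtain ⟨z, hz⟩ := exists_add_pow_prime_eq hq (a : ℤ√d) ((b : ℤ√d) * (Zsqrtd.sqrtd : ℤ√d))
  have e : (⟨a, b⟩ : ℤ√d) = (a : ℤ√d) + ((b : ℤ√d) * (Zsqrtd.sqrtd : ℤ√d)) := by ext <;> simp
  rw [← e, mul_pow, zs_sqrtd_pow] at hz
  simp only [hq2] at hz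
  have h3 : ((a : ℤ√d) ^ q) = ((a ^ q : ℤ) : ℤ√d) := by push_cast; rfl
  have h3' : ((b : ℤ√d) ^ q) = ((b ^ q : ℤ) : ℤ√d) := by push_cast; rfl
  have h4 : (q : ℤ√d) * (a : ℤ√d) * ((b : ℤ√d) * (Zsqrtd.sqrtd : ℤ√d)) * z
     = ((q : ℤ) : ℤ√d) * ((a : ℤ√d) * ((b : ℤ√d) * (Zsqrtd.sqrtd : ℤ√d)) * z) := by push_cast; ring
  rw [h4, h3, h3'] at hz
  have hpa : ∀ a : ℤ, (q : ℤ) ∣ a ^ q - a := by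
    intro a
    rw [← ZMod.intCast_zmod_eq_zero_iff_dvd]
    push_cast
    rw [ZMod.pow_card, sub_self]
  have hd : (q : ℤ) ∣ d ^ (q / 2) - jacobiSym d q := by
    rw [← ZMod.intCast_zmod_eq_zero_iff_dvd]
    push_cast
    rw [← jacobiSym.legendreSym.to_jacobiSym, legendreSym.eq_pow, sub_self]
  rw [hz]
  simp only [Zsqrtd.re_add, Zsqrtd.im_add, Zsqrtd.re_smul, Zsqrtd.im_smul, Zsqrtd.re_intCast,
    Zsqrtd.im_intCast]
  constructor
  · obtain ⟨w, hw⟩ := hpa a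
    simp only [if_false, mul_zero, add_zero, one_ne_zero]
    refine ⟨w + ((a : ℤ√d) * ((b : ℤ√d) * (Zsqrtd.sqrtd : ℤ√d)) * z).re, ?_⟩
    linear_combination hw
  · obtain ⟨w, hw⟩ := hpa b
    obtain ⟨w', hw'⟩ := hd
    simp only [if_true, zero_add]
    refine ⟨w * d ^ (q / 2) + w' * b + ((a : ℤ√d) * ((b : ℤ√d) * (Zsqrtd.sqrtd : ℤ√d)) * z).im, ?_⟩
    linear_combination (d ^ (q / 2)) * hw + b * hw'

lemma rank_lemma (d : ℤ) (c : ℤ√d) (q : ℕ) (hq : q.Prime) (hq2 : q ≠ 2)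
    (hqd : ¬ (q : ℤ) ∣ d) (hqN : ¬ (q : ℤ) ∣ c.re ^ 2 - d * c.im ^ 2) (r t : ℕ) (hr : r.Prime)
    (h1 : (q : ℤ) ∣ (c ^ (r ^ (t + 1))).im) (h2 : ¬ (q : ℤ) ∣ (c ^ (r ^ t)).im) :
    r ^ (t + 1) ∣ ((q : ℤ) - jacobiSym d q).toNat := by
  have hqodd : q % 2 = 1 := by
    rcases hq.eq_two_or_odd with h | h
    · exact absurd h hq2
    · exact h
  have := Fact.mk hq
  have hqz := Nat.prime_iff_prime_int.1 hq
  let Z : ℕ → Prop := fun n => (q : ℤ) ∣ (c ^ n).im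
  have h0 : Z 0 := by simp [Z]
  have hadd : ∀ m n, Z m → Z n → Z (m + n) := by
    intro m n hm hn
    change (q : ℤ) ∣ (c ^ (m + n)).im
    rw [pow_add, Zsqrtd.im_mul]
    exact dvd_add (Dvd.dvd.mul_left hn _) (Dvd.dvd.mul_right hm _)
  have hre : ∀ m, Z m → ¬ (q : ℤ) ∣ (c ^ m).re := by
    intro m hm hm'
    have := zs_norm d c.re c.im m
    apply hqN
    apply hqz.dvd_of_dvd_pow (n := m)
    rw [← this]
    exact dvd_sub (dvd_pow hm' two_ne_zero) (Dvd.dvd.mul_left (dvd_pow hm two_ne_zero) _)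
  have hsub : ∀ m n, Z (m + n) → Z m → Z n := by
    intro m n hmn hm
    change (q : ℤ) ∣ (c ^ (m + n)).im at hmn
    rw [pow_add, Zsqrtd.im_mul] at hmn
    have := (dvd_add_left (Dvd.dvd.mul_right hm _)).1 hmn
    exact (hqz.dvd_or_dvd this).resolve_left (hre m hm)
  have hmul : ∀ m k, Z m → Z (m * k) := by
    intro m k hm
    induction k with
    | zero => simpa using h0
    | succ k ih2 => rw [Nat.mul_succ]; exact hadd _ _ ih2 hm
  have he : Z (((q : ℤ) - jacobiSym d q).toNat) := by
    obtain ⟨f1, f2⟩ := frob_im d c.re c.im q hq hqodd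
    have hd0 : ((d : ℤ) : ZMod q) ≠ 0 := by
      rwa [Ne, ZMod.intCast_zmod_eq_zero_iff_dvd]
    have hj := legendreSym.eq_one_or_neg_one q hd0
    rw [jacobiSym.legendreSym.to_jacobiSym] at hj
    change (q : ℤ) ∣ (c ^ q).re - c.re at f1
    change (q : ℤ) ∣ (c ^ q).im - _ at f2
    rcases hj with hj | hj
    · rw [hj] at f2 ⊢
      have hq1 : ((q : ℤ) - 1).toNat = q - 1 := by omega
      rw [hq1]
      change (q : ℤ) ∣ (c ^ (q - 1)).im
      obtain ⟨n, hn⟩ : ∃ n, q = n + 1 := ⟨q - 1, by omega⟩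
      have hc : c ^ q = c ^ (q - 1) * c := by rw [hn]; simp [pow_succ]
      rw [hc, Zsqrtd.re_mul] at f1
      rw [hc, Zsqrtd.im_mul] at f2
      refine (hqz.dvd_or_dvd ?_).resolve_left hqN
      obtain ⟨u, hu⟩ := f1
      obtain ⟨v, hv⟩ := f2
      refine ⟨c.re * v - c.im * u, ?_⟩
      linear_combination c.re * hv - c.im * hu
    · rw [hj] at f2 ⊢
      have hq1 : ((q : ℤ) - -1).toNat = q + 1 := by omega
      rw [hq1]
      change (q : ℤ) ∣ (c ^ (q + 1)).im
      rw [pow_succ, Zsqrtd.im_mul]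
      obtain ⟨u, hu⟩ := f1
      obtain ⟨v, hv⟩ := f2
      refine ⟨c.im * u + c.re * v, ?_⟩
      linear_combination c.im * hu + c.re * hv
  have hg := zset_gcd Z h0 hadd hsub _ _ h1 he
  obtain ⟨s, hs, hse⟩ := (Nat.dvd_prime_pow hr).1 (Nat.gcd_dvd_left (r ^ (t + 1)) ((q : ℤ) - jacobiSym d q).toNat)
  rcases Nat.lt_or_ge t s with hlt | hge
  · have : s = t + 1 := by omega
    rw [← this, ← hse]
    exact Nat.gcd_dvd_right _ _
  · exfalso
    apply h2
    rw [hse] at hg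
    obtain ⟨w, hw⟩ := pow_dvd_pow r hge
    rw [hw]
    exact hmul _ _ hg

open NumberField in
lemma qf_quadratic (K : Type) [Field K] [NumberField K] (hK2 : Module.finrank ℚ K = 2) (e : 𝓞 K) :
    ∃ t N : ℤ, (e : K) ^ 2 - t * (e : K) + N = 0 := by
  have hIntgr : IsIntegral ℤ (e : K) := e.2
  have hq : IsIntegral ℚ (e : K) := Algebra.IsIntegral.isIntegral _
  have h1 := minpoly.isIntegrallyClosed_eq_field_fractions' ℚ hIntgr
  have h2 := minpoly.natDegree_le (A := ℚ) (e : K)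
  have h3 := minpoly.natDegree_pos hq
  have hm := minpoly.monic hIntgr
  have h4 : (minpoly ℚ (e : K)).natDegree = (minpoly ℤ (e : K)).natDegree := by
    rw [h1, hm.natDegree_map]
  rw [hK2] at h2
  have h5 := minpoly.aeval ℤ (e : K)
  rw [h4] at h2 h3
  rw [Polynomial.aeval_eq_sum_range] at h5
  rcases (by omega : (minpoly ℤ (e : K)).natDegree = 1 ∨ (minpoly ℤ (e : K)).natDegree = 2) with h | h
  · have hl : (minpoly ℤ (e : K)).coeff 1 = 1 := by rw [← h]; exact hm
    rw [h] at h5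
    simp only [Finset.sum_range_succ, Finset.sum_range_zero, hl, zsmul_eq_mul] at h5
    push_cast at h5
    refine ⟨-2 * (minpoly ℤ (e : K)).coeff 0, (minpoly ℤ (e : K)).coeff 0 ^ 2, ?_⟩
    push_cast
    linear_combination ((e : K) + ((minpoly ℤ (e : K)).coeff 0 : K)) * h5
  · have hl : (minpoly ℤ (e : K)).coeff 2 = 1 := by rw [← h]; exact hm
    rw [h] at h5
    simp only [Finset.sum_range_succ, Finset.sum_range_zero, hl, zsmul_eq_mul] at h5
    push_cast at h5
    refine ⟨-(minpoly ℤ (e : K)).coeff 1, (minpoly ℤ (e : K)).coeff 0, ?_⟩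
    push_cast
    linear_combination h5

lemma qf_rat (P : ℕ) (hP : Squarefree P) (q : ℚ) (M : ℤ) (h : (P : ℚ) * q ^ 2 = M) :
    ∃ B : ℤ, q = B := by
  have hden : (q.den : ℚ) ≠ 0 := by exact_mod_cast q.den_nz
  have h1 : (P : ℚ) * q.num ^ 2 = M * q.den ^ 2 := by
    have : q = q.num / q.den := (Rat.num_div_den q).symm
    rw [this] at h
    field_simp at h
    linear_combination h
  have h2 : (P : ℤ) * q.num ^ 2 = M * (q.den : ℤ) ^ 2 := by exact_mod_cast h1
  have hc : IsCoprime ((q.den : ℤ) ^ 2) (q.num ^ 2) := by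
    apply IsCoprime.pow
    rw [Int.isCoprime_iff_gcd_eq_one, Int.gcd_comm]
    exact q.reduced
  have h3 : (q.den : ℤ) ^ 2 ∣ (P : ℤ) := hc.dvd_of_dvd_mul_right ⟨M, by rw [h2]; ring⟩
  have h4 : q.den * q.den ∣ P := by rw [← pow_two]; exact_mod_cast h3
  have h5 := Nat.isUnit_iff.1 (hP _ h4)
  exact ⟨q.num, by conv_lhs => rw [← Rat.num_div_den q, h5]; simp⟩

lemma qf_indep (K : Type) [Field K] [CharZero K] (P : ℕ) (hP : 0 < P)
    (s : K) (hs : s ^ 2 = -(P : K)) (p q : ℚ) (h : (p : K) + q * s = 0) : p = 0 ∧ q = 0 := by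
  have h1 : ((p ^ 2 + P * q ^ 2 : ℚ) : K) = 0 := by
    push_cast
    linear_combination ((p : K) - q * s) * h + (q : K) ^ 2 * hs
  have h2 : p ^ 2 + P * q ^ 2 = 0 := by exact_mod_cast h1
  have hP' : (0 : ℚ) < P := by exact_mod_cast hP
  have h3 : q = 0 := by
    by_contra hq
    have : 0 < q ^ 2 := by positivity
    nlinarith [sq_nonneg p]
  subst h3
  refine ⟨?_, rfl⟩
  simpa using h2

lemma qf_indep_int (K : Type) [Field K] [CharZero K] (P : ℕ) (hP : 0 < P)
    (s : K) (hs : s ^ 2 = -(P : K)) (a b a' b' : ℤ) (h : (a : K) + b * s = a' + b' * s) :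
    a = a' ∧ b = b' := by
  have := qf_indep K P hP s hs (a - a') (b - b') (by push_cast; linear_combination h)
  constructor
  · have h1 := this.1
    have : (a : ℚ) = a' := by linarith
    exact_mod_cast this
  · have h1 := this.2
    have : (b : ℚ) = b' := by linarith
    exact_mod_cast this

lemma qf_span (K : Type) [Field K] [NumberField K] (hK2 : Module.finrank ℚ K = 2) (P : ℕ)
    (hP : 0 < P) (s : K) (hs : s ^ 2 = -(P : K)) (e : K) : ∃ p q : ℚ, e = p + q * s := by
  have hli : LinearIndependent ℚ ![(1 : K), s] := by
    rw [LinearIndependent.pair_iff]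
    intro p q h
    apply qf_indep K P hP s hs
    rw [Algebra.smul_def, Algebra.smul_def] at h
    simpa using h
  let b := basisOfLinearIndependentOfCardEqFinrank hli (by rw [hK2]; simp)
  have h1 := b.sum_repr e
  rw [Fin.sum_univ_two] at h1
  refine ⟨b.repr e 0, b.repr e 1, ?_⟩
  have hb0 : b 0 = 1 := by simp [b]
  have hb1 : b 1 = s := by simp [b]
  rw [hb0, hb1, Algebra.smul_def, Algebra.smul_def] at h1
  rw [mul_one] at h1
  exact h1.symm

open NumberField in
lemma qf_half (K : Type) [Field K] [NumberField K] (hK2 : Module.finrank ℚ K = 2) (P : ℕ)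
    (hP : Squarefree P) (s : K) (hs : s ^ 2 = -(P : K)) (e : 𝓞 K) :
    ∃ A B M : ℤ, 2 * (e : K) = A + B * s ∧ A ^ 2 + P * B ^ 2 = 4 * M := by
  have hP0 : 0 < P := Nat.pos_of_ne_zero hP.ne_zero
  obtain ⟨t, N, htN⟩ := qf_quadratic K hK2 e
  obtain ⟨p, q, hpq⟩ := qf_span K hK2 P hP0 s hs (2 * (e : K) - t)
  have h1 : ((p ^ 2 - P * q ^ 2 - (t ^ 2 - 4 * N) : ℚ) : K) + ((2 * p * q : ℚ) : K) * s = 0 := by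
    push_cast
    linear_combination 4 * htN - (2 * (e : K) - t + (p + q * s)) * hpq - (q : K) ^ 2 * hs
  obtain ⟨h2, h3⟩ := qf_indep K P hP0 s hs _ _ h1
  have h4 : p = 0 ∨ q = 0 := by simpa using h3
  rcases h4 with rfl | rfl
  · obtain ⟨B, rfl⟩ := qf_rat P hP q (4 * N - t ^ 2) (by push_cast; linear_combination -h2)
    refine ⟨t, B, N, ?_, ?_⟩
    · push_cast at hpq; linear_combination hpq
    · have : (t : ℚ) ^ 2 + P * (B : ℚ) ^ 2 = 4 * N := by linear_combination -h2
      exact_mod_cast this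
  · obtain ⟨B, rfl⟩ := qf_rat 1 squarefree_one p (t ^ 2 - 4 * N) (by push_cast; linear_combination h2)
    have h5 : (B : ℚ) ^ 2 = t ^ 2 - 4 * N := by linear_combination h2
    have h6 : B ^ 2 = t ^ 2 - 4 * N := by exact_mod_cast h5
    have h7 : (t + B) % 2 = 0 := by
      have h8 : (t * t - B * B) % 2 = 0 := by
        have : t * t - B * B = 4 * N := by linear_combination -h6
        omega
      rcases Int.emod_two_eq_zero_or_one t with h | h <;>
        rcases Int.emod_two_eq_zero_or_one B with h' | h' <;>
        simp [Int.sub_emod, Int.mul_emod, h, h'] at h8 <;> omega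
    obtain ⟨m, hm⟩ : ∃ m, t + B = 2 * m := ⟨(t + B) / 2, by omega⟩
    refine ⟨t + B, 0, m ^ 2, ?_, ?_⟩
    · push_cast at hpq ⊢; linear_combination hpq
    · rw [hm]; ring

open NumberField in
lemma qf_ideal (K : Type) [Field K] [NumberField K] (h n T : ℕ) (hn : 0 < n)
    (hhprinc : ∀ I : Ideal (𝓞 K), (I ^ h).IsPrincipal) (hT : T * Nat.gcd h n ∣ n)
    (b b' : 𝓞 K) (y : ℤ) (hy : y ≠ 0) (hbb : b * b' = (y : 𝓞 K) ^ n) (hcop : IsCoprime b b') :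
    ∃ c e : 𝓞 K, IsUnit e ∧ b = e * c ^ T := by
  have hb0 : b ≠ 0 := by
    rintro rfl
    rw [zero_mul] at hbb
    exact hy (by exact_mod_cast (pow_eq_zero_iff hn.ne').1 hbb.symm)
  have hc1 : IsCoprime (Ideal.span {b}) (Ideal.span {b'}) :=
    (Ideal.isCoprime_span_singleton_iff b b').2 hcop
  have hc2 : Ideal.span {b} * Ideal.span {b'} = (Ideal.span {(y : 𝓞 K)}) ^ n := by
    rw [Ideal.span_singleton_mul_span_singleton, hbb, Ideal.span_singleton_pow]
  classical
  obtain ⟨I, hI⟩ : ∃ I : Ideal (𝓞 K), Ideal.span {b} = I ^ n := by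
    let _ : NormalizedGCDMonoid (Ideal (𝓞 K)) := UniqueFactorizationMonoid.toNormalizedGCDMonoid _
    exact exists_eq_pow_of_mul_eq_pow_of_coprime hc1 hc2
  have hI0 : I ≠ 0 := by
    rintro rfl
    rw [zero_pow hn.ne'] at hI
    exact hb0 (by simpa using hI)
  have hmem : I ∈ nonZeroDivisors (Ideal (𝓞 K)) := mem_nonZeroDivisors_of_ne_zero hI0
  have hpow : ∀ m, (I ^ m).IsPrincipal ↔ (ClassGroup.mk0 ⟨I, hmem⟩) ^ m = 1 := by
    intro m
    rw [← map_pow, SubmonoidClass.mk_pow, ClassGroup.mk0_eq_one_iff]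
  have hIn : (I ^ n).IsPrincipal := by rw [← hI]; exact ⟨⟨b, rfl⟩⟩
  have hg := pow_gcd_eq_one.2 ⟨(hpow h).1 (hhprinc I), (hpow n).1 hIn⟩
  obtain ⟨m, hm⟩ := hT
  have hgm : (I ^ (Nat.gcd h n * m)).IsPrincipal := by
    rw [hpow, pow_mul, hg, one_pow]
  obtain ⟨⟨c, hc⟩⟩ := hgm
  have hc' : I ^ (Nat.gcd h n * m) = Ideal.span {c} := hc
  have h3 : Ideal.span {b} = Ideal.span {c ^ T} := by
    rw [hI, ← Ideal.span_singleton_pow, ← hc', ← pow_mul]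
    congr 1
    rw [mul_comm _ T, ← mul_assoc]; exact hm
  rw [Ideal.span_singleton_eq_span_singleton] at h3
  obtain ⟨e, he⟩ := h3.symm
  exact ⟨c, e, e.isUnit, by rw [← he, mul_comm]⟩

lemma qc_inj {K : Type} [Field K] [CharZero K] {P : ℕ} (hP : 0 < P) {s : K} (hs : s ^ 2 = -(P : K))
    (f : ℤ√(-(P : ℤ)) →+* K) (hf : ∀ z, f z = z.re + z.im * s) (z w : ℤ√(-(P : ℤ)))
    (h : f z = f w) : z = w := by
  rw [hf, hf] at h
  obtain ⟨h1, h2⟩ := qf_indep_int K P hP s hs _ _ _ _ h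
  exact Zsqrtd.ext h1 h2

lemma qc_clear {K : Type} [Field K] [CharZero K] {P : ℕ} (hP : 0 < P) {s : K}
    (hs : s ^ 2 = -(P : K))
    (f : ℤ√(-(P : ℤ)) →+* K) (hf : ∀ z, f z = z.re + z.im * s) (c w : ℤ√(-(P : ℤ)))
    (hc : c.norm % 2 = 1) (g : K) (A B : ℤ) (hg : 2 * g = A + B * s) (h : f c * g = f w) :
    A % 2 = 0 ∧ B % 2 = 0 := by
  have h1 : f (c.norm : ℤ√(-(P : ℤ))) = f c * f (star c) := by
    rw [← map_mul, Zsqrtd.norm_eq_mul_conj]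
  rw [map_intCast] at h1
  have h2 : (c.norm : K) * (A + B * s) = 2 * f (star c * w) := by
    rw [← hg, h1, map_mul, ← h]; ring
  rw [hf] at h2
  obtain ⟨h3, h4⟩ := qf_indep_int K P hP s hs (c.norm * A) (c.norm * B) (2 * (star c * w).re)
    (2 * (star c * w).im) (by push_cast; linear_combination h2)
  constructor
  · have : (c.norm * A) % 2 = 0 := by omega
    rw [Int.mul_emod, hc] at this
    omega
  · have : (c.norm * B) % 2 = 0 := by omega
    rw [Int.mul_emod, hc] at this
    omega

lemma qc_prod {K : Type} [Field K] [CharZero K] {P : ℕ} (hP : 0 < P) {s : K}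
    (hs : s ^ 2 = -(P : K)) (g g' : K) (A B M A' B' M' n : ℤ)
    (hg : 2 * g = A + B * s) (hM : A ^ 2 + P * B ^ 2 = 4 * M)
    (hg' : 2 * g' = A' + B' * s) (hM' : A' ^ 2 + P * B' ^ 2 = 4 * M')
    (h : g * g' = n) : M * M' = n ^ 2 := by
  obtain ⟨h1, h2⟩ := qf_indep_int K P hP s hs (A * A' - P * B * B') (A * B' + B * A') (4 * n) 0 (by
    push_cast
    linear_combination 4 * h - (2 * g') * hg - (A + B * s) * hg' - B * B' * hs)
  have h3 : 16 * (M * M') = 16 * n ^ 2 := by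
    linear_combination (-4 * M') * hM - (A ^ 2 + P * B ^ 2) * hM'
      + (A * A' - P * B * B' + 4 * n) * h1 + P * (A * B' + B * A') * h2
  linarith

lemma qc_core {K : Type} [Field K] [CharZero K] {P : ℕ} (hPsf : Squarefree P) {s : K} (hs : s ^ 2 = -(P : K))
    (f : ℤ√(-(P : ℤ)) →+* K) (hf : ∀ z, f z = z.re + z.im * s) (g : K) (A B M : ℤ)
    (hg : 2 * g = A + B * s) (hM : A ^ 2 + P * B ^ 2 = 4 * M) (hM2 : M % 2 = 1) :
    (∃ c, f c = g) ∨ (P % 8 = 3 ∧ A % 2 = 1 ∧ B % 2 = 1 ∧ ∃ c, f c = g ^ 3 ∧ c.norm % 2 = 1) := by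
  have hsq : ∀ a : ℤ, a % 2 = 1 → a ^ 2 % 8 = 1 := by
    intro a ha
    rcases (by omega : a % 8 = 1 ∨ a % 8 = 3 ∨ a % 8 = 5 ∨ a % 8 = 7) with h | h | h | h <;>
      simp [pow_two, Int.mul_emod, h]
  rcases Int.emod_two_eq_zero_or_one A with hA | hA
  · rcases Int.emod_two_eq_zero_or_one B with hB | hB
    · left
      obtain ⟨a, rfl⟩ : ∃ a, A = 2 * a := ⟨A / 2, by omega⟩
      obtain ⟨b, rfl⟩ : ∃ b, B = 2 * b := ⟨B / 2, by omega⟩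
      refine ⟨⟨a, b⟩, ?_⟩
      rw [hf]
      have h2 : (2 : K) ≠ 0 := two_ne_zero
      apply mul_left_cancel₀ h2
      rw [hg]; push_cast; ring
    · exfalso
      obtain ⟨a, rfl⟩ : ∃ a, A = 2 * a := ⟨A / 2, by omega⟩
      obtain ⟨B2, hB2⟩ : ∃ B2, B ^ 2 = 8 * B2 + 1 := ⟨B ^ 2 / 8, by have := hsq B hB; omega⟩
      have h4 : (4 : ℤ) ∣ P := ⟨M - a ^ 2 - P * 2 * B2, by linear_combination hM - P * hB2⟩
      have h5 : 2 * 2 ∣ P := by exact_mod_cast h4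
      have := hPsf 2 h5
      simp at this
  · rcases Int.emod_two_eq_zero_or_one B with hB | hB
    · exfalso
      obtain ⟨b, rfl⟩ : ∃ b, B = 2 * b := ⟨B / 2, by omega⟩
      have := hsq A hA
      have h4 : A ^ 2 + 4 * (P * b ^ 2) = 4 * M := by linear_combination hM
      omega
    · right
      have h1 := hsq A hA
      have h2 := hsq B hB
      have hP8 : P % 8 = 3 := by
        have h3 : ((P : ℤ) * B ^ 2) % 8 = (P : ℤ) % 8 := by
          rw [Int.mul_emod, h2]; simp
        omega
      refine ⟨hP8, hA, hB, ?_⟩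
      obtain ⟨B2, hB2⟩ : ∃ B2, B ^ 2 = 8 * B2 + 1 := ⟨B ^ 2 / 8, by omega⟩
      obtain ⟨p, hp⟩ : ∃ p : ℤ, (P : ℤ) = 8 * p + 3 := ⟨(P : ℤ) / 8, by omega⟩
      obtain ⟨m, hm⟩ : ∃ m, M = 2 * m + 1 := ⟨M / 2, by omega⟩
      have hPB : (P : ℤ) * B ^ 2 = 2 * (4 * (p * B ^ 2 + 3 * B2) + 1) + 1 := by rw [hp, hB2]; ring
      -- A^2 - 3 P B^2 = 4 M - 4 P B^2
      obtain ⟨u, hu⟩ : ∃ u, A ^ 2 - 3 * P * B ^ 2 = 8 * u :=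
        ⟨m - (4 * (p * B ^ 2 + 3 * B2) + 1), by linear_combination hM + 4 * hm - 4 * hPB⟩
      obtain ⟨v, hv⟩ : ∃ v, 3 * A ^ 2 - P * B ^ 2 = 8 * v :=
        ⟨3 * m + 1 - (4 * (p * B ^ 2 + 3 * B2) + 1), by linear_combination 3 * hM + 12 * hm - 4 * hPB⟩
      refine ⟨⟨A * u, B * v⟩, ?_, ?_⟩
      · rw [hf]
        have h8 : (8 : K) ≠ 0 := by norm_num
        apply mul_left_cancel₀ h8
        have hu' : (A : K) ^ 2 - 3 * P * B ^ 2 = 8 * u := by exact_mod_cast congrArg (Int.cast : ℤ → K) hu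
        have hv' : 3 * (A : K) ^ 2 - P * B ^ 2 = 8 * v := by exact_mod_cast congrArg (Int.cast : ℤ → K) hv
        have : 8 * g ^ 3 = (A + B * s) ^ 3 := by rw [← hg]; ring
        rw [this]
        push_cast
        linear_combination -A * hu' - B * s * hv' - (3 * A * B ^ 2 + B ^ 3 * s) * hs
      · have hn : 64 * Zsqrtd.norm (⟨A * u, B * v⟩ : ℤ√(-(P : ℤ))) = 64 * M ^ 3 := by
          rw [Zsqrtd.norm_def]
          simp only
          have e1 : 64 * (A * u * (A * u) - -(P : ℤ) * (B * v) * (B * v)) =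
            A ^ 2 * (8 * u) ^ 2 + P * B ^ 2 * (8 * v) ^ 2 := by ring
          rw [e1, ← hu, ← hv, show 64 * M ^ 3 = (4 * M) ^ 3 by ring, ← hM]
          ring
        have hn' : Zsqrtd.norm (⟨A * u, B * v⟩ : ℤ√(-(P : ℤ))) = M ^ 3 := by linarith
        rw [hn']
        rw [← Int.odd_iff] at hM2 ⊢
        exact hM2.pow

lemma qc_three {K : Type} [Field K] [CharZero K] {P : ℕ} (hP : 0 < P) {s : K}
    (hs : s ^ 2 = -(P : K))
    (f : ℤ√(-(P : ℤ)) →+* K) (hf : ∀ z, f z = z.re + z.im * s) (g : K) (A B M : ℤ)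
    (hg : 2 * g = A + B * s) (hM : A ^ 2 + P * B ^ 2 = 4 * M)
    (hA : A % 2 = 1) (hB : B % 2 = 1) (c : ℤ√(-(P : ℤ))) (hc : f c = g ^ 3) (hc2 : c.norm % 2 = 1)
    (T : ℕ) (w : ℤ√(-(P : ℤ))) (hw : f w = g ^ T) : 3 ∣ T := by
  by_contra h3
  have hnorm : (c ^ (T / 3)).norm % 2 = 1 := by
    have : (c ^ (T / 3)).norm = c.norm ^ (T / 3) := map_pow (Zsqrtd.normMonoidHom) c _
    rw [this]
    rw [← Int.odd_iff] at hc2 ⊢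
    exact hc2.pow
  rcases (by omega : T = 3 * (T / 3) + 1 ∨ T = 3 * (T / 3) + 2) with h | h
  · rw [h, pow_add, pow_mul, ← hc, ← map_pow, pow_one] at hw
    have := qc_clear hP hs f hf _ _ hnorm g A B hg hw.symm
    omega
  · rw [h, pow_add, pow_mul, ← hc, ← map_pow] at hw
    have := qc_clear hP hs f hf _ _ hnorm (g ^ 2) (A ^ 2 - 2 * M) (A * B) (by
      have hM' : (A : K) ^ 2 + P * B ^ 2 = 4 * M := by exact_mod_cast congrArg (Int.cast : ℤ → K) hM
      push_cast
      linear_combination (g + (A + B * s) / 2) * hg + (B ^ 2 / 2) * hs - hM' / 2) hw.symm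
    have h5 := this.2
    rw [Int.mul_emod, hA, hB] at h5
    omega

lemma qc_unit (P : ℕ) (hP : Squarefree P) (A B : ℤ) (h : A ^ 2 + P * B ^ 2 = 4) :
    (B = 0 ∧ (A = 2 ∨ A = -2)) ∨ (P = 1 ∧ A = 0 ∧ (B = 2 ∨ B = -2)) ∨ (P = 3 ∧ A % 2 = 1 ∧ B % 2 = 1) := by
  have hP0 : (0 : ℤ) < P := by exact_mod_cast Nat.pos_of_ne_zero hP.ne_zero
  have hA1 : A ≤ 2 := by nlinarith [mul_nonneg hP0.le (sq_nonneg B)]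
  have hA2 : -2 ≤ A := by nlinarith [mul_nonneg hP0.le (sq_nonneg B)]
  have hB1 : B ≤ 2 := by nlinarith [sq_nonneg A]
  have hB2 : -2 ≤ B := by nlinarith [sq_nonneg A]
  have hP4 : P ≠ 4 := by
    rintro rfl
    have := hP 2 (by norm_num)
    simp at this
  interval_cases A <;> interval_cases B <;> omega

open NumberField in
lemma qa_one (K : Type) [Field K] [NumberField K] (hK2 : Module.finrank ℚ K = 2) (P : ℕ)
    (hP : Squarefree P) (s : K) (hs : s ^ 2 = -(P : K)) (h n T : ℕ) (hn : 0 < n) (hT0 : 0 < T)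
    (hhprinc : ∀ I : Ideal (𝓞 K), (I ^ h).IsPrincipal) (hT : T * Nat.gcd h n ∣ n)
    (x y k : ℤ) (hy : y % 2 = 1) (hcop : IsCoprime x y) (heq : x ^ 2 + P * k ^ 2 = y ^ n) :
    ∃ (g e : K) (A B M A1 B1 : ℤ), 2 * g = A + B * s ∧ A ^ 2 + P * B ^ 2 = 4 * M ∧ M % 2 = 1 ∧
      2 * e = A1 + B1 * s ∧ A1 ^ 2 + P * B1 ^ 2 = 4 ∧ (x : K) + k * s = e * g ^ T := by
  have hP0 : 0 < P := Nat.pos_of_ne_zero hP.ne_zero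
  have hIntgr : IsIntegral ℤ s := by
    refine ⟨Polynomial.X ^ 2 + Polynomial.C (P : ℤ), Polynomial.monic_X_pow_add_C _ two_ne_zero, ?_⟩
    simp [hs]
  obtain ⟨s0, hs0⟩ : ∃ s0 : 𝓞 K, (s0 : K) = s := ⟨⟨s, hIntgr⟩, rfl⟩
  have hs2 : s0 ^ 2 = -(P : 𝓞 K) := by
    apply RingOfIntegers.ext
    change (algebraMap (𝓞 K) K) (s0 ^ 2) = (algebraMap (𝓞 K) K) (-(P : 𝓞 K))
    rw [map_pow, map_neg, map_natCast, ← hs, ← hs0]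
  have heq' : (x : 𝓞 K) ^ 2 + P * k ^ 2 = y ^ n := by exact_mod_cast congrArg (Int.cast : ℤ → 𝓞 K) heq
  have hbb : ((x : 𝓞 K) + k * s0) * (x - k * s0) = y ^ n := by
    linear_combination heq' - (k : 𝓞 K) ^ 2 * hs2
  have hy0 : y ≠ 0 := by rintro rfl; simp at hy
  have hc2 : IsCoprime (2 * x) (y ^ n) := by
    apply IsCoprime.pow_right
    refine IsCoprime.mul_left ?_ hcop
    exact ⟨-(y / 2), 1, by omega⟩
  obtain ⟨u, v, huv⟩ := hc2
  have huv' : (u : 𝓞 K) * (2 * x) + v * y ^ n = 1 := by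
    exact_mod_cast congrArg (Int.cast : ℤ → 𝓞 K) huv
  have hcop' : IsCoprime ((x : 𝓞 K) + k * s0) (x - k * s0) :=
    ⟨u, u + v * (x + k * s0), by linear_combination huv' + (v : 𝓞 K) * hbb⟩
  obtain ⟨c, e, he, hce⟩ := qf_ideal K h n T hn hhprinc hT _ _ y hy0 hbb hcop'
  obtain ⟨e', he'⟩ := he.exists_right_inv
  obtain ⟨A, B, M, h1, h2⟩ := qf_half K hK2 P hP s hs c
  obtain ⟨A', B', M', h1', h2'⟩ := qf_half K hK2 P hP s hs (e * c ^ (T - 1) * (x - k * s0))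
  obtain ⟨A1, B1, M1, h3, h4⟩ := qf_half K hK2 P hP s hs e
  obtain ⟨A2, B2, M2, h5, h6⟩ := qf_half K hK2 P hP s hs e'
  have hM : M * M' = (y ^ n) ^ 2 := by
    refine qc_prod hP0 hs _ _ A B M A' B' M' (y ^ n) h1 h2 h1' h2' ?_
    have : c * (e * c ^ (T - 1) * (x - k * s0)) = (y : 𝓞 K) ^ n := by
      rw [← hbb, hce]
      obtain ⟨t, rfl⟩ : ∃ t, T = t + 1 := ⟨T - 1, by omega⟩
      simp only [Nat.add_sub_cancel]
      ring
    have h8 := congrArg (algebraMap (𝓞 K) K) this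
    rw [map_mul, map_pow, map_intCast] at h8
    push_cast
    exact h8
  have hM1 : M1 * M2 = 1 ^ 2 := by
    refine qc_prod hP0 hs _ _ A1 B1 M1 A2 B2 M2 1 h3 h4 h5 h6 ?_
    have h8 := congrArg (algebraMap (𝓞 K) K) he'
    rw [map_mul, map_one] at h8
    push_cast
    exact h8
  have hM1' : M1 = 1 := by
    have : 0 ≤ M1 := by nlinarith [sq_nonneg A1, mul_nonneg (Int.natCast_nonneg P) (sq_nonneg B1)]
    rcases Int.eq_one_or_neg_one_of_mul_eq_one (by simpa using hM1) with h | h <;> omega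
  refine ⟨c, e, A, B, M, A1, B1, h1, h2, ?_, h3, by rw [h4, hM1']; rfl, ?_⟩
  · have ho : Odd (M * M') := by
      rw [hM]
      exact ((Int.odd_iff.2 hy).pow).pow
    exact Int.odd_iff.1 (Int.odd_mul.1 ho).1
  · have h8 := congrArg (algebraMap (𝓞 K) K) hce
    rw [map_add, map_mul, map_intCast, map_intCast, map_mul, map_pow] at h8
    rw [← hs0]
    exact h8

lemma qa_gauss (x k : ℤ) (c e : ℤ√(-((1 : ℕ) : ℤ))) (hc : c.norm % 2 = 1)
    (T : ℕ) (he : e = 1 ∨ e = -1 ∨ e = ⟨0, 1⟩ ∨ e = -⟨0, 1⟩) (h : ⟨x, k⟩ = e * c ^ T) (hx : x % 2 = 1) :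
    ∃ c : ℤ√(-((1 : ℕ) : ℤ)), c ^ T = ⟨x, k⟩ ∨ c ^ T = -⟨x, k⟩ := by
  have hI : (⟨0, 1⟩ : ℤ√(-((1 : ℕ) : ℤ))) * ⟨0, 1⟩ = -1 := by
    ext <;> simp
  have key : ∀ c e : ℤ√(-((1 : ℕ) : ℤ)), c.im % 2 = 0 →
    (e = 1 ∨ e = -1 ∨ e = ⟨0, 1⟩ ∨ e = -⟨0, 1⟩) → ⟨x, k⟩ = e * c ^ T →
    ∃ c : ℤ√(-((1 : ℕ) : ℤ)), c ^ T = ⟨x, k⟩ ∨ c ^ T = -⟨x, k⟩ := by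
    intro c e hc he h
    have him : ∀ t : ℕ, (c ^ t).im % 2 = 0 := by
      intro t
      induction t with
      | zero => simp
      | succ t ih =>
        rw [pow_succ, Zsqrtd.im_mul, Int.add_emod, Int.mul_emod, hc, Int.mul_emod _ c.re, ih]
        simp
    have h1 := him T
    rcases he with rfl | rfl | rfl | rfl
    · exact ⟨c, Or.inl (by rw [h, one_mul])⟩
    · exact ⟨c, Or.inr (by rw [h]; ring)⟩
    · have := congrArg Zsqrtd.re h
      simp at this
      omega
    · have := congrArg Zsqrtd.re h
      simp at this
      omega
  rcases Int.emod_two_eq_zero_or_one c.im with hci | hci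
  · exact key c e hci he h
  · have hcl : ∀ t : ℕ, ((-⟨0, 1⟩ : ℤ√(-((1 : ℕ) : ℤ))) ^ t = 1 ∨ (-⟨0, 1⟩ : ℤ√(-((1 : ℕ) : ℤ))) ^ t = -1 ∨
        (-⟨0, 1⟩ : ℤ√(-((1 : ℕ) : ℤ))) ^ t = ⟨0, 1⟩ ∨ (-⟨0, 1⟩ : ℤ√(-((1 : ℕ) : ℤ))) ^ t = -⟨0, 1⟩) := by
      intro t
      induction t with
      | zero => simp
      | succ t ih =>
        rw [pow_succ]
        rcases ih with ih | ih | ih | ih <;> rw [ih] <;> simp [hI]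
    refine key (⟨0, 1⟩ * c) (e * (-⟨0, 1⟩) ^ T) ?_ ?_ ?_
    · rw [Zsqrtd.norm_def] at hc
      simp
      rcases Int.emod_two_eq_zero_or_one c.re with h | h
      · omega
      · exfalso
        have : (c.re * c.re - -((1 : ℕ) : ℤ) * c.im * c.im) % 2 = 0 := by
          obtain ⟨a, ha⟩ : ∃ a, c.re = 2 * a + 1 := ⟨c.re / 2, by omega⟩
          obtain ⟨b, hb⟩ : ∃ a, c.im = 2 * a + 1 := ⟨c.im / 2, by omega⟩
          rw [ha, hb]
          push_cast
          ring_nf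
          omega
        omega
    · rcases he with rfl | rfl | rfl | rfl <;>
      rcases hcl T with ih | ih | ih | ih <;> rw [ih] <;> simp [hI]
    · rw [mul_assoc, ← mul_pow, h]
      congr 2
      linear_combination c * hI

lemma qa_unit3 {K : Type} [Field K] [CharZero K] {s : K} (hs : s ^ 2 = -3) (e e' : K)
    (A B A' B' : ℤ) (h1 : 2 * e = A + B * s) (h2 : A ^ 2 + 3 * B ^ 2 = 4)
    (h1' : 2 * e' = A' + B' * s) (h2' : A' ^ 2 + 3 * B' ^ 2 = 4) :
    ∃ A B : ℤ, 2 * (e * e') = A + B * s ∧ A ^ 2 + 3 * B ^ 2 = 4 := by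
  have hp : ∀ A B : ℤ, A ^ 2 + 3 * B ^ 2 = 4 → ∃ j, A = B + 2 * j := by
    intro A B h
    refine ⟨(A - B) / 2, ?_⟩
    have : Even (A ^ 2 + 3 * B ^ 2) := by rw [h]; decide
    have h4 : Even (A - B) := by
      simp [Int.even_add, Int.even_sub, Int.even_pow, Int.even_mul] at this ⊢
      have h3 : ¬ Even (3 : ℤ) := by decide
      tauto
    obtain ⟨r, hr⟩ := h4
    omega
  obtain ⟨j, rfl⟩ := hp _ _ h2
  obtain ⟨j', rfl⟩ := hp _ _ h2'
  refine ⟨-B * B' + B * j' + B' * j + 2 * j * j', B * B' + B * j' + B' * j, ?_, ?_⟩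
  · have h0 : (2 : K) ≠ 0 := two_ne_zero
    apply mul_left_cancel₀ h0
    push_cast at h1 h1' ⊢
    linear_combination (2 * e') * h1 + (B + 2 * j + B * s) * h1' + B * B' * hs
  · have : 4 * ((-B * B' + B * j' + B' * j + 2 * j * j') ^ 2 + 3 * (B * B' + B * j' + B' * j) ^ 2) = 4 * 4 := by
      linear_combination ((B' + 2 * j') ^ 2 + 3 * B' ^ 2) * h2 + 4 * h2'
    linarith

lemma qa_unit3_pow {K : Type} [Field K] [CharZero K] {s : K} (hs : s ^ 2 = -3) (e e' : K)
    (A B A' B' : ℤ) (h1 : 2 * e = A + B * s) (h2 : A ^ 2 + 3 * B ^ 2 = 4)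
    (h1' : 2 * e' = A' + B' * s) (h2' : A' ^ 2 + 3 * B' ^ 2 = 4) (t : ℕ) :
    ∃ A B : ℤ, 2 * (e * e' ^ t) = A + B * s ∧ A ^ 2 + 3 * B ^ 2 = 4 := by
  induction t with
  | zero => exact ⟨A, B, by simpa using h1, h2⟩
  | succ t ih =>
    obtain ⟨A2, B2, h3, h4⟩ := ih
    obtain ⟨A3, B3, h5, h6⟩ := qa_unit3 hs _ _ _ _ _ _ h3 h4 h1' h2'
    exact ⟨A3, B3, by rw [← h5]; ring, h6⟩

lemma qa_three {K : Type} [Field K] [CharZero K] {s : K} (hs : s ^ 2 = -((3 : ℕ) : K))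
    (f : ℤ√(-((3 : ℕ) : ℤ)) →+* K) (hf : ∀ z, f z = z.re + z.im * s) (T : ℕ)
    (g e : K) (A B M A1 B1 : ℤ) (h1 : 2 * g = A + B * s) (h2 : A ^ 2 + ((3 : ℕ) : ℤ) * B ^ 2 = 4 * M)
    (hM : M % 2 = 1) (h3 : 2 * e = A1 + B1 * s) (h4 : A1 ^ 2 + ((3 : ℕ) : ℤ) * B1 ^ 2 = 4)
    (w : ℤ√(-((3 : ℕ) : ℤ))) (hw : f w = e * g ^ T) : ∃ c : ℤ√(-((3 : ℕ) : ℤ)), c ^ T = w ∨ c ^ T = -w := by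
  have h0 : (2 : K) ≠ 0 := two_ne_zero
  have hs3 : s ^ 2 = -3 := by rw [hs]; norm_num
  have h2' : A ^ 2 + 3 * B ^ 2 = 4 * M := h2
  have key : ∀ (c : ℤ√(-((3 : ℕ) : ℤ))) (e : K) (A1 B1 : ℤ), c.norm % 2 = 1 → 2 * e = A1 + B1 * s →
      A1 ^ 2 + 3 * B1 ^ 2 = 4 → f w = e * (f c) ^ T → ∃ c : ℤ√(-((3 : ℕ) : ℤ)), c ^ T = w ∨ c ^ T = -w := by
    intro c e A1 B1 hc h3 h4 hw
    have hnorm : (c ^ T).norm % 2 = 1 := by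
      have : (c ^ T).norm = c.norm ^ T := map_pow (Zsqrtd.normMonoidHom) c _
      rw [this]
      rw [← Int.odd_iff] at hc ⊢
      exact hc.pow
    have h5 := qc_clear (by norm_num) hs f hf (c ^ T) w hnorm e A1 B1 h3 (by rw [hw, map_pow]; ring)
    rcases qc_unit 3 (by norm_num [Nat.squarefree_iff_prime_squarefree, Nat.prime_three.squarefree]) A1 B1 h4 with h | h | h
    · obtain ⟨rfl, h⟩ := h
      refine ⟨c, ?_⟩
      rcases h with rfl | rfl
      · left
        apply qc_inj (by norm_num) hs f hf
        have : e = 1 := by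
          apply mul_left_cancel₀ h0
          rw [h3]; push_cast; ring
        rw [hw, this, map_pow, one_mul]
      · right
        apply qc_inj (by norm_num) hs f hf
        have : e = -1 := by
          apply mul_left_cancel₀ h0
          rw [h3]; push_cast; ring
        rw [map_neg, hw, this, map_pow]; ring
    · omega
    · omega
  rcases qc_core Nat.prime_three.prime.squarefree hs f hf g A B M h1 h2 hM with ⟨c, hc⟩ | ⟨-, hA, hB, -⟩
  · refine key c e A1 B1 ?_ h3 h4 (by rw [hw, hc])
    rw [← hc, hf] at h1
    obtain ⟨e1, e2⟩ := qf_indep_int K 3 (by norm_num) s hs (2 * c.re) (2 * c.im) A B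
      (by push_cast; linear_combination h1)
    have : c.norm = M := by
      rw [Zsqrtd.norm_def]
      rw [← e1, ← e2] at h2'
      push_cast
      linarith
    omega
  · rcases (by omega : (A + B) % 4 = 0 ∨ (A - B) % 4 = 0) with h | h
    · obtain ⟨a, ha⟩ : ∃ a, A = 4 * a - B := ⟨(A + B) / 4, by omega⟩
      obtain ⟨A3, B3, h5, h6⟩ := qa_unit3_pow hs3 e ((1 - s) / 2) A1 B1 1 (-1) h3 h4 (by push_cast; ring)
        (by norm_num) T
      refine key ⟨a - B, a⟩ (e * ((1 - s) / 2) ^ T) A3 B3 ?_ h5 h6 ?_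
      · rw [Zsqrtd.norm_def]
        have : 4 * ((a - B) * (a - B) - -((3 : ℕ) : ℤ) * a * a) = 4 * M := by
          rw [← h2', ha]; push_cast; ring
        simp only
        omega
      · rw [hw, mul_assoc, ← mul_pow]
        congr 2
        apply mul_left_cancel₀ h0
        rw [h1, hf, ha]
        push_cast
        linear_combination a * hs3
    · obtain ⟨a, ha⟩ : ∃ a, A = 4 * a + B := ⟨(A - B) / 4, by omega⟩
      obtain ⟨A3, B3, h5, h6⟩ := qa_unit3_pow hs3 e ((1 + s) / 2) A1 B1 1 1 h3 h4 (by push_cast; ring)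
        (by norm_num) T
      refine key ⟨a + B, -a⟩ (e * ((1 + s) / 2) ^ T) A3 B3 ?_ h5 h6 ?_
      · rw [Zsqrtd.norm_def]
        have : 4 * ((a + B) * (a + B) - -((3 : ℕ) : ℤ) * -a * -a) = 4 * M := by
          rw [← h2', ha]; push_cast; ring
        simp only
        omega
      · rw [hw, mul_assoc, ← mul_pow]
        congr 2
        apply mul_left_cancel₀ h0
        rw [h1, hf, ha]
        push_cast
        linear_combination a * hs3

open NumberField in
lemma qa_main (K : Type) [Field K] [NumberField K] (hK2 : Module.finrank ℚ K = 2) (P : ℕ)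
    (hP : Squarefree P) (s : K) (hs : s ^ 2 = -(P : K)) (h n T : ℕ) (hn : 0 < n) (hT0 : 0 < T)
    (hhprinc : ∀ I : Ideal (𝓞 K), (I ^ h).IsPrincipal) (hT : T * Nat.gcd h n ∣ n)
    (x y k : ℤ) (hy : y % 2 = 1) (hcop : IsCoprime x y) (heq : x ^ 2 + P * k ^ 2 = y ^ n)
    (hP1 : P = 1 → k % 2 = 0) :
    (∃ c : ℤ√(-(P : ℤ)), c ^ T = ⟨x, k⟩ ∨ c ^ T = -⟨x, k⟩) ∨
    (3 < P ∧ P % 8 = 3 ∧ 3 ∣ T ∧ ∃ c : ℤ√(-(P : ℤ)), c ^ (T / 3) = ⟨x, k⟩ ∨ c ^ (T / 3) = -⟨x, k⟩) := by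
  have hP0 : 0 < P := Nat.pos_of_ne_zero hP.ne_zero
  have h0 : (2 : K) ≠ 0 := two_ne_zero
  obtain ⟨g, e, A, B, M, A1, B1, h1, h2, hM, h3, h4, hw⟩ := qa_one K hK2 P hP s hs h n T hn hT0
    hhprinc hT x y k hy hcop heq
  obtain ⟨f, hf⟩ : ∃ f : ℤ√(-(P : ℤ)) →+* K, ∀ z, f z = z.re + z.im * s :=
    ⟨Zsqrtd.lift ⟨s, by push_cast; linear_combination hs⟩, fun z => rfl⟩
  have hw' : f ⟨x, k⟩ = e * g ^ T := by rw [← hw, hf]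
  by_cases hP3 : P = 3
  · subst hP3
    left
    exact qa_three hs f hf T g e A B M A1 B1 h1 h2 hM h3 h4 _ hw'
  by_cases hPo : P = 1
  · subst hPo
    left
    have hk := hP1 rfl
    rcases qc_core hP hs f hf g A B M h1 h2 hM with ⟨c, hc⟩ | ⟨h8, -⟩
    · have hx : x % 2 = 1 := by
        have ho : Odd (x ^ 2 + ((1 : ℕ) : ℤ) * k ^ 2) := by rw [heq]; exact (Int.odd_iff.2 hy).pow
        have he : Even k := Int.even_iff.2 hk
        simp [Int.odd_add, Int.odd_pow, he, Int.even_pow] at ho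
        exact Int.odd_iff.1 ho
      have hcn : c.norm % 2 = 1 := by
        rw [← hc, hf] at h1
        obtain ⟨e1, e2⟩ := qf_indep_int K 1 (by norm_num) s hs (2 * c.re) (2 * c.im) A B
          (by push_cast; linear_combination h1)
        have : c.norm = M := by
          rw [Zsqrtd.norm_def]
          rw [← e1, ← e2] at h2
          push_cast at h2 ⊢
          linarith
        omega
      have hex : ∃ e0 : ℤ√(-((1 : ℕ) : ℤ)), (e0 = 1 ∨ e0 = -1 ∨ e0 = ⟨0, 1⟩ ∨ e0 = -⟨0, 1⟩) ∧ f e0 = e := by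
        rcases qc_unit 1 hP A1 B1 h4 with ⟨rfl, rfl | rfl⟩ | ⟨-, rfl, rfl | rfl⟩ | hh
        · refine ⟨1, by simp, ?_⟩
          apply mul_left_cancel₀ h0
          rw [h3]; simp
        · refine ⟨-1, by simp, ?_⟩
          apply mul_left_cancel₀ h0
          rw [h3]; simp
        · refine ⟨⟨0, 1⟩, by simp, ?_⟩
          apply mul_left_cancel₀ h0
          rw [h3, hf]; simp
        · refine ⟨-⟨0, 1⟩, by simp, ?_⟩
          apply mul_left_cancel₀ h0
          rw [h3, hf]; simp
        · omega
      obtain ⟨e0, he0, hfe⟩ := hex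
      refine qa_gauss x k c e0 hcn T he0 ?_ hx
      apply qc_inj hP0 hs f hf
      rw [hw', map_mul, map_pow, hfe, hc]
    · omega
  have he : e = 1 ∨ e = -1 := by
    rcases qc_unit P hP A1 B1 h4 with ⟨rfl, rfl | rfl⟩ | hh | hh
    · left
      apply mul_left_cancel₀ h0
      rw [h3]; simp
    · right
      apply mul_left_cancel₀ h0
      rw [h3]; simp
    · exact absurd hh.1 hPo
    · exact absurd hh.1 hP3
  have hsg : ∀ (c : ℤ√(-(P : ℤ))) (t : ℕ), f c ^ t = g ^ T → c ^ t = ⟨x, k⟩ ∨ c ^ t = -⟨x, k⟩ := by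
    intro c t hct
    rcases he with rfl | rfl
    · left
      apply qc_inj hP0 hs f hf
      rw [hw', map_pow, hct, one_mul]
    · right
      apply qc_inj hP0 hs f hf
      rw [map_neg, hw', map_pow, hct]; ring
  rcases qc_core hP hs f hf g A B M h1 h2 hM with ⟨c, hc⟩ | ⟨h8, hA, hB, c, hc, hcn⟩
  · left
    exact ⟨c, hsg c T (by rw [hc])⟩
  · right
    have h3T : 3 ∣ T := by
      rcases he with rfl | rfl
      · exact qc_three hP0 hs f hf g A B M h1 h2 hA hB c hc hcn T ⟨x, k⟩ (by rw [hw', one_mul])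
      · exact qc_three hP0 hs f hf g A B M h1 h2 hA hB c hc hcn T (-⟨x, k⟩) (by rw [map_neg, hw']; ring)
    refine ⟨by omega, h8, h3T, c, hsg c (T / 3) ?_⟩
    rw [hc, ← pow_mul, Nat.mul_div_cancel' h3T]

lemma zl_lift (d e a b : ℤ) (he : e = d * b ^ 2) (r : ℕ) :
    ((⟨a, b⟩ : ℤ√d) ^ r).re = ((⟨a, 1⟩ : ℤ√e) ^ r).re ∧
    ((⟨a, b⟩ : ℤ√d) ^ r).im = b * ((⟨a, 1⟩ : ℤ√e) ^ r).im := by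
  induction r with
  | zero => simp
  | succ r ih =>
    rw [pow_succ, pow_succ, Zsqrtd.re_mul, Zsqrtd.re_mul, Zsqrtd.im_mul, Zsqrtd.im_mul, ih.1, ih.2]
    simp only
    constructor
    · rw [he]; ring
    · ring

lemma zl_sign {d : ℤ} (c w : ℤ√d) (T : ℕ) (hT : T % 2 = 1) (h : c ^ T = w ∨ c ^ T = -w) :
    ∃ c : ℤ√d, c ^ T = w := by
  rcases h with h | h
  · exact ⟨c, h⟩
  · exact ⟨-c, by rw [Odd.neg_pow (Nat.odd_iff.2 hT), h, neg_neg]⟩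

lemma zl_pow_inj (a b : ℤ) (r : ℕ) (hr : r % 2 = 1) (h : a ^ r = b ^ r) : a = b :=
  (Odd.strictMono_pow (R := ℤ) (Nat.odd_iff.2 hr)).injective h

lemma gc_gauss (x k y : ℤ) (r : ℕ) (hy : y % 2 = 1) (hk : k % 2 = 0) (hcop : IsCoprime x y)
    (hr0 : r ≠ 0) (h : x ^ 2 + k ^ 2 = y ^ r) :
    ∃ c : ℤ√(-((1 : ℕ) : ℤ)), c ^ r = ⟨x, k⟩ ∨ c ^ r = -⟨x, k⟩ := by
  have hx : x % 2 = 1 := by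
    have ho : Odd (x ^ 2 + k ^ 2) := by rw [h]; exact (Int.odd_iff.2 hy).pow
    have he : Even k := Int.even_iff.2 hk
    simp [Int.odd_add, Int.odd_pow, he, Int.even_pow] at ho
    exact Int.odd_iff.1 ho
  have hbb : (⟨x, k⟩ : GaussianInt) * ⟨x, -k⟩ = (y : GaussianInt) ^ r := by
    have : ((y ^ r : ℤ) : GaussianInt) = (y : GaussianInt) ^ r := by push_cast; rfl
    rw [← this, ← h]
    apply Zsqrtd.ext
    · rw [Zsqrtd.re_mul, Zsqrtd.re_intCast]; ring
    · rw [Zsqrtd.im_mul, Zsqrtd.im_intCast]; ring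
  have hc2 : IsCoprime (2 * x) (y ^ r) := by
    apply IsCoprime.pow_right
    refine IsCoprime.mul_left ?_ hcop
    exact ⟨-(y / 2), 1, by omega⟩
  obtain ⟨u, v, huv⟩ := hc2
  have huv' : (u : GaussianInt) * (2 * x) + v * y ^ r = 1 := by
    exact_mod_cast congrArg (Int.cast : ℤ → GaussianInt) huv
  have hsum : (⟨x, k⟩ : GaussianInt) + ⟨x, -k⟩ = 2 * (x : GaussianInt) := by
    ext
    · simp; ring
    · simp
  have hcop' : IsCoprime (⟨x, k⟩ : GaussianInt) ⟨x, -k⟩ :=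
    ⟨u, u + v * ⟨x, k⟩, by linear_combination huv' + (v : GaussianInt) * hbb + (u : GaussianInt) * hsum⟩
  obtain ⟨d, e, hde⟩ := exists_associated_pow_of_mul_eq_pow' hcop' hbb
  have he := Zsqrtd.norm_eq_one_iff.2 e.isUnit
  have hdn : d.norm % 2 = 1 := by
    have h1 := congrArg Zsqrtd.norm hde
    rw [Zsqrtd.norm_mul, Zsqrtd.norm_def ⟨x, k⟩] at h1
    have h2 : (d ^ r).norm = d.norm ^ r := map_pow (Zsqrtd.normMonoidHom) d _
    have ho : Odd (x ^ 2 + k ^ 2) := by rw [h]; exact (Int.odd_iff.2 hy).pow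
    have ho2 : Odd ((d ^ r).norm * (e : GaussianInt).norm) := by
      rw [h1]
      simp only
      convert ho using 1
      ring
    rw [h2] at ho2
    have := (Int.odd_mul.1 ho2).1
    rw [Int.odd_pow] at this
    exact Int.odd_iff.1 (this.resolve_right hr0)
  refine qa_gauss x k d e hdn r ?_ ?_ hx
  · generalize (e : GaussianInt) = z at he
    obtain ⟨p, q⟩ := z
    rw [Zsqrtd.norm_def] at he
    simp only at he
    have he' : p * p + q * q = 1 := by
      have : p * p - -1 * q * q = 1 := by
        have : 0 ≤ p * p - -1 * q * q := by nlinarith [mul_self_nonneg p, mul_self_nonneg q]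
        omega
      linarith
    have hp1 : p ≤ 1 := by nlinarith [mul_self_nonneg q]
    have hp2 : -1 ≤ p := by nlinarith [mul_self_nonneg q]
    have hq1 : q ≤ 1 := by nlinarith [mul_self_nonneg p]
    have hq2 : -1 ≤ q := by nlinarith [mul_self_nonneg p]
    interval_cases p <;> interval_cases q <;> simp [Zsqrtd.ext_iff] at he' ⊢
  · rw [mul_comm]; exact hde.symm

lemma gc_even (r i : ℕ) (hr : r.Prime) (hr2 : r % 2 = 1) (hi : 1 ≤ i) (Y : ℤ)
    (hY : ∀ p q : ℕ, p.Prime → q.Prime → (p : ℤ) ∣ Y → (q : ℤ) ∣ Y → p = q)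
    (h : (3 : ℤ) ^ (2 * i) + 4 = Y ^ r) : False := by
  have hr0 := hr.ne_zero
  have ho3 : Odd ((3 : ℤ) ^ i) := Odd.pow (by decide)
  have hYo : Y % 2 = 1 := by
    have : Odd (Y ^ r) := by
      rw [← h]
      exact Odd.add_even (Odd.pow (by decide)) (by decide)
    rw [Int.odd_pow] at this
    exact Int.odd_iff.1 (this.resolve_right hr0)
  have hcop : IsCoprime ((3 : ℤ) ^ i) Y := by
    apply IsCoprime.pow_left
    rw [Int.prime_three.coprime_iff_not_dvd]
    intro h3
    have h4 : (3 : ℤ) ∣ Y ^ r := dvd_pow h3 hr0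
    rw [← h] at h4
    have h5 : (3 : ℤ) ∣ 3 ^ (2 * i) := dvd_pow_self _ (by omega)
    have := (Int.dvd_add_right h5).1 h4
    omega
  obtain ⟨c, hc⟩ := gc_gauss (3 ^ i) 2 Y r hYo (by norm_num) hcop hr0 (by rw [← h]; ring)
  obtain ⟨c, hc⟩ := zl_sign c _ r hr2 hc
  obtain ⟨a, b⟩ := c
  have hn := zs_norm (-((1 : ℕ) : ℤ)) a b r
  rw [hc] at hn
  simp only at hn
  have hYn : a ^ 2 + b ^ 2 = Y := by
    apply zl_pow_inj _ _ r hr2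
    rw [← h]
    push_cast at hn
    have e1 : a ^ 2 - -1 * b ^ 2 = a ^ 2 + b ^ 2 := by ring
    rw [e1] at hn
    rw [← hn]; ring
  have hl := zl_lift (-((1 : ℕ) : ℤ)) (-((b.natAbs ^ 2 : ℕ) : ℤ)) a b (by simp) r
  rw [hc] at hl
  simp only at hl
  obtain ⟨m, hm⟩ : ∃ m, r = 2 * m + 1 := ⟨r / 2, by omega⟩
  obtain ⟨W, hW, -, -⟩ := zs_mod_a (-((b.natAbs ^ 2 : ℕ) : ℤ)) a m
  rw [← hm, ← hl.1] at hW
  have hao : a % 2 = 1 := by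
    rw [hW] at ho3
    exact Int.odd_iff.1 (Int.odd_mul.1 ho3).1
  have hbe : b % 2 = 0 := by
    have : Odd (a ^ 2 + b ^ 2) := by rw [hYn]; exact Int.odd_iff.2 hYo
    have hoa : Odd a := Int.odd_iff.2 hao
    simp [Int.odd_add, Int.odd_pow, hoa, Int.even_pow] at this
    exact Int.even_iff.1 this
  obtain ⟨b', rfl⟩ : ∃ b', b = 2 * b' := ⟨b / 2, by omega⟩
  have hb1 : b' * ((⟨a, 1⟩ : ℤ√(-(((2 * b').natAbs ^ 2 : ℕ) : ℤ))) ^ r).im = 1 := by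
    have := hl.2
    rw [mul_assoc] at this
    omega
  have hD : (2 * b').natAbs ^ 2 = 4 := by
    rcases Int.eq_one_or_neg_one_of_mul_eq_one hb1 with h | h <;> rw [h] <;> rfl
  have hb2 : (2 * b') ^ 2 = 4 := by
    have := congrArg (Nat.cast : ℕ → ℤ) hD
    rw [Nat.cast_pow, Int.natCast_natAbs, sq_abs] at this
    exact this
  rw [hD] at hb1 hl
  have hU1 : IsUnit ((⟨a, 1⟩ : ℤ√(-((4 : ℕ) : ℤ))) ^ r).im := IsUnit.of_mul_eq_one_right _ hb1
  obtain ⟨ha1, hcase⟩ := sit_S r hr hr2 4 (by norm_num) (by norm_num) a hao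
    (by
      have : IsCoprime a (2 ^ 2) := IsCoprime.pow_right ⟨1, -(a / 2), by omega⟩
      norm_num at this ⊢
      exact this)
    (by
      rw [← hl.1]
      intro p q hp hq h1 h2
      have e1 := (Nat.prime_dvd_prime_iff_eq hp Nat.prime_three).1
        (by exact_mod_cast Int.Prime.dvd_pow' hp h1)
      have e2 := (Nat.prime_dvd_prime_iff_eq hq Nat.prime_three).1
        (by exact_mod_cast Int.Prime.dvd_pow' hq h2)
      rw [e1, e2])
    (by
      intro p q hp hq h1 h2
      have e : a ^ 2 + ((4 : ℕ) : ℤ) = Y := by rw [← hYn, hb2]; rfl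
      rw [e] at h1 h2
      exact hY p q hp hq h1 h2)
    (by
      intro q hq hd
      exfalso
      have := isUnit_of_dvd_unit hd hU1
      rw [Int.ofNat_isUnit, Nat.isUnit_iff] at this
      exact hq.one_lt.ne' this)
  have hr3 : r = 3 := by
    rcases hcase with h | h | h | ⟨h, j, hj, h'⟩ <;> omega
  have h3 := hl.1
  rw [hr3] at h3
  have h4 : (3 : ℤ) ∣ 11 := by
    have h5 : (3 : ℤ) ∣ 3 ^ i := dvd_pow_self _ (by omega)
    rw [h3] at h5
    simp [pow_succ] at h5
    rcases (by simpa using ha1 : a = 1 ∨ a = -1) with h | h <;> subst h <;> omega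
  omega

lemma gc_two_adic (b : ℤ) (hb : b % 2 = 1) (r : ℕ) (hr : 1 < r) (hr2 : r % 2 = 1)
    (h : ((⟨2, b⟩ : ℤ√(-((3 : ℕ) : ℤ))) ^ r).re = 2) : False := by
  set δ : ℤ√(-((3 : ℕ) : ℤ)) := ⟨0, b⟩ with hδ
  have hc : (⟨2, b⟩ : ℤ√(-((3 : ℕ) : ℤ))) = 2 + δ := by
    rw [hδ]; ext <;> simp
  have hδ2 : δ ^ 2 = ((-3 * b ^ 2 : ℤ) : ℤ√(-((3 : ℕ) : ℤ))) := by
    rw [hδ, pow_two]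
    apply Zsqrtd.ext
    · rw [Zsqrtd.re_mul, Zsqrtd.re_intCast]; push_cast; ring
    · rw [Zsqrtd.im_mul, Zsqrtd.im_intCast]; ring
  obtain ⟨b2, hb2⟩ : ∃ b2, b ^ 2 = 8 * b2 + 1 := by
    refine ⟨b ^ 2 / 8, ?_⟩
    have : b ^ 2 % 8 = 1 := by
      rcases (by omega : b % 8 = 1 ∨ b % 8 = 3 ∨ b % 8 = 5 ∨ b % 8 = 7) with h | h | h | h <;>
        simp [pow_two, Int.mul_emod, h]
    omega
  have key : ∀ e : ℕ, ∃ w, (2 + δ) ^ (2 ^ (e + 1)) = 1 + 2 ^ (e + 2) * (δ + 2 * w) := by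
    intro e
    induction e with
    | zero =>
      refine ⟨(((-3 * b2 : ℤ)) : ℤ√(-((3 : ℕ) : ℤ))), ?_⟩
      rw [hb2] at hδ2
      push_cast at hδ2 ⊢
      linear_combination hδ2
    | succ e ih =>
      obtain ⟨w, hw⟩ := ih
      refine ⟨w + 2 ^ e * (δ + 2 * w) ^ 2, ?_⟩
      rw [pow_succ 2 (e + 1), pow_mul, hw]
      ring
  obtain ⟨e, o, ho, heo⟩ := Nat.exists_eq_two_pow_mul_odd (n := r - 1) (by omega)
  have he1 : e ≠ 0 := by
    rintro rfl
    rw [Nat.odd_iff] at ho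
    omega
  obtain ⟨e, rfl⟩ := Nat.exists_eq_succ_of_ne_zero he1
  obtain ⟨w, hw⟩ := key e
  obtain ⟨v, hv⟩ := lm_one (2 ^ (e + 2) * (δ + 2 * w)) o
  obtain ⟨p, rfl⟩ := ho
  have hr1 : r = 2 ^ (e + 1) * (2 * p + 1) + 1 := by
    simp only [Nat.succ_eq_add_one] at heo
    omega
  have hfin : (2 + δ) ^ r = 2 + δ + 2 ^ (e + 2) * (δ ^ 2 + 2 * (δ + (2 + δ) * (w + p * (δ + 2 * w)
      + 2 ^ (e + 1) * ((δ + 2 * w) ^ 2 * v)))) := by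
    rw [hr1, pow_succ, pow_mul, hw, hv]
    push_cast
    ring
  generalize δ + (2 + δ) * (w + p * (δ + 2 * w) + 2 ^ (e + 1) * ((δ + 2 * w) ^ 2 * v)) = z at hfin
  rw [hc, hfin, hδ2] at h
  have e1 : (2 : ℤ√(-((3 : ℕ) : ℤ))) ^ (e + 2) = ((2 ^ (e + 2) : ℤ) : ℤ√(-((3 : ℕ) : ℤ))) := by
    push_cast; rfl
  have e2 : (2 : ℤ√(-((3 : ℕ) : ℤ))) = ((2 : ℤ) : ℤ√(-((3 : ℕ) : ℤ))) := by
    push_cast; rfl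
  rw [e1, e2, Zsqrtd.re_add, Zsqrtd.re_add, Zsqrtd.re_smul, Zsqrtd.re_add, Zsqrtd.re_smul,
    Zsqrtd.re_intCast, Zsqrtd.re_intCast, hδ] at h
  simp only [add_zero] at h
  have h3 : (2 : ℤ) ^ (e + 2) * (-3 * b ^ 2 + 2 * z.re) = 0 := by linarith
  rcases mul_eq_zero.1 h3 with h4 | h4
  · exact absurd h4 (by positivity)
  · omega

open NumberField in
lemma gc_odd_aux (K : Type) [Field K] [NumberField K] [IsCyclotomicExtension {3} ℚ K] (r i : ℕ) (hr : r.Prime) (hr2 : r % 2 = 1) (Y : ℤ)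
    (h : (3 : ℤ) ^ (2 * i + 1) + 4 = Y ^ r) : False := by
  have hr0 := hr.ne_zero
  have hYo : Y % 2 = 1 := by
    have : Odd (Y ^ r) := by
      rw [← h]
      exact Odd.add_even (Odd.pow (by decide)) (by decide)
    rw [Int.odd_pow] at this
    exact Int.odd_iff.1 (this.resolve_right hr0)
  have hK2 : Module.finrank ℚ K = 2 := by
    rw [IsCyclotomicExtension.finrank (n := 3) K
      (Polynomial.cyclotomic.irreducible_rat (by norm_num))]
    rfl
  obtain ⟨s, hs⟩ : ∃ s : K, s ^ 2 = -((3 : ℕ) : K) := by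
    have hz := IsCyclotomicExtension.zeta_spec 3 ℚ K
    set ζ := IsCyclotomicExtension.zeta 3 ℚ K
    have h3 := hz.pow_eq_one
    have h1 : ζ ≠ 1 := hz.ne_one (by norm_num)
    have h4 : ζ ^ 2 + ζ + 1 = 0 := by
      apply mul_left_cancel₀ (sub_ne_zero.2 h1)
      linear_combination h3
    refine ⟨2 * ζ + 1, ?_⟩
    push_cast
    linear_combination 4 * h4
  have hpid : IsPrincipalIdealRing (𝓞 K) :=
    IsCyclotomicExtension.Rat.three_pid K
  have hm := qa_main K hK2 3 Nat.prime_three.prime.squarefree s hs 1 r r hr.pos hr.pos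
    (fun I => by rw [pow_one]; exact IsPrincipalIdealRing.principal I) (by simp) 2 Y (3 ^ i) hYo
    ⟨-(Y / 2), 1, by omega⟩ (by rw [← h]; push_cast; ring) (by norm_num)
  rcases hm with ⟨c, hc⟩ | ⟨h3, -⟩
  · obtain ⟨⟨a, b⟩, hc⟩ := zl_sign c _ r hr2 hc
    have hl := zl_lift (-((3 : ℕ) : ℤ)) (-((3 : ℕ) : ℤ) * b ^ 2) a b rfl r
    rw [hc] at hl
    simp only at hl
    have ho3 : Odd ((3 : ℤ) ^ i) := Odd.pow (by decide)
    rw [hl.2] at ho3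
    have hbo := (Int.odd_mul.1 ho3).1
    have hn := zs_norm (-((3 : ℕ) : ℤ)) a b r
    have hY2 : Odd (a ^ 2 - (-((3 : ℕ) : ℤ)) * b ^ 2) := by
      have : Odd ((a ^ 2 - (-((3 : ℕ) : ℤ)) * b ^ 2) ^ r) := by
        rw [← hn, hc]
        have : (2 : ℤ) ^ 2 - (-((3 : ℕ) : ℤ)) * (3 ^ i) ^ 2 = Y ^ r := by
          rw [← h]; push_cast; ring
        simp only
        rw [this]
        exact (Int.odd_iff.2 hYo).pow
      rw [Int.odd_pow] at this
      exact this.resolve_right hr0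
    have hae : Even a := by
      obtain ⟨j, hj⟩ := hbo
      obtain ⟨l, hl⟩ := hY2
      have : Even (a ^ 2) := ⟨l - 3 * (2 * j ^ 2 + 2 * j) - 1, by
        rw [hj] at hl; push_cast at hl; linarith⟩
      rw [Int.even_pow] at this
      exact this.1
    obtain ⟨m, hm⟩ : ∃ m, r = 2 * m + 1 := ⟨r / 2, by omega⟩
    obtain ⟨W, hW, -, -⟩ := zs_mod_a (-((3 : ℕ) : ℤ) * b ^ 2) a m
    rw [← hm, ← hl.1] at hW
    obtain ⟨a', ha'⟩ := hae
    have ha1 : a' * W = 1 := by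
      rw [ha'] at hW; linarith
    have ha2 : a = 2 := by
      rcases Int.eq_one_or_neg_one_of_mul_eq_one ha1 with h1 | h1
      · omega
      · exfalso
        have ha3 : a = -2 := by omega
        have h5 := (zs_mod_d (-((3 : ℕ) : ℤ) * b ^ 2) a r).1
        rw [← hl.1, ha3] at h5
        have h6 : (3 : ℤ) ∣ 2 - (-2) ^ r := dvd_trans ⟨-b ^ 2, by push_cast; ring⟩ h5
        have h7 : (3 : ℤ) ∣ (-2) ^ r - 1 ^ r := dvd_trans (by norm_num) (sub_dvd_pow_sub_pow (-2) 1 r)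
        rw [one_pow] at h7
        omega
    subst ha2
    exact gc_two_adic b (Int.odd_iff.1 hbo) r hr.one_lt hr2 (by rw [hc])
  · omega

lemma gc_odd (r i : ℕ) (hr : r.Prime) (hr2 : r % 2 = 1) (Y : ℤ)
    (h : (3 : ℤ) ^ (2 * i + 1) + 4 = Y ^ r) : False := by
  have h3 : IsCyclotomicExtension {3} ℚ (CyclotomicField 3 ℚ) := by
    convert CyclotomicField.isCyclotomicExtension 3 ℚ
    · rfl
    · exact Subsingleton.elim _ _
  exact gc_odd_aux (CyclotomicField 3 ℚ) r i hr hr2 Y h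

-- `3 ^ j + 4` is not a proper power of a prime power
lemma gc_main (j n : ℕ) (hj : 1 ≤ j) (z : ℤ)
    (hz : ∀ p q : ℕ, p.Prime → q.Prime → (p : ℤ) ∣ z → (q : ℤ) ∣ z → p = q)
    (h : (3 : ℤ) ^ j + 4 = z ^ n) : n = 1 := by
  by_contra hn1
  obtain ⟨r, hr, m, rfl⟩ := Nat.exists_prime_and_dvd hn1
  rw [mul_comm, pow_mul] at h
  rcases hr.eq_two_or_odd with rfl | hr2
  · have h9 : ∀ i : ℕ, (3 : ℤ) ^ (2 * i) % 8 = 1 := by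
      intro i
      have h7 : (8 : ℤ) ∣ (3 ^ 2) ^ i - 1 ^ i := dvd_trans (by norm_num) (sub_dvd_pow_sub_pow _ _ i)
      rw [one_pow, ← pow_mul] at h7
      omega
    have hs : (z ^ m) ^ 2 % 8 = 0 ∨ (z ^ m) ^ 2 % 8 = 1 ∨ (z ^ m) ^ 2 % 8 = 4 := by
      generalize z ^ m = w
      rcases (by omega : w % 8 = 0 ∨ w % 8 = 1 ∨ w % 8 = 2 ∨ w % 8 = 3 ∨ w % 8 = 4 ∨ w % 8 = 5 ∨ w % 8 = 6 ∨ w % 8 = 7)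
        with h | h | h | h | h | h | h | h <;> simp [pow_two, Int.mul_emod, h]
    obtain ⟨i, hi | hi⟩ := Nat.even_or_odd' j
    · have := h9 i
      rw [← hi] at this
      omega
    · have := h9 i
      rw [hi, pow_succ] at h
      omega
  · obtain ⟨i, hi | hi⟩ := Nat.even_or_odd' j
    · refine gc_even r i hr hr2 (by omega) (z ^ m) ?_ (by rw [← hi]; exact h)
      intro p q hp hq h1 h2
      exact hz p q hp hq (Int.Prime.dvd_pow' hp h1) (Int.Prime.dvd_pow' hq h2)
    · exact gc_odd r i hr hr2 (z ^ m) (by rw [← hi]; exact h)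

lemma fb_no_common (P n : ℕ) (x y k : ℤ) (hcop : IsCoprime x y) (heq : x ^ 2 + P * k ^ 2 = y ^ n)
    (q : ℕ) (hq : q.Prime) (h1 : (q : ℤ) ∣ x) (h2 : (q : ℤ) ∣ k) : False := by
  have h3 : (q : ℤ) ∣ y ^ n := by
    rw [← heq]
    exact dvd_add (dvd_pow h1 two_ne_zero) (Dvd.dvd.mul_left (dvd_pow h2 two_ne_zero) _)
  have h4 := Int.Prime.dvd_pow' hq h3
  have := hcop.isUnit_of_dvd' h1 h4
  rw [Int.ofNat_isUnit, Nat.isUnit_iff] at this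
  exact hq.one_lt.ne' this

lemma fb_rank (P n L : ℕ) (x y k : ℤ) (hcop : IsCoprime x y) (heq : x ^ 2 + P * k ^ 2 = y ^ n)
    (hL : ∀ q : ℕ, q.Prime → q ≠ 2 → (q : ℤ) ∣ k → ¬ q ∣ P →
      ((q : ℤ) - jacobiSym (-(P : ℤ)) q).toNat ∣ L)
    (c : ℤ√(-(P : ℤ))) (T : ℕ) (hT : T ≠ 0) (hc : c ^ T = ⟨x, k⟩) (r t : ℕ) (hr : r.Prime) (q : ℕ) (hq : q.Prime)
    (hq2 : q ≠ 2) (hqk : (q : ℤ) ∣ k) (hqP : ¬ q ∣ P)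
    (h1 : (q : ℤ) ∣ (c ^ (r ^ (t + 1))).im) (h2 : ¬ (q : ℤ) ∣ (c ^ (r ^ t)).im) : r ^ (t + 1) ∣ L := by
  refine dvd_trans (rank_lemma (-(P : ℤ)) c q hq hq2 ?_ ?_ r t hr h1 h2) (hL q hq hq2 hqk hqP)
  · rw [Int.dvd_neg]
    exact_mod_cast hqP
  · intro h3
    obtain ⟨a, b⟩ := c
    have h4 := zs_norm (-(P : ℤ)) a b T
    rw [hc] at h4
    simp only at h4 h3
    have h5 : (q : ℤ) ∣ x ^ 2 - (-(P : ℤ)) * k ^ 2 := by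
      rw [h4]; exact dvd_pow h3 hT
    have h6 : (q : ℤ) ∣ x ^ 2 := by
      have := dvd_add h5 (Dvd.dvd.mul_left (dvd_pow hqk two_ne_zero) (-(P : ℤ)))
      simpa using this
    exact fb_no_common P n x y k hcop heq q hq (Int.Prime.dvd_pow' hq h6) hqk

lemma fb_odd (P n L : ℕ) (hP : 0 < P) (x y k : ℤ) (hx2 : x % 2 = 1) (hy2 : y % 2 = 1) (hk0 : k ≠ 0)
    (hxprime : ∀ p q : ℕ, p.Prime → q.Prime → (p : ℤ) ∣ x → (q : ℤ) ∣ x → p = q)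
    (hyprime : ∀ p q : ℕ, p.Prime → q.Prime → (p : ℤ) ∣ y → (q : ℤ) ∣ y → p = q)
    (hcop : IsCoprime x y) (heq : x ^ 2 + P * k ^ 2 = y ^ n)
    (hexc2 : ¬ (x.natAbs = 401 ∧ y.natAbs = 11 ∧ n = 5))
    (hL : ∀ q : ℕ, q.Prime → q ≠ 2 → (q : ℤ) ∣ k → ¬ q ∣ P →
      ((q : ℤ) - jacobiSym (-(P : ℤ)) q).toNat ∣ L)
    (r t : ℕ) (hr : r.Prime) (hr2 : r % 2 = 1) (hrn : r ∣ n) (c : ℤ√(-(P : ℤ)))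
    (hc : c ^ (r ^ (t + 1)) = ⟨x, k⟩) : n = 3 ∨ r ^ (t + 1) ∣ L := by
  by_cases hrL : r ^ (t + 1) ∣ L
  · exact Or.inr hrL
  left
  obtain ⟨a, b, hab⟩ : ∃ a b, c ^ (r ^ t) = ⟨a, b⟩ := ⟨_, _, rfl⟩
  have hc1 : (⟨a, b⟩ : ℤ√(-(P : ℤ))) ^ r = ⟨x, k⟩ := by rw [← hab, ← pow_mul, ← pow_succ, hc]
  obtain ⟨D, hD⟩ : ∃ D : ℕ, D = P * b.natAbs ^ 2 := ⟨_, rfl⟩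
  have hDb : (D : ℤ) = P * b ^ 2 := by rw [hD]; push_cast; rw [sq_abs]
  have hl := zl_lift (-(P : ℤ)) (-(D : ℤ)) a b (by rw [hDb]; ring) r
  rw [hc1] at hl
  simp only at hl
  have hb0 : b ≠ 0 := by
    rintro rfl
    rw [zero_mul] at hl
    exact hk0 hl.2
  have hD0 : 0 < D := by rw [hD]; positivity
  have hYr : (a ^ 2 + D) ^ r = y ^ n := by
    have := zs_norm (-(P : ℤ)) a b r
    rw [hc1] at this
    simp only at this
    rw [← heq, hDb]
    rw [show a ^ 2 + (P : ℤ) * b ^ 2 = a ^ 2 - -(P : ℤ) * b ^ 2 by ring, ← this]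
    ring
  have hYo : Odd (a ^ 2 + (D : ℤ)) := by
    have : Odd ((a ^ 2 + (D : ℤ)) ^ r) := by rw [hYr]; exact (Int.odd_iff.2 hy2).pow
    rw [Int.odd_pow] at this
    exact this.resolve_right hr.ne_zero
  obtain ⟨m, hm⟩ : ∃ m, r = 2 * m + 1 := ⟨r / 2, by omega⟩
  obtain ⟨W, hW, -, -⟩ := zs_mod_a (-(D : ℤ)) a m
  rw [← hm, ← hl.1] at hW
  have hao : Odd a := by
    have := Int.odd_iff.2 hx2
    rw [hW] at this
    exact (Int.odd_mul.1 this).1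
  have hDe : 2 ∣ D := by
    have : Even (D : ℤ) := by
      rw [Int.odd_add] at hYo
      exact hYo.1 hao.pow
    have := even_iff_two_dvd.1 this
    exact_mod_cast this
  have hcopaD : IsCoprime a (D : ℤ) := by
    have h1 : IsCoprime x (a ^ 2 + (D : ℤ)) := by
      have : IsCoprime x ((a ^ 2 + (D : ℤ)) ^ r) := by rw [hYr]; exact hcop.pow_right
      exact (IsCoprime.pow_right_iff hr.pos).1 this
    have h2 : IsCoprime a ((D : ℤ) + a * a) := by
      have := IsCoprime.of_isCoprime_of_dvd_left h1 (Dvd.intro W hW.symm)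
      rwa [add_comm, pow_two] at this
    exact h2.of_add_mul_left_right
  obtain ⟨n', hn'⟩ := hrn
  have hY : a ^ 2 + (D : ℤ) = y ^ n' := by
    apply zl_pow_inj _ _ r hr2
    rw [hYr, hn', mul_comm, pow_mul]
  have hone : ∀ p : ℕ, p.Prime → (p : ℤ) = y ^ n' → n' = 1 ∧ y.natAbs = p := by
    intro p hp h
    have h1 := congrArg Int.natAbs h
    rw [Int.natAbs_natCast, Int.natAbs_pow] at h1
    have h2 : n' = 1 := by
      rw [h1] at hp
      exact hp.eq_one_of_pow
    exact ⟨h2, by rw [h1, h2, pow_one]⟩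
  obtain ⟨ha1, hcase⟩ := sit_S r hr hr2 D hD0 hDe a (Int.odd_iff.1 hao) hcopaD
    (by rw [← hl.1]; exact hxprime)
    (by
      intro p q hp hq h1 h2
      have e : ∀ p : ℕ, p.Prime → (p : ℤ) ∣ a ^ 2 + D → (p : ℤ) ∣ y := by
        intro p hp h1
        have : (p : ℤ) ∣ y ^ n := by rw [← hYr]; exact dvd_pow h1 hr.ne_zero
        exact Int.Prime.dvd_pow' hp this
      exact hyprime p q hp hq (e p hp h1) (e q hq h2))
    (by
      intro q hq hqU
      right
      by_contra hqD
      have hqP : ¬ q ∣ P := fun h => hqD (by rw [hD]; exact Dvd.dvd.mul_right h _)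
      have hqb : ¬ (q : ℤ) ∣ b := by
        intro h
        apply hqD
        have : (q : ℤ) ∣ D := by
          rw [hDb]
          exact Dvd.dvd.mul_left (dvd_pow h two_ne_zero) _
        exact_mod_cast this
      have hq2 : q ≠ 2 := by rintro rfl; exact hqD hDe
      have hqk : (q : ℤ) ∣ k := by rw [hl.2]; exact Dvd.dvd.mul_left hqU _
      exact hrL (fb_rank P n L x y k hcop heq hL c (r ^ (t + 1)) (pow_ne_zero _ hr.ne_zero) hc r t hr q hq hq2
        hqk hqP (by rw [hc]; exact hqk) (by rw [hab]; exact hqb)))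
  rcases hcase with ⟨rfl, h⟩ | ⟨rfl, h⟩ | ⟨rfl, h⟩ | ⟨rfl, j, hj, h⟩
  · have := hone 3 Nat.prime_three (by rw [← hY, ha1, h]; rfl)
    omega
  · have := hone 5 Nat.prime_five (by rw [← hY, ha1, h]; rfl)
    omega
  · exfalso
    have := hone 11 (by norm_num) (by rw [← hY, ha1, h]; rfl)
    refine hexc2 ⟨?_, this.2, by omega⟩
    have h3 := hl.1
    rw [h] at h3
    simp [pow_succ] at h3
    rcases (by simpa using ha1 : a = 1 ∨ a = -1) with h | h <;> subst h <;> omega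
  · have := gc_main j n' hj y hyprime (by rw [← hY, ha1, h]; push_cast; ring)
    omega

lemma fb_two (P n L : ℕ) (hP : 0 < P) (x y k : ℤ) (hx2 : x % 2 = 1) (hy2 : y % 2 = 1) (hk0 : k ≠ 0)
    (hcop : IsCoprime x y) (heq : x ^ 2 + P * k ^ 2 = y ^ n)
    (hexc1 : ¬ (x.natAbs = 7 ∧ y.natAbs = 3 ∧ n = 4))
    (hL : ∀ q : ℕ, q.Prime → q ≠ 2 → (q : ℤ) ∣ k → ¬ q ∣ P →
      ((q : ℤ) - jacobiSym (-(P : ℤ)) q).toNat ∣ L)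
    (hL2 : P % 2 = 1 → (2 : ℤ) ∣ k → 2 ∣ L)
    (t : ℕ) (hrn : 4 ∣ n) (c : ℤ√(-(P : ℤ)))
    (hc : c ^ (2 ^ (t + 2)) = ⟨x, k⟩) : 2 ^ (t + 2) ∣ 2 * L := by
  by_contra hnot
  have hn1 : ¬ 2 ^ (t + 1) ∣ L := fun h => hnot (by rw [pow_succ' 2 (t + 1)]; exact mul_dvd_mul_left 2 h)
  have hn2 : ¬ 2 ^ (t + 1 + 1) ∣ L := fun h => hnot (Dvd.dvd.mul_left h _)
  obtain ⟨a, b, hab⟩ : ∃ a b, c ^ (2 ^ t) = ⟨a, b⟩ := ⟨_, _, rfl⟩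
  obtain ⟨a3, ha3⟩ : ∃ a3, a3 = a ^ 2 - P * b ^ 2 := ⟨_, rfl⟩
  obtain ⟨b3, hb3⟩ : ∃ b3, b3 = 2 * a * b := ⟨_, rfl⟩
  have hsq : ∀ a b : ℤ, (⟨a, b⟩ : ℤ√(-(P : ℤ))) ^ 2 = ⟨a ^ 2 - P * b ^ 2, 2 * a * b⟩ := by
    intro a b
    rw [pow_two]
    apply Zsqrtd.ext
    · rw [Zsqrtd.re_mul]; ring
    · rw [Zsqrtd.im_mul]; ring
  have hab3 : c ^ (2 ^ (t + 1)) = ⟨a3, b3⟩ := by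
    rw [pow_succ, pow_mul, hab, hsq, ha3, hb3]
  have habx : (⟨x, k⟩ : ℤ√(-(P : ℤ))) = ⟨a3 ^ 2 - P * b3 ^ 2, 2 * a3 * b3⟩ := by
    rw [← hc, ← hsq, ← hab3, ← pow_mul, ← pow_succ]
  have hx : x = a3 ^ 2 - P * b3 ^ 2 := congrArg Zsqrtd.re habx
  have hk : k = 2 * a3 * b3 := congrArg Zsqrtd.im habx
  have hN : (a ^ 2 + P * b ^ 2) ^ 4 = y ^ n := by
    rw [← heq, hx, hk, hb3, ha3]; ring
  have hNo : Odd (a ^ 2 + P * b ^ 2) := by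
    have : Odd ((a ^ 2 + P * b ^ 2) ^ 4) := by rw [hN]; exact (Int.odd_iff.2 hy2).pow
    rw [Int.odd_pow] at this
    exact this.resolve_right (by norm_num)
  have hT0 : 2 ^ (t + 2) ≠ 0 := by positivity
  have ha3o : Odd a3 := by
    have h1 : Odd x := Int.odd_iff.2 hx2
    rw [hx, hb3, Int.odd_sub] at h1
    have h2 : Even ((P : ℤ) * (2 * a * b) ^ 2) := ⟨P * 2 * (a * b) ^ 2, by ring⟩
    have h3 := h1.2 h2
    rw [Int.odd_pow] at h3
    exact h3.resolve_right (by norm_num)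
  -- no odd prime divides a3
  have hodd1 : ∀ z : ℤ, Odd z → (∀ q : ℕ, q.Prime → q ≠ 2 → ¬ (q : ℤ) ∣ z) → z = 1 ∨ z = -1 := by
    intro z hz h
    have h1 : z.natAbs = 1 := by
      by_contra h1
      obtain ⟨q, hq, hqz⟩ := Nat.exists_prime_and_dvd h1
      have hqz' : (q : ℤ) ∣ z := Int.natCast_dvd.2 hqz
      refine h q hq ?_ hqz'
      rintro rfl
      exact Int.not_even_iff_odd.2 hz (even_iff_two_dvd.2 hqz')
    omega
  have hA3 : a3 = 1 ∨ a3 = -1 := by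
    apply hodd1 a3 ha3o
    intro q hq hq2 hqa
    have hqk : (q : ℤ) ∣ k := by rw [hk]; exact Dvd.dvd.mul_right (Dvd.dvd.mul_left hqa _) _
    have hqx : ¬ (q : ℤ) ∣ P * b3 ^ 2 := by
      intro h
      refine fb_no_common P n x y k hcop heq q hq ?_ hqk
      rw [hx]
      exact dvd_sub (dvd_pow hqa two_ne_zero) h
    refine hn2 (fb_rank P n L x y k hcop heq hL c _ hT0 hc 2 (t + 1) Nat.prime_two q hq hq2 hqk ?_ ?_ ?_)
    · intro h
      exact hqx (Dvd.dvd.mul_right (by exact_mod_cast h) _)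
    · rw [hc]; exact hqk
    · rw [hab3]
      intro h
      exact hqx (Dvd.dvd.mul_left (dvd_pow h two_ne_zero) _)
  rcases Int.even_or_odd a with hae | hao
  · -- a even
    have h1 : Odd ((P : ℤ) * b ^ 2) := by
      rw [Int.odd_add'] at hNo
      exact hNo.2 (hae.pow_of_ne_zero two_ne_zero)
    have hPo : P % 2 = 1 := by
      have := Int.odd_iff.1 (Int.odd_mul.1 h1).1
      omega
    have hLL := hL2 hPo (by rw [hk, mul_assoc]; exact Dvd.intro _ rfl)
    have ht : t = 0 := by
      by_contra ht
      obtain ⟨t', rfl⟩ := Nat.exists_eq_succ_of_ne_zero ht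
      obtain ⟨a', b', hab'⟩ : ∃ a b, c ^ (2 ^ t') = ⟨a, b⟩ := ⟨_, _, rfl⟩
      have h2 : (⟨a, b⟩ : ℤ√(-(P : ℤ))) = ⟨a' ^ 2 - P * b' ^ 2, 2 * a' * b'⟩ := by
        rw [← hab, Nat.succ_eq_add_one, pow_succ, pow_mul, hab', hsq]
      have h3 : a = a' ^ 2 - P * b' ^ 2 := congrArg Zsqrtd.re h2
      have h4 : b = 2 * a' * b' := congrArg Zsqrtd.im h2
      have h5 : Even b := ⟨a' * b', by rw [h4]; ring⟩
      have h6 := (Int.odd_mul.1 h1).2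
      rw [Int.odd_pow] at h6
      exact Int.not_even_iff_odd.2 (h6.resolve_right (by norm_num)) h5
    subst ht
    exact hnot (by rw [zero_add, pow_two]; exact mul_dvd_mul_left 2 hLL)
  · have hA : a = 1 ∨ a = -1 := by
      apply hodd1 a hao
      intro q hq hq2 hqa
      have hqb3 : (q : ℤ) ∣ b3 := by rw [hb3]; exact Dvd.dvd.mul_right (Dvd.dvd.mul_left hqa _) _
      have hqk : (q : ℤ) ∣ k := by rw [hk]; exact Dvd.dvd.mul_left hqb3 _
      have hqx : ¬ (q : ℤ) ∣ P * b ^ 2 := by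
        intro h
        refine fb_no_common P n x y k hcop heq q hq ?_ hqk
        rw [hx]
        refine dvd_sub (dvd_pow ?_ two_ne_zero) (Dvd.dvd.mul_left (dvd_pow hqb3 two_ne_zero) _)
        rw [ha3]
        exact dvd_sub (dvd_pow hqa two_ne_zero) h
      refine hn1 (fb_rank P n L x y k hcop heq hL c _ hT0 hc 2 t Nat.prime_two q hq hq2 hqk ?_ ?_ ?_)
      · intro h
        exact hqx (Dvd.dvd.mul_right (by exact_mod_cast h) _)
      · rw [hab3]; exact hqb3
      · rw [hab]
        intro h
        exact hqx (Dvd.dvd.mul_left (dvd_pow h two_ne_zero) _)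
    have ha2 : a ^ 2 = 1 := by rcases hA with h | h <;> rw [h] <;> rfl
    have hb0 : b ≠ 0 := by
      rintro rfl
      apply hk0
      rw [hk, hb3]; ring
    have hPb : (P : ℤ) * b ^ 2 = 2 := by
      have h1 : 0 < (P : ℤ) * b ^ 2 := by positivity
      rw [ha2] at ha3
      rcases hA3 with h | h <;> omega
    have hx7 : x = -7 := by
      have e : x = (a ^ 2 - P * b ^ 2) ^ 2 - 4 * a ^ 2 * (P * b ^ 2) := by rw [hx, ha3, hb3]; ring
      rw [hPb, ha2] at e
      omega
    rw [hPb, ha2] at hN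
    obtain ⟨m, hm⟩ := hrn
    have h3 : y.natAbs ^ m = 3 := by
      have h1 := congrArg Int.natAbs hN
      rw [hm, mul_comm, pow_mul, Int.natAbs_pow, Int.natAbs_pow, Int.natAbs_pow] at h1
      have := Nat.pow_left_injective (n := 4) (by norm_num) h1
      simpa using this.symm
    have hm1 : m = 1 := by
      have hp := Nat.prime_three
      rw [← h3] at hp
      exact hp.eq_one_of_pow
    refine hexc1 ⟨by rw [hx7]; rfl, by simpa [hm1] using h3, by omega⟩

theorem x_sq_add_C_eq_y_pow
    (C : ℕ) (hC : 0 < C) (hCeven : 2 ∣ C)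
    -- P is the squarefree part of C : P squarefree and C/P a perfect square
    (P : ℕ) (hPsf : Squarefree P) (hPsq : ∃ k : ℕ, C = P * k ^ 2)
    -- P * Q is the largest squarefree divisor (radical) of C
    (Q : ℕ) (hPQsf : Squarefree (P * Q)) (hPQdvd : P * Q ∣ C)
    (hPQmax : ∀ d : ℕ, Squarefree d → d ∣ C → d ∣ P * Q)
    -- u = 1 if 3 < P ≡ 3 (mod 8), else u = 0
    (u : ℕ) (hu : u = if 3 < P ∧ P % 8 = 3 then 1 else 0)
    -- K = ℚ(√-P), a quadratic field containing a square root of -P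
    (K : Type) [Field K] [NumberField K]
    (hK2 : Module.finrank ℚ K = 2) (hKP : ∃ α : K, α ^ 2 = -(P : K))
    -- h = h(-P), the least positive integer such that the h-th power of every
    -- ideal of the ring of integers of K is principal
    (h : ℕ) (hh : 0 < h)
    (hhprinc : ∀ I : Ideal (NumberField.RingOfIntegers K), (I ^ h).IsPrincipal)
    (hhleast : ∀ h' : ℕ, 0 < h' →
      (∀ I : Ideal (NumberField.RingOfIntegers K), (I ^ h').IsPrincipal) → h ≤ h')
    -- χ q is the Legendre symbol (-P/q) for odd primes q, and χ 2 = 0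
    (χ : ℕ → ℤ) (hχ : ∀ q : ℕ, χ q = if q = 2 then 0 else jacobiSym (-(P : ℤ)) q)
    -- L = lcm of q - χ q over the primes q dividing Q (L = 1 if there are none)
    (L : ℕ) (hL : L = Q.primeFactors.lcm fun q => ((q : ℤ) - χ q).toNat)
    (N : ℕ) (hN : N = 2 * 3 ^ u * h * L)
    -- x, y nonzero, each divisible by at most one prime, coprime
    (x y : ℤ) (hx : x ≠ 0) (hy : y ≠ 0)
    (hxprime : ∀ p q : ℕ, p.Prime → q.Prime → (p : ℤ) ∣ x → (q : ℤ) ∣ x → p = q)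
    (hyprime : ∀ p q : ℕ, p.Prime → q.Prime → (p : ℤ) ∣ y → (q : ℤ) ∣ y → p = q)
    (hcop : IsCoprime x y)
    (n : ℕ) (hn : 0 < n)
    (heq : x ^ 2 + (C : ℤ) = y ^ n)
    (hexc1 : ¬(x.natAbs = 7 ∧ y.natAbs = 3 ∧ n = 4))
    (hexc2 : ¬(x.natAbs = 401 ∧ y.natAbs = 11 ∧ n = 5)) :
    n = 3 ∨ n ∣ N := by
  by_cases hn3 : n = 3
  · exact Or.inl hn3
  right
  obtain ⟨k, hCk⟩ := hPsq
  obtain ⟨s, hs⟩ := hKP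
  have hP0 : 0 < P := Nat.pos_of_ne_zero hPsf.ne_zero
  have hk0 : (k : ℤ) ≠ 0 := by
    have : k ≠ 0 := by
      rintro rfl
      simp at hCk
      omega
    exact_mod_cast this
  have hCe : Even (C : ℤ) := by exact_mod_cast even_iff_two_dvd.2 hCeven
  have hxo : Odd x := by
    rw [← Int.not_even_iff_odd]
    intro hxe
    have h1 : Even (y ^ n) := by
      rw [← heq]
      exact (hxe.pow_of_ne_zero two_ne_zero).add hCe
    rw [Int.even_pow] at h1
    have := hcop.isUnit_of_dvd' (even_iff_two_dvd.1 hxe) (even_iff_two_dvd.1 h1.1)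
    rw [Int.isUnit_iff] at this
    omega
  have hyo : Odd y := by
    have h1 : Odd (y ^ n) := by
      rw [← heq]
      exact hxo.pow.add_even hCe
    rw [Int.odd_pow] at h1
    exact h1.resolve_right hn.ne'
  have heq' : x ^ 2 + (P : ℤ) * (k : ℤ) ^ 2 = y ^ n := by
    rw [← heq, hCk]; push_cast; rfl
  have heqn : (-x) ^ 2 + (P : ℤ) * (-(k : ℤ)) ^ 2 = y ^ n := by
    rw [← heq']; ring
  have hx2 := Int.odd_iff.1 hxo
  have hy2 := Int.odd_iff.1 hyo
  have hP1 : P = 1 → (k : ℤ) % 2 = 0 := by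
    rintro rfl
    rw [hCk, one_mul] at hCeven
    have := Nat.prime_two.dvd_of_dvd_pow hCeven
    omega
  have hQ0 : Q ≠ 0 := by
    rintro rfl
    simp at hPQsf
  have hLq : ∀ q : ℕ, q.Prime → q ∣ k → ¬ q ∣ P → ((q : ℤ) - χ q).toNat ∣ L := by
    intro q hq hqk hqP
    have h1 : q ∣ P * Q := hPQmax q hq.prime.squarefree (by
      rw [hCk]; exact Dvd.dvd.mul_left (dvd_pow hqk two_ne_zero) _)
    have h2 : q ∣ Q := (hq.dvd_mul.1 h1).resolve_left hqP
    rw [hL]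
    exact Finset.dvd_lcm (f := fun q : ℕ => ((q : ℤ) - χ q).toNat)
      (Nat.mem_primeFactors.2 ⟨hq, h2, hQ0⟩)
  have hL1 : ∀ q : ℕ, q.Prime → q ≠ 2 → (q : ℤ) ∣ (k : ℤ) → ¬ q ∣ P →
      ((q : ℤ) - jacobiSym (-(P : ℤ)) q).toNat ∣ L := by
    intro q hq hq2 hqk hqP
    have := hLq q hq (by exact_mod_cast hqk) hqP
    rwa [hχ q, if_neg hq2] at this
  have hL2 : P % 2 = 1 → (2 : ℤ) ∣ (k : ℤ) → 2 ∣ L := by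
    intro hP2 h2k
    have := hLq 2 Nat.prime_two (by exact_mod_cast h2k) (by omega)
    rw [hχ 2, if_pos rfl] at this
    exact this
  obtain ⟨n0, hn0⟩ : ∃ n0, n = Nat.gcd h n * n0 := Nat.gcd_dvd_right h n
  suffices hmain : n0 ∣ 2 * 3 ^ u * L by
    rw [hN, hn0]
    have := mul_dvd_mul (Nat.gcd_dvd_left h n) hmain
    rwa [show 2 * 3 ^ u * h * L = h * (2 * 3 ^ u * L) by ring]
  rw [Nat.dvd_iff_prime_pow_dvd_dvd]
  intro r t hr hrt
  have hT : r ^ t * Nat.gcd h n ∣ n := by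
    conv_rhs => rw [hn0]
    rw [mul_comm]
    exact mul_dvd_mul_left _ hrt
  have hTn : r ^ t ∣ n := dvd_trans (Dvd.intro _ rfl) hT
  have hqa := qa_main K hK2 P hPsf s hs h n (r ^ t) hn (pow_pos hr.pos t) hhprinc hT x y k hy2 hcop
    heq' hP1
  -- the odd prime engine
  have hodd : ∀ t' : ℕ, r % 2 = 1 → r ∣ n → (∃ c : ℤ√(-(P : ℤ)), c ^ (r ^ t') = ⟨x, k⟩ ∨
      c ^ (r ^ t') = -⟨x, k⟩) → r ^ t' ∣ L := by
    rintro t' hr2 hrn ⟨c, hc⟩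
    obtain ⟨c, hc⟩ := zl_sign c _ _ (by rw [← Nat.odd_iff] at hr2 ⊢; exact hr2.pow) hc
    rcases t' with _ | t'
    · simp
    · exact (fb_odd P n L hP0 x y k hx2 hy2 hk0 hxprime hyprime hcop heq' hexc2 hL1 r t' hr hr2 hrn
        c hc).resolve_left hn3
  rcases Nat.eq_zero_or_pos t with rfl | ht
  · simp
  have hrn : r ∣ n := dvd_trans (dvd_pow_self r ht.ne') hTn
  rcases hr.eq_two_or_odd with rfl | hr2
  · -- r = 2
    rcases hqa with ⟨c, hc⟩ | ⟨-, -, h3, -⟩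
    · rcases (show t = 1 ∨ ∃ t', t = t' + 2 from by
        rcases Nat.lt_or_ge t 2 with h | h
        · left; omega
        · right; exact ⟨t - 2, by omega⟩) with rfl | ⟨t', rfl⟩
      · rw [pow_one, mul_assoc]
        exact Dvd.intro _ rfl
      · have h4 : 4 ∣ n := dvd_trans (by rw [pow_add]; exact Dvd.intro_left _ rfl) hTn
        have : 2 ^ (t' + 2) ∣ 2 * L := by
          rcases hc with hc | hc
          · exact fb_two P n L hP0 x y k hx2 hy2 hk0 hcop heq' hexc1 hL1 hL2 t' h4 c hc
          · refine fb_two P n L hP0 (-x) y (-k) (by omega) hy2 (neg_ne_zero.2 hk0) hcop.neg_left heqn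
              (by rwa [Int.natAbs_neg]) ?_ ?_ t' h4 c ?_
            · intro q hq hq2 hqk
              exact hL1 q hq hq2 ((Int.dvd_neg).1 hqk)
            · intro h1 h2
              exact hL2 h1 ((Int.dvd_neg).1 h2)
            · rw [hc]; rfl
        exact dvd_trans this ⟨3 ^ u, by ring⟩
    · exfalso
      have := (Nat.prime_dvd_prime_iff_eq Nat.prime_three Nat.prime_two).1
        (Nat.prime_three.dvd_of_dvd_pow h3)
      omega
  · rcases hqa with hc | ⟨hP3, hP8, h3, hc⟩
    · exact Dvd.dvd.mul_left (hodd t hr2 hrn hc) _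
    · have hr3 : r = 3 := ((Nat.prime_dvd_prime_iff_eq Nat.prime_three hr).1
        (Nat.prime_three.dvd_of_dvd_pow h3)).symm
      obtain ⟨t', rfl⟩ : ∃ t', t = t' + 1 := ⟨t - 1, by omega⟩
      have hu1 : u = 1 := by rw [hu, if_pos ⟨hP3, hP8⟩]
      have hdiv : r ^ (t' + 1) / 3 = r ^ t' := by
        rw [hr3, pow_succ]
        exact Nat.mul_div_cancel _ (by norm_num)
      rw [hdiv] at hc
      have := hodd t' hr2 hrn hc
      rw [hu1, pow_one, pow_succ, hr3]
      rw [hr3] at this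
      obtain ⟨w, hw⟩ := this
      exact ⟨2 * w, by rw [hw]; ring⟩
end
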